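/- Under the conditions of the main theorem (conditions (★)), as n → ∞, miss(d,X) = exp( λX/((1−λ)n) + λX₂/(2(1−λ)n) + λ(1−2λ)X₃/(6(1−λ)²n²) + λX²/((1−λ)n²) − D/(λ(1−λ)n²) − C_{1,1}/((1−λ)n) − (1−2λ)C_{1,2}/(2(1−λ)²n²) − C_{2,1}/(2(1−λ)²n²) + O(n^{−b}) ). -/

import Mathlib

open Filter Finset Asymptotics MeasureTheory
open scoped Classical Topology

noncomputable section

/-- The number of simple graphs on `Fin n` with degree sequence `d` having
no edge in common with the graph `X`. -/
def gCount {n : ℕ} (d : Fin n → ℕ) (X : SimpleGraph (Fin n)) : ℕ :=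
  Nat.card {H : SimpleGraph (Fin n) //
    (∀ v, Nat.card (H.neighborSet v) = d v) ∧ Disjoint H.edgeSet X.edgeSet}

/-- The degree `x_j` of vertex `j` in the graph `X`. -/
def xDeg {n : ℕ} (X : SimpleGraph (Fin n)) (j : Fin n) : ℕ :=
  Nat.card (X.neighborSet j)

/-- The number of edges of `X`. -/
def xEdges {n : ℕ} (X : SimpleGraph (Fin n)) : ℕ := Nat.card X.edgeSet

/-- The average degree `d̄ = 2E/n`. -/
def dBar {n : ℕ} (d : Fin n → ℕ) : ℝ := (∑ j, (d j : ℝ)) / n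

/-- The density `λ = d̄/(n-1)`. -/
def lamb {n : ℕ} (d : Fin n → ℕ) : ℝ := dBar d / ((n : ℝ) - 1)

/-- `A = λ(1-λ)/2`. -/
def aPar {n : ℕ} (d : Fin n → ℕ) : ℝ := lamb d * (1 - lamb d) / 2

/-- `δ_j = d_j - d̄ + λ x_j`. -/
def deltaPar {n : ℕ} (d : Fin n → ℕ) (X : SimpleGraph (Fin n)) (j : Fin n) : ℝ :=
  (d j : ℝ) - dBar d + lamb d * (xDeg X j : ℝ)

/-- The sum over unordered pairs `{j,k}` with `X.Adj j k` of `f j * f k`. -/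
def pairSum {n : ℕ} (X : SimpleGraph (Fin n)) (f : Fin n → ℝ) : ℝ :=
  (∑ j, ∑ k, if X.Adj j k then f j * f k else 0) / 2

/-- `R = Σ_j (d_j - d̄)²`. -/
def rPar {n : ℕ} (d : Fin n → ℕ) : ℝ := ∑ j, ((d j : ℝ) - dBar d)^2

/-- The naive estimate `Ĝ(d,X)`. -/
def gHat {n : ℕ} (d : Fin n → ℕ) (X : SimpleGraph (Fin n)) : ℝ :=
  (1 - lamb d) ^ (-(xEdges X : ℝ)) *
  (lamb d ^ lamb d * (1 - lamb d) ^ (1 - lamb d)) ^ n.choose 2 *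
  ∏ j, ((n - 1 - xDeg X j).choose (d j) : ℝ)

/-- `X_ℓ = Σ_j x_j^ℓ`. -/
def xPow {n : ℕ} (X : SimpleGraph (Fin n)) (ℓ : ℕ) : ℝ := ∑ j, (xDeg X j : ℝ)^ℓ

/-- `C_{ℓ,m} = Σ_j δ_j^ℓ x_j^m`. -/
def cPar {n : ℕ} (d : Fin n → ℕ) (X : SimpleGraph (Fin n)) (ℓ m : ℕ) : ℝ :=
  ∑ j, (deltaPar d X j)^ℓ * (xDeg X j : ℝ)^m

/-- `miss(d,X) = G(d,X) / ((1-λ)^X G(d))`. -/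
def missPar {n : ℕ} (d : Fin n → ℕ) (X : SimpleGraph (Fin n)) : ℝ :=
  (gCount d X : ℝ) / ((1 - lamb d) ^ xEdges X * (gCount d ⊥ : ℝ))

/-- `hit(d,X) = G(d-x,X) / (λ^X G(d))`. -/
def hitPar {n : ℕ} (d : Fin n → ℕ) (X : SimpleGraph (Fin n)) : ℝ :=
  (gCount (fun j => d j - xDeg X j) X : ℝ) / (lamb d ^ xEdges X * (gCount d ⊥ : ℝ))

/-- The degree of `v` in `H`, as an integer. -/
def dg {n : ℕ} (H : SimpleGraph (Fin n)) (v : Fin n) : ℤ := ∑ u, if H.Adj v u then 1 else 0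

/-- The graphs with degree sequence `d` that have no edge in common with `Y`. -/
def cls {n : ℕ} (Y : SimpleGraph (Fin n)) (d : Fin n → ℤ) : Finset (SimpleGraph (Fin n)) :=
  univ.filter fun H => (∀ v, dg H v = d v) ∧ ∀ i j, H.Adj i j → ¬ Y.Adj i j

/-- The number of graphs with degree sequence `d` that have no edge in common with `Y`. -/
def cnt {n : ℕ} (Y : SimpleGraph (Fin n)) (d : Fin n → ℤ) : ℝ := ((cls Y d).card : ℝ)

/-- The indicator vector of a vertex. -/
abbrev uv {n : ℕ} (a : Fin n) : Fin n → ℤ := Pi.single a 1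

/-- Adding the edge `ab`. -/
abbrev ad {n : ℕ} (Y : SimpleGraph (Fin n)) (a b : Fin n) : SimpleGraph (Fin n) :=
  Y ⊔ SimpleGraph.edge a b

section Counting

variable {n : ℕ}

lemma mem_cls {Y H : SimpleGraph (Fin n)} {d : Fin n → ℤ} :
    H ∈ cls Y d ↔ (∀ v, dg H v = d v) ∧ ∀ i j, H.Adj i j → ¬ Y.Adj i j := by
  simp [cls]

lemma cnt_nonneg (Y : SimpleGraph (Fin n)) (d : Fin n → ℤ) : 0 ≤ cnt Y d := Nat.cast_nonneg _

lemma ad_adj (Y : SimpleGraph (Fin n)) {a b : Fin n} (hab : a ≠ b) (i j : Fin n) :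
    (ad Y a b).Adj i j ↔ Y.Adj i j ∨ (i = a ∧ j = b) ∨ (i = b ∧ j = a) := by
  simp only [ad, SimpleGraph.sup_adj, SimpleGraph.edge_adj]
  constructor
  · rintro (h | ⟨h, -⟩)
    · exact Or.inl h
    · exact Or.inr h
  · rintro (h | h)
    · exact Or.inl h
    · refine Or.inr ⟨h, ?_⟩
      rcases h with ⟨rfl, rfl⟩ | ⟨rfl, rfl⟩
      · exact hab
      · exact hab.symm

lemma ad_comm (Y : SimpleGraph (Fin n)) (a b : Fin n) : ad Y a b = ad Y b a := by
  simp only [ad, SimpleGraph.edge_comm]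

lemma ad_right_comm (Y : SimpleGraph (Fin n)) (a b c e : Fin n) :
    ad (ad Y a b) c e = ad (ad Y c e) a b := by
  simp only [ad, sup_right_comm]

lemma dg_ad {Y : SimpleGraph (Fin n)} {a b : Fin n} (hab : a ≠ b) (h : ¬ Y.Adj a b)
    (v : Fin n) : dg (ad Y a b) v = dg Y v + uv a v + uv b v := by
  have h' : ¬ Y.Adj b a := fun hh => h hh.symm
  trans ∑ u, ((if Y.Adj v u then 1 else 0) + (if u = b then (if v = a then 1 else 0) else 0)
        + (if u = a then (if v = b then (1 : ℤ) else 0) else 0))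
  · refine Finset.sum_congr rfl fun u _ => ?_
    simp only [ad_adj Y hab]
    by_cases h1 : v = a
    · subst h1
      by_cases h2 : u = b
      · subst h2; simp [h, hab]
      · simp [h2, hab]
    · by_cases h3 : v = b
      · subst h3
        by_cases h2 : u = a
        · subst h2; simp [h', hab.symm]
        · simp [h2, hab.symm]
      · simp [h1, h3]
  · rw [Finset.sum_add_distrib, Finset.sum_add_distrib]
    simp [dg, Pi.single_apply]

lemma dg_eq_of_sdiff {H : SimpleGraph (Fin n)} {a b : Fin n} (h : H.Adj a b) :
    ad (H \ SimpleGraph.edge a b) a b = H ∧ ¬ (H \ SimpleGraph.edge a b).Adj a b := by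
  have hab := h.ne
  constructor
  · refine sdiff_sup_cancel ?_
    intro i j hij
    rw [SimpleGraph.edge_adj] at hij
    rcases hij.1 with ⟨rfl, rfl⟩ | ⟨rfl, rfl⟩
    · exact h
    · exact h.symm
  · simp [SimpleGraph.edge_adj, hab]

lemma dg_sdiff {H : SimpleGraph (Fin n)} {a b : Fin n} (h : H.Adj a b) (v : Fin n) :
    dg (H \ SimpleGraph.edge a b) v = dg H v - uv a v - uv b v := by
  obtain ⟨h1, h2⟩ := dg_eq_of_sdiff h
  have := dg_ad h.ne h2 v
  rw [h1] at this
  rw [this]; ring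

lemma card_cls_adj {Y : SimpleGraph (Fin n)} {a b : Fin n} (hab : a ≠ b) (h : ¬ Y.Adj a b)
    (d : Fin n → ℤ) :
    ((cls Y d).filter fun H => H.Adj a b).card = (cls (ad Y a b) (d - uv a - uv b)).card := by
  refine Finset.card_bij' (fun H _ => H \ SimpleGraph.edge a b) (fun H _ => ad H a b) ?_ ?_ ?_ ?_
  · intro H hH
    obtain ⟨h1, h2⟩ := Finset.mem_filter.1 hH
    obtain ⟨h3, h4⟩ := mem_cls.1 h1
    refine mem_cls.2 ⟨fun v => ?_, fun i j hij => ?_⟩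
    · rw [dg_sdiff h2, h3]; rfl
    · have h5 := (SimpleGraph.sdiff_adj ..).1 hij
      rintro (h6 | h6)
      · exact h4 _ _ h5.1 h6
      · exact h5.2 h6
  · intro H hH
    obtain ⟨h3, h4⟩ := mem_cls.1 hH
    have hn : ¬ H.Adj a b := fun h6 => h4 _ _ h6 ((ad_adj Y hab _ _).2 (by simp))
    refine Finset.mem_filter.2 ⟨mem_cls.2 ⟨fun v => ?_, fun i j hij => ?_⟩, ?_⟩
    · rw [dg_ad hab hn, h3]; simp only [Pi.sub_apply]; ring
    · rcases (ad_adj H hab _ _).1 hij with h6 | ⟨rfl, rfl⟩ | ⟨rfl, rfl⟩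
      · exact fun h7 => h4 _ _ h6 (Or.inl h7)
      · exact h
      · exact fun h7 => h h7.symm
    · exact (ad_adj H hab _ _).2 (by simp)
  · intro H hH
    exact (dg_eq_of_sdiff (Finset.mem_filter.1 hH).2).1
  · intro H hH
    obtain ⟨h3, h4⟩ := mem_cls.1 hH
    have hn : ¬ H.Adj a b := fun h6 => h4 _ _ h6 ((ad_adj Y hab _ _).2 (by simp))
    have hn' : ¬ H.Adj b a := fun h6 => hn h6.symm
    ext i j
    simp only [SimpleGraph.sdiff_adj, ad, SimpleGraph.sup_adj, SimpleGraph.edge_adj]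
    constructor
    · tauto
    · intro h6
      refine ⟨Or.inl h6, ?_⟩
      rintro ⟨⟨rfl, rfl⟩ | ⟨rfl, rfl⟩, -⟩ <;> contradiction

lemma cnt_split {Y : SimpleGraph (Fin n)} {a b : Fin n} (hab : a ≠ b) (h : ¬ Y.Adj a b)
    (d : Fin n → ℤ) :
    cnt Y d = cnt (ad Y a b) d + cnt (ad Y a b) (d - uv a - uv b) := by
  have h1 := Finset.card_filter_add_card_filter_not (s := cls Y d) (fun H => H.Adj a b)
  rw [card_cls_adj hab h] at h1
  have h2 : (cls Y d).filter (fun H => ¬ H.Adj a b) = cls (ad Y a b) d := by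
    ext H
    simp only [Finset.mem_filter, mem_cls, ad_adj Y hab]
    constructor
    · rintro ⟨⟨h3, h4⟩, h5⟩
      refine ⟨h3, fun i j hij => ?_⟩
      rintro (h6 | ⟨rfl, rfl⟩ | ⟨rfl, rfl⟩)
      · exact h4 _ _ hij h6
      · exact h5 hij
      · exact h5 hij.symm
    · rintro ⟨h3, h4⟩
      exact ⟨⟨h3, fun i j hij h6 => h4 _ _ hij (Or.inl h6)⟩, fun h6 => h4 _ _ h6 (by simp)⟩
  rw [h2] at h1
  unfold cnt
  rw [← h1]; push_cast; ring

lemma sum_cnt_edge (Y : SimpleGraph (Fin n)) (d : Fin n → ℤ) (a : Fin n) :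
    ∑ v, (if v ≠ a ∧ ¬ Y.Adj a v then cnt (ad Y a v) (d - uv a - uv v) else 0)
      = (d a : ℝ) * cnt Y d := by
  have h1 : ∀ v, (if v ≠ a ∧ ¬ Y.Adj a v then cnt (ad Y a v) (d - uv a - uv v) else 0)
      = ∑ H ∈ cls Y d, if H.Adj a v then (1 : ℝ) else 0 := by
    intro v
    rw [← Finset.sum_filter, Finset.sum_const, nsmul_eq_mul, mul_one]
    split_ifs with hv
    · rw [card_cls_adj hv.1.symm hv.2]; rfl
    · rw [eq_comm, Nat.cast_eq_zero, Finset.card_eq_zero, Finset.filter_eq_empty_iff]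
      intro H hH hadj
      exact hv ⟨hadj.ne', fun h => (mem_cls.1 hH).2 _ _ hadj h⟩
  rw [Finset.sum_congr rfl fun v _ => h1 v, Finset.sum_comm]
  have h2 : ∀ H ∈ cls Y d, (∑ v, if H.Adj a v then (1 : ℝ) else 0) = (d a : ℝ) := by
    intro H hH
    rw [← (mem_cls.1 hH).1 a]
    simp [dg]
  rw [Finset.sum_congr rfl h2, Finset.sum_const, nsmul_eq_mul, mul_comm]
  rfl

/-- The exact recursion comparing the counts for two degree sequences that differ by
moving one unit of degree from `a` to `b`. -/
lemma cnt_shift_rec (Y : SimpleGraph (Fin n)) (d : Fin n → ℤ) {a b : Fin n} (hab : a ≠ b) :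
    ((d b : ℝ) + 1) * cnt Y (d - uv a + uv b) - d a * cnt Y d
      = (∑ v ∈ univ \ {a, b},
          if Y.Adj a v then
            (if Y.Adj b v then 0 else cnt (ad Y b v) (d - uv a - uv v))
          else
            (if Y.Adj b v then - cnt (ad Y a v) (d - uv a - uv v)
             else cnt (ad (ad Y a v) b v) (d - uv a - uv v - uv a - uv v)
              - cnt (ad (ad Y a v) b v) (d - uv a - uv v - uv b - uv v)))
        + (if Y.Adj a b then 0 else
            cnt (ad Y a b) (d - uv a - uv a) - cnt (ad Y a b) (d - uv a - uv b)) := by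
  have h1 := sum_cnt_edge Y (d - uv a + uv b) b
  have h2 := sum_cnt_edge Y d a
  have h3 : (((d - uv a + uv b) b : ℤ) : ℝ) = d b + 1 := by
    simp [hab.symm]
  have h4 : ∀ v, d - uv a + uv b - uv b - uv v = d - uv a - uv v := by
    intro v; abel
  rw [h3] at h1
  rw [← h1, ← h2, ← Finset.sum_sub_distrib]
  simp only [h4]
  rw [← Finset.sum_sdiff (Finset.subset_univ ({a, b} : Finset (Fin n)))]
  congr 1
  · refine Finset.sum_congr rfl fun v hv => ?_
    have hva : v ≠ a := by rintro rfl; simp at hv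
    have hvb : v ≠ b := by rintro rfl; simp at hv
    by_cases hya : Y.Adj a v <;> by_cases hyb : Y.Adj b v
    · simp [hya, hyb]
    · simp [hya, hyb, hvb]
    · simp [hya, hyb, hva]
    · simp only [hya, hyb, hva, hvb, ne_eq, not_false_eq_true, and_self, if_true, if_false]
      have hb' : ¬ (ad Y a v).Adj b v := by
        rw [ad_adj Y hva.symm]; simp [hyb, hab.symm, hvb.symm]
      have ha' : ¬ (ad Y b v).Adj a v := by
        rw [ad_adj Y hvb.symm]; simp [hya, hab, hva.symm]
      rw [cnt_split hva.symm ha', cnt_split (Y := ad Y a v) hvb.symm hb', ad_right_comm Y b v a v]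
      ring
  · rw [Finset.sum_pair hab]
    by_cases hy : Y.Adj a b
    · simp [hy, hy.symm]
    · have hy' : ¬ Y.Adj b a := fun h => hy h.symm
      simp only [hy, hy', hab, hab.symm, ne_eq, not_false_eq_true, and_self, if_true, if_false,
        not_true_eq_false, false_and]
      rw [ad_comm Y b a]
      ring

/-- Two edges at `v` are exchanged by moving a unit of degree. -/
lemma cnt_edge_diff (Y : SimpleGraph (Fin n)) (d : Fin n → ℤ) {a b v : Fin n} (hab : a ≠ b)
    (hav : a ≠ v) (hbv : b ≠ v) (ha : ¬ Y.Adj a v) (hb : ¬ Y.Adj b v) :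
    cnt (ad Y b v) (d - uv b - uv v) - cnt (ad Y a v) (d - uv a - uv v)
      = cnt (ad (ad Y a v) b v) (d - uv a - uv v - uv b + uv a)
        - cnt (ad (ad Y a v) b v) (d - uv a - uv v) := by
  have hb' : ¬ (ad Y a v).Adj b v := by
    rw [ad_adj Y hav]; simp [hb, hab.symm, hbv]
  have ha' : ¬ (ad Y b v).Adj a v := by
    rw [ad_adj Y hbv]; simp [ha, hab, hav]
  rw [cnt_split hav ha', cnt_split (Y := ad Y a v) hbv hb', ad_right_comm Y b v a v]
  have e1 : d - uv a - uv v - uv b + uv a = d - uv b - uv v := by abel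
  have e2 : d - uv a - uv v - uv b - uv v = d - uv b - uv v - uv a - uv v := by abel
  rw [e1, e2]
  ring

end Counting

section Switching

variable {n : ℕ}

/-- Replace the edge `bv` by `wv`. -/
def sw (H : SimpleGraph (Fin n)) (b v w : Fin n) : SimpleGraph (Fin n) :=
  ad (H \ SimpleGraph.edge b v) w v

lemma sw_adj (H : SimpleGraph (Fin n)) {b v w : Fin n} (hwv : w ≠ v) (i j : Fin n) :
    (sw H b v w).Adj i j ↔ (H.Adj i j ∧ ¬ (i = b ∧ j = v) ∧ ¬ (i = v ∧ j = b)) ∨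
      (i = w ∧ j = v) ∨ (i = v ∧ j = w) := by
  rw [sw, ad_adj _ hwv]
  simp only [SimpleGraph.sdiff_adj, SimpleGraph.edge_adj]
  constructor
  · rintro (⟨h1, h2⟩ | h)
    · exact Or.inl ⟨h1, fun h => h2 ⟨Or.inl h, h1.ne⟩, fun h => h2 ⟨Or.inr h, h1.ne⟩⟩
    · exact Or.inr h
  · rintro (⟨h1, h2, h3⟩ | h)
    · exact Or.inl ⟨h1, fun h => h.1.elim h2 h3⟩
    · exact Or.inr h

lemma sw_mem {Y H : SimpleGraph (Fin n)} {d : Fin n → ℤ} {b v w : Fin n} (hH : H ∈ cls Y d)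
    (h1 : H.Adj b v) (hwv : w ≠ v) (h2 : ¬ H.Adj w v) (h3 : ¬ Y.Adj w v) :
    sw H b v w ∈ cls Y (d - uv b + uv w) := by
  obtain ⟨h4, h5⟩ := mem_cls.1 hH
  have hn : ¬ (H \ SimpleGraph.edge b v).Adj w v := fun h => h2 h.1
  refine mem_cls.2 ⟨fun x => ?_, fun i j hij => ?_⟩
  · rw [sw, dg_ad hwv hn, dg_sdiff h1, h4]
    simp only [Pi.sub_apply, Pi.add_apply]; ring
  · rcases (sw_adj H hwv i j).1 hij with h | ⟨rfl, rfl⟩ | ⟨rfl, rfl⟩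
    · exact h5 _ _ h.1
    · exact h3
    · exact fun h => h3 h.symm

lemma sw_injOn {H H' : SimpleGraph (Fin n)} {b v w : Fin n}
    (h1 : H.Adj b v) (hwv : w ≠ v) (h2 : ¬ H.Adj w v) (h1' : H'.Adj b v) (h2' : ¬ H'.Adj w v)
    (he : sw H b v w = sw H' b v w) : H = H' := by
  have key : ∀ K : SimpleGraph (Fin n), K.Adj b v → ¬ K.Adj w v → ∀ i j,
      K.Adj i j ↔ ((sw K b v w).Adj i j ∧ ¬ (i = w ∧ j = v) ∧ ¬ (i = v ∧ j = w)) ∨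
        (i = b ∧ j = v) ∨ (i = v ∧ j = b) := by
    intro K k1 k2 i j
    rw [sw_adj K hwv]
    constructor
    · intro hK
      by_cases h : (i = b ∧ j = v) ∨ (i = v ∧ j = b)
      · exact Or.inr h
      · push Not at h
        refine Or.inl ⟨Or.inl ⟨hK, fun h' => h.1 h'.1 h'.2, fun h' => h.2 h'.1 h'.2⟩, ?_, ?_⟩
        · rintro ⟨rfl, rfl⟩; exact k2 hK
        · rintro ⟨rfl, rfl⟩; exact k2 hK.symm
    · rintro (⟨h | h, h3, h4⟩ | ⟨rfl, rfl⟩ | ⟨rfl, rfl⟩)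
      · exact h.1
      · exact absurd h (by tauto)
      · exact k1
      · exact k1.symm
  ext i j
  rw [key H h1 h2, key H' h1' h2', he]

/-- Number of alternating paths of length two (as an indicator in the middle vertex). -/
def alt (Y H : SimpleGraph (Fin n)) (b v w : Fin n) : Prop :=
  H.Adj b v ∧ w ≠ v ∧ ¬ H.Adj w v ∧ ¬ Y.Adj w v

lemma card_alt_le (Y : SimpleGraph (Fin n)) (d : Fin n → ℤ) (b v w : Fin n) :
    ((cls Y d).filter fun H => alt Y H b v w).card ≤ (cls Y (d - uv b + uv w)).card := by
  refine Finset.card_le_card_of_injOn (fun H => sw H b v w) ?_ ?_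
  · intro H hH
    obtain ⟨h0, h1, h2, h3, h4⟩ := Finset.mem_filter.1 hH
    exact sw_mem h0 h1 h2 h3 h4
  · intro H hH H' hH' he
    obtain ⟨h0, h1, h2, h3, h4⟩ := Finset.mem_filter.1 hH
    obtain ⟨h0', h1', h2', h3', h4'⟩ := Finset.mem_filter.1 hH'
    exact sw_injOn h1 h2 h3 h1' h3' he

lemma card_alt_alt_le (Y : SimpleGraph (Fin n)) (d : Fin n → ℤ) (b v w u a : Fin n) :
    ((cls Y d).filter fun H => alt Y H b v w ∧ alt Y H w u a).card
      ≤ (cls Y (d - uv b + uv a)).card := by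
  have h0 : d - uv b + uv a = d - uv b + uv w - uv w + uv a := by abel
  rw [h0]
  refine le_trans ?_ (card_alt_le Y _ w u a)
  refine Finset.card_le_card_of_injOn (fun H => sw H b v w) ?_ ?_
  · intro H hH
    obtain ⟨h0, ⟨h1, h2, h3, h4⟩, h5, h6, h7, h8⟩ := Finset.mem_filter.1 hH
    have hwb : w ≠ b := by rintro rfl; exact h3 h1
    refine Finset.mem_coe.2 (Finset.mem_filter.2 ⟨sw_mem h0 h1 h2 h3 h4, ?_, h6, ?_, h8⟩)
    · rw [sw_adj H h2]
      exact Or.inl ⟨h5, fun h => hwb h.1, fun h => h2 h.1⟩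
    · rw [sw_adj H h2]
      rintro (h | ⟨rfl, rfl⟩ | ⟨rfl, rfl⟩)
      · exact h7 h.1
      · exact h3 h5
      · exact h5.ne rfl
  · intro H hH H' hH' he
    obtain ⟨h0, ⟨h1, h2, h3, h4⟩, -⟩ := Finset.mem_filter.1 hH
    obtain ⟨h0', ⟨h1', h2', h3', h4'⟩, -⟩ := Finset.mem_filter.1 hH'
    exact sw_injOn h1 h2 h3 h1' h3' he

/-- The number of alternating paths of length two from `b` to `w`. -/
def altCount (Y H : SimpleGraph (Fin n)) (b w : Fin n) : ℝ := ∑ v, if alt Y H b v w then 1 else 0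

lemma altCount_nonneg (Y H : SimpleGraph (Fin n)) (b w : Fin n) : 0 ≤ altCount Y H b w :=
  Finset.sum_nonneg fun _ _ => by split_ifs <;> norm_num

lemma sum_altCount_le (Y : SimpleGraph (Fin n)) (d : Fin n → ℤ) (b a : Fin n) :
    ∑ H ∈ cls Y d, altCount Y H b a ≤ n * cnt Y (d - uv b + uv a) := by
  unfold altCount
  rw [Finset.sum_comm]
  refine (Finset.sum_le_card_nsmul univ _ (cnt Y (d - uv b + uv a)) fun v _ => ?_).trans ?_
  · rw [← Finset.sum_filter, Finset.sum_const, nsmul_eq_mul, mul_one]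
    exact Nat.cast_le.2 (card_alt_le Y d b v a)
  · simp

lemma sum_altCount_mul_le (Y : SimpleGraph (Fin n)) (d : Fin n → ℤ) (b a : Fin n) :
    ∑ H ∈ cls Y d, ∑ w, altCount Y H b w * altCount Y H w a
      ≤ (n : ℝ) ^ 3 * cnt Y (d - uv b + uv a) := by
  have h1 : ∀ H w, altCount Y H b w * altCount Y H w a
      = ∑ v, ∑ u, if alt Y H b v w ∧ alt Y H w u a then 1 else 0 := by
    intro H w
    rw [altCount, altCount, Finset.sum_mul_sum]
    refine Finset.sum_congr rfl fun v _ => Finset.sum_congr rfl fun u _ => ?_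
    by_cases h : alt Y H b v w <;> by_cases h' : alt Y H w u a <;> simp [h, h']
  simp only [h1]
  rw [Finset.sum_comm]
  have h2 : ∀ w ∈ (univ : Finset (Fin n)), (∑ H ∈ cls Y d, ∑ v, ∑ u,
      if alt Y H b v w ∧ alt Y H w u a then (1 : ℝ) else 0)
      ≤ (n : ℝ) ^ 2 * cnt Y (d - uv b + uv a) := by
    intro w _
    rw [Finset.sum_comm]
    have h3 : ∀ v ∈ (univ : Finset (Fin n)), (∑ H ∈ cls Y d, ∑ u,
        if alt Y H b v w ∧ alt Y H w u a then (1 : ℝ) else 0)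
        ≤ n * cnt Y (d - uv b + uv a) := by
      intro v _
      rw [Finset.sum_comm]
      refine (Finset.sum_le_card_nsmul univ _ (cnt Y (d - uv b + uv a)) fun u _ => ?_).trans ?_
      · rw [← Finset.sum_filter, Finset.sum_const, nsmul_eq_mul, mul_one]
        exact Nat.cast_le.2 (card_alt_alt_le Y d b v w u a)
      · simp
    refine (Finset.sum_le_card_nsmul univ _ _ h3).trans (le_of_eq ?_)
    simp; ring
  refine (Finset.sum_le_card_nsmul univ _ _ h2).trans (le_of_eq ?_)
  simp; ring

lemma dg_real (H : SimpleGraph (Fin n)) (v : Fin n) :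
    (dg H v : ℝ) = ∑ u, if H.Adj v u then (1 : ℝ) else 0 := by
  simp [dg]

lemma altCount_ge (Y H : SimpleGraph (Fin n)) (b w : Fin n) :
    (dg H b : ℝ) - (∑ v, if H.Adj b v ∧ H.Adj w v then (1 : ℝ) else 0) - 1 - dg Y w
      ≤ altCount Y H b w := by
  have h1 : (1 : ℝ) = ∑ v, if v = w then (1 : ℝ) else 0 := by simp
  rw [altCount, dg_real, dg_real, h1, ← Finset.sum_sub_distrib, ← Finset.sum_sub_distrib,
    ← Finset.sum_sub_distrib]
  refine Finset.sum_le_sum fun v _ => ?_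
  rw [← h1]
  by_cases h4 : v = w
  · subst h4
    by_cases h2 : H.Adj b v <;> simp [alt, h2]
  · have h4' : w ≠ v := fun h => h4 h.symm
    by_cases h2 : H.Adj b v <;> by_cases h3 : H.Adj w v <;>
      by_cases h5 : Y.Adj w v <;> simp [alt, h2, h3, h4, h4', h5]

lemma codeg_le (Y H : SimpleGraph (Fin n)) (a b w : Fin n) :
    (∑ v, if H.Adj w v ∧ H.Adj a v then (1 : ℝ) else 0)
      ≤ (∑ v, if H.Adj b v ∧ H.Adj w v then (1 : ℝ) else 0)
        + (dg H a - dg H b + altCount Y H b a + 1 + dg Y a) := by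
  have h0 := altCount_ge Y H b a
  have h1 : (∑ v, if H.Adj w v ∧ H.Adj a v then (1 : ℝ) else 0)
      ≤ (∑ v, if H.Adj b v ∧ H.Adj w v then (1 : ℝ) else 0)
        + (dg H a - ∑ v, if H.Adj b v ∧ H.Adj a v then (1 : ℝ) else 0) := by
    rw [dg_real, ← Finset.sum_sub_distrib, ← Finset.sum_add_distrib]
    refine Finset.sum_le_sum fun v _ => ?_
    by_cases h2 : H.Adj b v <;> by_cases h3 : H.Adj w v <;> by_cases h4 : H.Adj a v <;>
      simp [h2, h3, h4]
  linarith

lemma sum_codeg (H : SimpleGraph (Fin n)) (b : Fin n) :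
    ∑ w, (∑ v, if H.Adj b v ∧ H.Adj w v then (1 : ℝ) else 0)
      = ∑ v, (if H.Adj b v then (1 : ℝ) else 0) * dg H v := by
  rw [Finset.sum_comm]
  refine Finset.sum_congr rfl fun v _ => ?_
  rw [dg_real]
  by_cases h : H.Adj b v <;> simp [h, H.adj_comm]

/-- In a graph with nearly constant degrees there are many alternating paths of length two
or four between two given vertices. -/
lemma many_alt (Y H : SimpleGraph (Fin n)) {l B : ℝ} (hl0 : 0 < l) (hl1 : l < 1) (hB1 : 1 ≤ B)
    (hB : 40 * B ≤ l * (1 - l) * n) (hH : ∀ v, |(dg H v : ℝ) - l * n| ≤ B)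
    (hY : ∀ v, (dg Y v : ℝ) ≤ B) (a b : Fin n) :
    l * (1 - l) * n / 4 ≤ altCount Y H b a ∨
      (l * (1 - l)) ^ 2 * n ^ 3 / 4 ≤ ∑ w, altCount Y H b w * altCount Y H w a := by
  by_cases hc : l * (1 - l) * n / 4 ≤ altCount Y H b a
  · exact Or.inl hc
  right
  push Not at hc
  set c := altCount Y H b a with hcdef
  have hn : (0 : ℝ) < n := by
    have : 0 < l * (1 - l) := mul_pos hl0 (by linarith)
    by_contra h
    have : (n : ℝ) = 0 := le_antisymm (not_lt.1 h) (Nat.cast_nonneg n)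
    rw [this] at hB; linarith
  let y : Fin n → ℝ := fun w => ∑ v, if H.Adj b v ∧ H.Adj w v then (1 : ℝ) else 0
  let z : Fin n → ℝ := fun w => l * n - y w - c - 7 * B
  have hb := abs_le.1 (hH b)
  have ha := abs_le.1 (hH a)
  have hc0 : 0 ≤ c := altCount_nonneg _ _ _ _
  have hz1 : ∀ w, z w ≤ altCount Y H b w := by
    intro w
    have := altCount_ge Y H b w
    have := hY w
    simp only [z, y]; linarith
  have hz2 : ∀ w, z w ≤ altCount Y H w a := by
    intro w
    have h1 := altCount_ge Y H w a
    have h2 := codeg_le Y H a b w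
    have h3 := hY a
    have h4 := abs_le.1 (hH w)
    simp only [z, y]; linarith
  have hz3 : ∀ w, (max (z w) 0) ^ 2 ≤ altCount Y H b w * altCount Y H w a := by
    intro w
    rw [sq]
    exact mul_le_mul (max_le (hz1 w) (altCount_nonneg _ _ _ _))
      (max_le (hz2 w) (altCount_nonneg _ _ _ _)) (le_max_right _ _) (altCount_nonneg _ _ _ _)
  have hln : l * n ≤ n := by nlinarith
  have hBn : B ≤ n := by
    have : l * (1 - l) ≤ 1 := by nlinarith
    nlinarith
  have hy : ∑ w, y w ≤ (l * n + B) * (l * n + B) := by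
    rw [sum_codeg]
    calc ∑ v, (if H.Adj b v then (1 : ℝ) else 0) * dg H v
        ≤ ∑ v, (if H.Adj b v then (1 : ℝ) else 0) * (l * n + B) := by
          refine Finset.sum_le_sum fun v _ => ?_
          have := abs_le.1 (hH v)
          split_ifs <;> linarith
      _ = dg H b * (l * n + B) := by rw [← Finset.sum_mul, dg_real]
      _ ≤ _ := by
          refine mul_le_mul_of_nonneg_right (by linarith) ?_
          positivity
  have hzs : l * (1 - l) * n ^ 2 / 2 ≤ ∑ w, max (z w) 0 := by
    have h1 : ∑ w, z w = n * (l * n) - (∑ w, y w) - n * c - n * (7 * B) := by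
      simp only [z, Finset.sum_sub_distrib, Finset.sum_const, Finset.card_univ, Fintype.card_fin,
        nsmul_eq_mul]
    have h2 : ∑ w, z w ≤ ∑ w, max (z w) 0 := Finset.sum_le_sum fun w _ => le_max_left _ _
    have h3 : n * c ≤ n * (l * (1 - l) * n / 4) := mul_le_mul_of_nonneg_left hc.le hn.le
    have h4 : n * (40 * B) ≤ n * (l * (1 - l) * n) := mul_le_mul_of_nonneg_left hB hn.le
    have h5 : l * n * B ≤ n * B := mul_le_mul_of_nonneg_right hln (by linarith)
    have h6 : B * B ≤ n * B := mul_le_mul_of_nonneg_right hBn (by linarith)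
    nlinarith
  have hcs := sq_sum_le_card_mul_sum_sq (s := (univ : Finset (Fin n))) (f := fun w => max (z w) 0)
  rw [Finset.card_univ, Fintype.card_fin] at hcs
  have h7 : (l * (1 - l) * n ^ 2 / 2) ^ 2 ≤ (∑ w, max (z w) 0) ^ 2 := by
    refine pow_le_pow_left₀ ?_ hzs 2
    have : 0 < 1 - l := by linarith
    positivity
  have h8 : ∑ w, (max (z w) 0) ^ 2 ≤ ∑ w, altCount Y H b w * altCount Y H w a :=
    Finset.sum_le_sum fun w _ => hz3 w
  have h9 : (n : ℝ) * ((l * (1 - l)) ^ 2 * n ^ 3 / 4) ≤ n * ∑ w, (max (z w) 0) ^ 2 := by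
    calc (n : ℝ) * ((l * (1 - l)) ^ 2 * n ^ 3 / 4) = (l * (1 - l) * n ^ 2 / 2) ^ 2 := by ring
      _ ≤ _ := h7.trans hcs
  exact (le_of_mul_le_mul_left h9 hn).trans h8

/-- Moving one unit of degree changes the count by at most a bounded factor. -/
lemma cnt_shift_le (Y : SimpleGraph (Fin n)) (d : Fin n → ℤ) {l B : ℝ} (hl0 : 0 < l) (hl1 : l < 1)
    (hB1 : 1 ≤ B) (hB : 40 * B ≤ l * (1 - l) * n) (hd : ∀ v, |(d v : ℝ) - l * n| + 1 ≤ B)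
    (hY : ∀ v, (dg Y v : ℝ) ≤ B) {a b : Fin n} (hab : a ≠ b) :
    cnt Y (d - uv a + uv b) ≤ (4 / (l * (1 - l)) + 4 / (l * (1 - l)) ^ 2) * cnt Y d := by
  have ho : 0 < l * (1 - l) := mul_pos hl0 (by linarith)
  have hn : (0 : ℝ) < n := by
    by_contra h
    have : (n : ℝ) = 0 := le_antisymm (not_lt.1 h) (Nat.cast_nonneg n)
    rw [this] at hB; linarith
  set o := l * (1 - l) with hodef
  have h1 : ∀ H ∈ cls Y (d - uv a + uv b), (1 : ℝ) ≤ 4 / (o * n) * altCount Y H b a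
      + 4 / (o ^ 2 * n ^ 3) * ∑ w, altCount Y H b w * altCount Y H w a := by
    intro H hH
    have hdg : ∀ v, |(dg H v : ℝ) - l * n| ≤ B := by
      intro v
      rw [(mem_cls.1 hH).1 v]
      refine le_trans ?_ (hd v)
      have : |(((d - uv a + uv b) v : ℤ) : ℝ) - d v| ≤ 1 := by
        by_cases hva : v = a
        · subst hva; simp [hab]
        · by_cases hvb : v = b
          · subst hvb; simp [hva]
          · simp [hva, hvb]
      calc |(((d - uv a + uv b) v : ℤ) : ℝ) - l * n|
          = |((d v : ℝ) - l * n) + ((((d - uv a + uv b) v : ℤ) : ℝ) - d v)| := by congr 1; ring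
        _ ≤ _ := (abs_add_le _ _).trans (by linarith)
    have h2 : 0 ≤ altCount Y H b a := altCount_nonneg _ _ _ _
    have h3 : 0 ≤ ∑ w, altCount Y H b w * altCount Y H w a :=
      Finset.sum_nonneg fun w _ => mul_nonneg (altCount_nonneg _ _ _ _) (altCount_nonneg _ _ _ _)
    rcases many_alt Y H hl0 hl1 hB1 hB hdg hY a b with h | h
    · have h4 : (1 : ℝ) ≤ 4 / (o * n) * altCount Y H b a := by
        rw [div_mul_eq_mul_div, le_div_iff₀ (by positivity)]
        linarith
      have h5 : 0 ≤ 4 / (o ^ 2 * n ^ 3) * ∑ w, altCount Y H b w * altCount Y H w a := by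
        positivity
      linarith
    · have h4 : (1 : ℝ) ≤ 4 / (o ^ 2 * n ^ 3) * ∑ w, altCount Y H b w * altCount Y H w a := by
        rw [div_mul_eq_mul_div, le_div_iff₀ (by positivity)]
        linarith
      have h5 : 0 ≤ 4 / (o * n) * altCount Y H b a := by
        positivity
      linarith
  have h2 := Finset.sum_le_sum h1
  rw [Finset.sum_const, nsmul_eq_mul, mul_one, Finset.sum_add_distrib, ← Finset.mul_sum,
    ← Finset.mul_sum] at h2
  have e1 : d - uv a + uv b - uv b + uv a = d := by abel
  have h3 := sum_altCount_le Y (d - uv a + uv b) b a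
  have h4 := sum_altCount_mul_le Y (d - uv a + uv b) b a
  rw [e1] at h3 h4
  calc cnt Y (d - uv a + uv b) ≤ _ := h2
    _ ≤ 4 / (o * n) * (n * cnt Y d) + 4 / (o ^ 2 * n ^ 3) * (n ^ 3 * cnt Y d) := by gcongr
    _ = _ := by field_simp

end Switching

/-- `x` is bounded by `q ^ K * θ`. -/
def Bd (q : ℝ) (K : ℕ) (θ x : ℝ) : Prop := |x| ≤ q ^ K * θ

section Bounds

variable {q θ φ x y : ℝ} {K L : ℕ}

lemma Bd.nonneg_scale (hq : 2 ≤ q) (h : Bd q K θ x) : 0 ≤ θ := by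
  have h1 : 0 < q ^ K := by positivity
  by_contra h2
  have h3 := mul_neg_of_pos_of_neg h1 (not_le.1 h2)
  have h4 := abs_nonneg x
  unfold Bd at h
  linarith

lemma Bd.mono (hq : 2 ≤ q) (h : Bd q K θ x) (hKL : K ≤ L) (hθ : θ ≤ φ) : Bd q L φ x := by
  have h0 := h.nonneg_scale hq
  have h1 : q ^ K ≤ q ^ L := pow_le_pow_right₀ (by linarith) hKL
  unfold Bd at *
  exact h.trans (mul_le_mul h1 hθ h0 (by positivity))

lemma Bd.mono_left (hq : 2 ≤ q) (h : Bd q K θ x) (hKL : K ≤ L) : Bd q L θ x :=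
  h.mono hq hKL le_rfl

lemma Bd.add (hq : 2 ≤ q) (hx : Bd q K θ x) (hy : Bd q L θ y) :
    Bd q (max K L + 1) θ (x + y) := by
  have h1 := hx.mono_left hq (le_max_left K L)
  have h2 := hy.mono_left hq (le_max_right K L)
  have h0 := hx.nonneg_scale hq
  unfold Bd at *
  refine (abs_add_le x y).trans ((add_le_add h1 h2).trans ?_)
  have : 0 ≤ q ^ max K L * θ := by positivity
  rw [pow_succ]
  nlinarith

lemma Bd.neg (hx : Bd q K θ x) : Bd q K θ (-x) := by
  unfold Bd at *; rwa [abs_neg]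

lemma Bd.sub (hq : 2 ≤ q) (hx : Bd q K θ x) (hy : Bd q L θ y) :
    Bd q (max K L + 1) θ (x - y) := by
  rw [sub_eq_add_neg]; exact hx.add hq hy.neg

lemma Bd.mul (hx : Bd q K θ x) (hy : Bd q L φ y) : Bd q (K + L) (θ * φ) (x * y) := by
  unfold Bd at *
  rw [abs_mul, pow_add, mul_mul_mul_comm]
  exact mul_le_mul hx hy (abs_nonneg _) ((abs_nonneg _).trans hx)

lemma Bd.mul_const {c : ℝ} (hc : |c| ≤ 1) (hx : Bd q K θ x) : Bd q K θ (c * x) := by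
  unfold Bd at *
  rw [abs_mul]
  exact (mul_le_of_le_one_left (abs_nonneg _) hc).trans hx

lemma Bd.pmul {σ : ℝ} {i j : ℕ} (hx : Bd q K (σ ^ i) x) (hy : Bd q L (σ ^ j) y) :
    Bd q (K + L) (σ ^ (i + j)) (x * y) := by
  rw [pow_add]; exact hx.mul hy

lemma Bd.of_abs_le {σ : ℝ} (h : |x| ≤ 1) : Bd q 0 (σ ^ 0) x := by
  unfold Bd; simpa using h

lemma Bd.sum {ι : Type*} (s : Finset ι) {f : ι → ℝ} {K : ℕ} {q θ c : ℝ} (hc : (s.card : ℝ) ≤ c)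
    (hθ : 0 ≤ q ^ K * θ) (h : ∀ i ∈ s, Bd q K θ (f i)) : Bd q K (c * θ) (∑ i ∈ s, f i) := by
  unfold Bd at *
  refine (Finset.abs_sum_le_sum_abs _ _).trans ((Finset.sum_le_card_nsmul _ _ _ h).trans ?_)
  rw [nsmul_eq_mul]
  calc (s.card : ℝ) * (q ^ K * θ) ≤ c * (q ^ K * θ) := mul_le_mul_of_nonneg_right hc hθ
    _ = _ := by ring

end Bounds

/-- The assumptions on the parameters: `σ = n ^ (-1/2)`, `l` is the density and `q` is a slowly
growing auxiliary quantity. -/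
structure Par (n : ℕ) (l q σ : ℝ) : Prop where
  q_ge : 16 ≤ q
  le_l : 1 ≤ q * l
  le_l' : 1 ≤ q * (1 - l)
  σ_pos : 0 < σ
  n_eq : (n : ℝ) * σ ^ 2 = 1
  small : q ^ 400 * σ ≤ 1
  exp_le : Real.exp (-q) ≤ σ ^ 3

/-- Degree sequences and forbidden graphs that are nearly regular and sparse respectively. -/
structure Good {n : ℕ} (l q σ r : ℝ) (Y : SimpleGraph (Fin n)) (d : Fin n → ℤ) : Prop where
  deg : ∀ j, |(d j : ℝ) - l * (n - 1)| ≤ q * σ⁻¹ + r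
  forb : ∀ j, (dg Y j : ℝ) ≤ q * σ⁻¹ + r
  edges : ∑ j, (dg Y j : ℝ) ≤ q * n + r
  total : |∑ j, ((d j : ℝ) - l * (n - 1))| ≤ r

namespace Par

variable {n : ℕ} {l q σ : ℝ}

lemma two_le (h : Par n l q σ) : 2 ≤ q := by linarith [h.q_ge]

lemma q_pos (h : Par n l q σ) : 0 < q := by linarith [h.q_ge]

lemma l_pos (h : Par n l q σ) : 0 < l := by
  have := h.le_l; have := h.q_pos
  by_contra hc; nlinarith

lemma l_lt (h : Par n l q σ) : l < 1 := by
  have := h.le_l'; have := h.q_pos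
  by_contra hc; nlinarith

lemma pow_small (h : Par n l q σ) {K : ℕ} (hK : K ≤ 400) : q ^ K * σ ≤ 1 :=
  (mul_le_mul_of_nonneg_right (pow_le_pow_right₀ (by linarith [h.q_ge]) hK) h.σ_pos.le).trans
    h.small

lemma σ_le (h : Par n l q σ) : σ ≤ 1 := by simpa using h.pow_small (K := 0) (by norm_num)

lemma n_pos (h : Par n l q σ) : (0 : ℝ) < n := by
  have := h.n_eq; have := h.σ_pos
  by_contra hc
  have : (n : ℝ) = 0 := le_antisymm (not_lt.1 hc) (Nat.cast_nonneg n)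
  simp_all

lemma n_eq' (h : Par n l q σ) : (n : ℝ) = σ⁻¹ * σ⁻¹ := by
  have := h.n_eq; have := h.σ_pos
  field_simp; linarith

lemma pow_le_inv (h : Par n l q σ) {K : ℕ} (hK : K ≤ 400) : q ^ K ≤ σ⁻¹ := by
  rw [← one_div, le_div_iff₀ h.σ_pos]; exact h.pow_small hK

lemma half (h : Par n l q σ) : 1 ≤ 2 * q * (l * (1 - l)) := by
  have h1 := h.le_l; have h2 := h.le_l'; have h3 := h.l_pos; have h4 := h.l_lt
  rcases le_total l (1 / 2) with h5 | h5
  · have := mul_le_mul h1 (show 1 / 2 ≤ 1 - l by linarith) (by norm_num) (by linarith)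
    linarith
  · have := mul_le_mul h2 h5 (by norm_num) (by linarith)
    linarith

end Par

namespace Good

variable {n : ℕ} {l q σ r r' : ℝ} {Y : SimpleGraph (Fin n)} {d : Fin n → ℤ} {a b : Fin n}

lemma mono (h : Good l q σ r Y d) (hr : r ≤ r') : Good l q σ r' Y d where
  deg j := (h.deg j).trans (by linarith)
  forb j := (h.forb j).trans (by linarith)
  edges := h.edges.trans (by linarith)
  total := h.total.trans hr

lemma uv_real (a j : Fin n) : ((uv a j : ℤ) : ℝ) = if j = a then 1 else 0 := by
  simp [Pi.single_apply]

lemma ad_forb (h : Good l q σ r Y d) (hab : a ≠ b) (hY : ¬ Y.Adj a b) :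
    Good l q σ (r + 2) (ad Y a b) d where
  deg j := (h.deg j).trans (by linarith)
  forb j := by
    have := h.forb j
    rw [dg_ad hab hY]; push_cast; rw [uv_real, uv_real]
    split_ifs <;> linarith
  edges := by
    have := h.edges
    have h2 : ∑ j, (dg (ad Y a b) j : ℝ) = ∑ j, (dg Y j : ℝ) + 2 := by
      have : ∀ j, (dg (ad Y a b) j : ℝ) = dg Y j + (if j = a then 1 else 0)
          + (if j = b then 1 else 0) := by
        intro j; rw [dg_ad hab hY]; push_cast; rw [uv_real, uv_real]
      simp only [this, Finset.sum_add_distrib]; simp; ring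
    linarith
  total := h.total.trans (by linarith)

lemma sub_deg (h : Good l q σ r Y d) (a b : Fin n) : Good l q σ (r + 2) Y (d - uv a - uv b) where
  deg j := by
    have := abs_le.1 (h.deg j)
    simp only [Pi.sub_apply]; push_cast; rw [uv_real, uv_real, abs_le]
    split_ifs <;> constructor <;> linarith
  forb j := (h.forb j).trans (by linarith)
  edges := h.edges.trans (by linarith)
  total := by
    have := abs_le.1 h.total
    have h2 : ∑ j, ((((d - uv a - uv b) j : ℤ) : ℝ) - l * (n - 1))
        = ∑ j, ((d j : ℝ) - l * (n - 1)) - 2 := by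
      have : ∀ j, ((((d - uv a - uv b) j : ℤ) : ℝ) - l * (n - 1)) = ((d j : ℝ) - l * (n - 1))
          - (if j = a then 1 else 0) - (if j = b then 1 else 0) := by
        intro j; simp only [Pi.sub_apply]; push_cast; rw [uv_real, uv_real]; ring
      simp only [this, Finset.sum_sub_distrib]; simp; ring
    rw [h2, abs_le]; constructor <;> linarith

lemma ad_sub (h : Good l q σ r Y d) (hab : a ≠ b) (hY : ¬ Y.Adj a b) :
    Good l q σ (r + 2) (ad Y a b) (d - uv a - uv b) where
  deg := (h.sub_deg a b).deg
  forb := (h.ad_forb hab hY).forb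
  edges := (h.ad_forb hab hY).edges
  total := (h.sub_deg a b).total

end Good

section Regime

variable {n : ℕ} {l q σ r : ℝ} {Y : SimpleGraph (Fin n)} {d : Fin n → ℤ}

lemma dg_nonneg (Y : SimpleGraph (Fin n)) (j : Fin n) : (0 : ℝ) ≤ dg Y j := by
  rw [dg_real]; exact Finset.sum_nonneg fun _ _ => by split_ifs <;> norm_num

lemma Good.deg' (hp : Par n l q σ) (h : Good l q σ r Y d) (hr : r ≤ σ⁻¹) (j : Fin n) :
    |(d j : ℝ) - l * (n - 1)| ≤ 2 * q * σ⁻¹ := by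
  have := h.deg j; have := hp.q_ge; have : 0 < σ⁻¹ := inv_pos.2 hp.σ_pos
  nlinarith

lemma Good.forb' (hp : Par n l q σ) (h : Good l q σ r Y d) (hr : r ≤ σ⁻¹) (j : Fin n) :
    (dg Y j : ℝ) ≤ 2 * q * σ⁻¹ := by
  have := h.forb j; have := hp.q_ge; have : 0 < σ⁻¹ := inv_pos.2 hp.σ_pos
  nlinarith

lemma Par.inv_ge (hp : Par n l q σ) : 1000 * q ^ 10 ≤ σ⁻¹ := by
  refine le_trans ?_ (hp.pow_le_inv (K := 13) (by norm_num))
  have h1 : (16 : ℝ) ^ 3 ≤ q ^ 3 := by gcongr; exact hp.q_ge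
  have h2 : 0 < q ^ 10 := pow_pos hp.q_pos _
  calc 1000 * q ^ 10 ≤ q ^ 3 * q ^ 10 := by gcongr; linarith
    _ = q ^ 13 := by ring

lemma Par.inv_ge' (hp : Par n l q σ) : 1000 * q ^ 3 ≤ σ⁻¹ := by
  refine le_trans ?_ hp.inv_ge
  have : q ^ 3 ≤ q ^ 10 := pow_le_pow_right₀ (by linarith [hp.q_ge]) (by norm_num)
  linarith

/-- Crude bound for moving one unit of degree. -/
lemma shift_le (hp : Par n l q σ) (h : Good l q σ r Y d) (hr : r ≤ σ⁻¹) {a b : Fin n}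
    (hab : a ≠ b) : cnt Y (d - uv a + uv b) ≤ q ^ 4 * cnt Y d := by
  have hq := hp.q_ge
  have hs : 0 < σ⁻¹ := inv_pos.2 hp.σ_pos
  have h1 := hp.inv_ge'
  have hl0 := hp.l_pos
  have hl1 := hp.l_lt
  have hh := hp.half
  have ho : 0 < l * (1 - l) := mul_pos hl0 (by linarith)
  have hqs : 1 ≤ q * σ⁻¹ := by
    have : q ^ 3 = q * q * q := by ring
    have : 1 ≤ σ⁻¹ := by nlinarith [mul_pos hp.q_pos hp.q_pos]
    nlinarith
  refine (cnt_shift_le Y d (B := 4 * q * σ⁻¹) hl0 hl1 (by linarith) ?_ ?_ ?_ hab).trans ?_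
  · rw [hp.n_eq']
    have h2 : 320 * q ^ 2 ≤ σ⁻¹ := by
      have : q ^ 3 = q * q ^ 2 := by ring
      nlinarith [sq_nonneg q]
    have h3 : 160 * q ≤ l * (1 - l) * σ⁻¹ := by
      have h4 : l * (1 - l) * (320 * q ^ 2) ≤ l * (1 - l) * σ⁻¹ :=
        mul_le_mul_of_nonneg_left h2 ho.le
      nlinarith
    nlinarith
  · intro v
    have h2 := abs_le.1 (h.deg' hp hr v)
    have h3 : |(d v : ℝ) - l * n| ≤ 2 * q * σ⁻¹ + 1 := by
      rw [abs_le]; constructor <;> nlinarith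
    linarith
  · intro v
    have := h.forb' hp hr v
    linarith
  · refine mul_le_mul_of_nonneg_right ?_ (cnt_nonneg _ _)
    have h5 : 1 / (l * (1 - l)) ≤ 2 * q := by
      rw [div_le_iff₀ ho]; exact hh
    have h6 : 0 < 1 / (l * (1 - l)) := by positivity
    have h7 : 4 / (l * (1 - l)) + 4 / (l * (1 - l)) ^ 2
        = 4 * (1 / (l * (1 - l))) + 4 * (1 / (l * (1 - l))) ^ 2 := by
      field_simp
    rw [h7]
    have h8 : (1 / (l * (1 - l))) ^ 2 ≤ (2 * q) ^ 2 := by gcongr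
    have h9 : (16 : ℝ) ^ 2 * q ^ 2 ≤ q ^ 2 * q ^ 2 := by gcongr
    have : q ^ 4 = q ^ 2 * q ^ 2 := by ring
    nlinarith

lemma Good.deg_ge (hp : Par n l q σ) (h : Good l q σ r Y d) (hr : r ≤ σ⁻¹) (j : Fin n) :
    (n : ℝ) ≤ 2 * q * d j := by
  have h1 := abs_le.1 (h.deg' hp hr j)
  have hq := hp.q_ge
  have hs : 0 < σ⁻¹ := inv_pos.2 hp.σ_pos
  have h2 := hp.inv_ge'
  have h3 := hp.le_l
  have h4 := hp.n_eq'
  have hl := hp.l_lt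
  have h5 : 1 ≤ σ⁻¹ := by nlinarith [mul_pos hp.q_pos hp.q_pos, pow_pos hp.q_pos 3, pow_le_pow_right₀ (show 1 ≤ q by linarith) (show 1 ≤ 3 by norm_num)]
  have h6 : (n : ℝ) ≤ q * l * n := by nlinarith [hp.n_pos]
  have h7 : 2 * q * (2 * q * σ⁻¹ + 1) ≤ n := by
    rw [h4]
    have : 2 * q * (2 * q + 1) ≤ σ⁻¹ := by
      have : q ^ 3 = q * q ^ 2 := by ring
      nlinarith [sq_nonneg q]
    calc 2 * q * (2 * q * σ⁻¹ + 1) ≤ 2 * q * (2 * q * σ⁻¹ + 1 * σ⁻¹) := by gcongr; linarith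
      _ = 2 * q * (2 * q + 1) * σ⁻¹ := by ring
      _ ≤ _ := by gcongr
  have h8 : l * n - 1 - 2 * q * σ⁻¹ ≤ d j := by linarith
  have h9 : 2 * q * (l * n - 1 - 2 * q * σ⁻¹) ≤ 2 * q * d j := by gcongr
  linarith

lemma Good.codeg_ge (hp : Par n l q σ) (h : Good l q σ r Y d) (hr : r ≤ σ⁻¹) (j : Fin n) :
    (n : ℝ) ≤ 2 * q * (n - 1 - dg Y j - d j) := by
  have h1 := abs_le.1 (h.deg' hp hr j)
  have h1' := h.forb' hp hr j
  have hq := hp.q_ge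
  have hs : 0 < σ⁻¹ := inv_pos.2 hp.σ_pos
  have h2 := hp.inv_ge'
  have h3 := hp.le_l'
  have h4 := hp.n_eq'
  have hl := hp.l_pos
  have h5 : 1 ≤ σ⁻¹ := by nlinarith [mul_pos hp.q_pos hp.q_pos, pow_pos hp.q_pos 3, pow_le_pow_right₀ (show 1 ≤ q by linarith) (show 1 ≤ 3 by norm_num)]
  have h6 : (n : ℝ) ≤ q * (1 - l) * n := by nlinarith [hp.n_pos]
  have h7 : 2 * q * (4 * q * σ⁻¹ + 1) ≤ n := by
    rw [h4]
    have : 2 * q * (4 * q + 1) ≤ σ⁻¹ := by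
      have : q ^ 3 = q * q ^ 2 := by ring
      nlinarith [sq_nonneg q]
    calc 2 * q * (4 * q * σ⁻¹ + 1) ≤ 2 * q * (4 * q * σ⁻¹ + 1 * σ⁻¹) := by gcongr; linarith
      _ = 2 * q * (4 * q + 1) * σ⁻¹ := by ring
      _ ≤ _ := by gcongr
  have h8 : (1 - l) * n - 1 - 4 * q * σ⁻¹ ≤ n - 1 - dg Y j - d j := by linarith
  have h9 : 2 * q * ((1 - l) * n - 1 - 4 * q * σ⁻¹) ≤ 2 * q * (n - 1 - dg Y j - d j) := by gcongr
  linarith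

lemma cnt_ad_le {a b : Fin n} (hab : a ≠ b) (h : ¬ Y.Adj a b) :
    cnt (ad Y a b) (d - uv a - uv b) ≤ cnt Y d := by
  rw [cnt_split hab h d]; linarith [cnt_nonneg (ad Y a b) d]

lemma sum_non_adj (Y : SimpleGraph (Fin n)) (v : Fin n) :
    ∑ a, (if a ≠ v ∧ ¬ Y.Adj v a then (1 : ℝ) else 0) = n - 1 - dg Y v := by
  have h1 : ∀ a, (if a ≠ v ∧ ¬ Y.Adj v a then (1 : ℝ) else 0)
      = 1 - (if a = v then 1 else 0) - if Y.Adj v a then 1 else 0 := by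
    intro a
    by_cases h : a = v
    · subst h; simp
    · by_cases h' : Y.Adj v a <;> simp [h, h']
  simp only [h1, Finset.sum_sub_distrib, dg_real]
  simp

/-- The probability that a given edge is present is bounded away from one. -/
lemma edge_prob_le (hp : Par n l q σ) (h : Good l q σ r Y d) (hr : r + 4 ≤ σ⁻¹) {a v : Fin n}
    (hav : a ≠ v) (hY : ¬ Y.Adj a v) :
    cnt (ad Y a v) (d - uv a - uv v) ≤ (1 - 1 / q ^ 6) * cnt Y d := by
  have hq := hp.q_ge
  have hq4 : 1 ≤ q ^ 4 := one_le_pow₀ (by linarith)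
  have h1 : ∀ a', a' ≠ v ∧ ¬ Y.Adj v a' →
      cnt Y d - cnt (ad Y v a') (d - uv v - uv a') ≤ q ^ 4 * cnt (ad Y a v) d := by
    rintro a' ⟨h2, h3⟩
    have h4 := cnt_split h2.symm h3 d
    have h5 : cnt Y d - cnt (ad Y v a') (d - uv v - uv a') = cnt (ad Y v a') d := by linarith
    rw [h5, ad_comm]
    have hc := cnt_nonneg (ad Y a v) d
    by_cases ha : a' = a
    · subst ha; nlinarith
    have h3' : ¬ Y.Adj a' v := fun h => h3 h.symm
    have h6 : ¬ (ad Y a' v).Adj a v := by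
      rw [ad_adj Y h2]; simp [hY, hav, Ne.symm ha]
    have h7 : ¬ (ad Y a v).Adj a' v := by
      rw [ad_adj Y hav]; simp [h3', h2, ha]
    have h8 := ((h.ad_forb hav hY).ad_sub h2 h7)
    have h9 := shift_le hp h8 (by linarith) (Ne.symm ha)
    rw [cnt_split hav h6 d, cnt_split h2 h7 d, ad_right_comm Y a' v a v]
    have e1 : d - uv a' - uv v - uv a + uv a' = d - uv a - uv v := by abel
    rw [e1] at h9
    have := cnt_nonneg (ad (ad Y a v) a' v) d
    nlinarith
  have h2 : ∑ a', (if a' ≠ v ∧ ¬ Y.Adj v a' then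
      cnt Y d - cnt (ad Y v a') (d - uv v - uv a') else 0) ≤ n * (q ^ 4 * cnt (ad Y a v) d) := by
    refine (Finset.sum_le_card_nsmul univ _ (q ^ 4 * cnt (ad Y a v) d) fun a' _ => ?_).trans ?_
    · split_ifs with h3
      · exact h1 a' h3
      · exact mul_nonneg (by positivity) (cnt_nonneg _ _)
    · simp
  have h3 : ∑ a', (if a' ≠ v ∧ ¬ Y.Adj v a' then
      cnt Y d - cnt (ad Y v a') (d - uv v - uv a') else 0)
      = (n - 1 - dg Y v - d v) * cnt Y d := by
    have h4 := sum_cnt_edge Y d v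
    have h5 := sum_non_adj Y v
    calc _ = ∑ a', ((if a' ≠ v ∧ ¬ Y.Adj v a' then (1 : ℝ) else 0) * cnt Y d
            - (if a' ≠ v ∧ ¬ Y.Adj v a' then cnt (ad Y v a') (d - uv v - uv a') else 0)) := by
          refine Finset.sum_congr rfl fun a' _ => ?_
          split_ifs <;> simp
      _ = _ := by
          rw [Finset.sum_sub_distrib, ← Finset.sum_mul, h4, h5]; ring
  rw [h3] at h2
  have h4 := h.codeg_ge hp (by linarith) v
  have h5 := cnt_split hav hY d
  have hn := hp.n_pos
  have hN := cnt_nonneg Y d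
  have h6 : n * cnt Y d ≤ n * (2 * q * q ^ 4 * cnt (ad Y a v) d) := by
    calc n * cnt Y d ≤ 2 * q * (n - 1 - dg Y v - d v) * cnt Y d := by gcongr
      _ = 2 * q * ((n - 1 - dg Y v - d v) * cnt Y d) := by ring
      _ ≤ 2 * q * (n * (q ^ 4 * cnt (ad Y a v) d)) := by gcongr
      _ = _ := by ring
  have h7 : cnt Y d ≤ 2 * q * q ^ 4 * cnt (ad Y a v) d := le_of_mul_le_mul_left h6 hn
  have h8 : 1 / q ^ 6 * cnt Y d ≤ cnt (ad Y a v) d := by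
    rw [div_mul_eq_mul_div, one_mul, div_le_iff₀ (by positivity)]
    refine h7.trans ?_
    have : 2 * q * q ^ 4 ≤ q ^ 6 := by
      have : q ^ 6 = q * q * q ^ 4 := by ring
      rw [this]; gcongr; linarith
    have := mul_le_mul_of_nonneg_right this (cnt_nonneg (ad Y a v) d)
    linarith
  linarith

end Regime

section Contraction

variable {n : ℕ} {l q σ r : ℝ} {Y : SimpleGraph (Fin n)} {d : Fin n → ℤ} {a b : Fin n}

/-- The summand of `cnt_shift_rec` at the vertex `v`. -/
def recTerm (Y : SimpleGraph (Fin n)) (d : Fin n → ℤ) (a b v : Fin n) : ℝ :=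
  if Y.Adj a v then
    (if Y.Adj b v then 0 else cnt (ad Y b v) (d - uv a - uv v))
  else
    (if Y.Adj b v then - cnt (ad Y a v) (d - uv a - uv v)
      else cnt (ad (ad Y a v) b v) (d - uv a - uv v - uv a - uv v)
        - cnt (ad (ad Y a v) b v) (d - uv a - uv v - uv b - uv v))

/-- The contribution to `cnt_shift_rec` of the edge `ab`. -/
def recEdge (Y : SimpleGraph (Fin n)) (d : Fin n → ℤ) (a b : Fin n) : ℝ :=
  if Y.Adj a b then 0 else cnt (ad Y a b) (d - uv a - uv a) - cnt (ad Y a b) (d - uv a - uv b)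

lemma recTerm_bound (hab : a ≠ b) {k : ℝ} (hk : 0 ≤ k) {M E : Fin n → ℝ}
    (h : ∀ v ∈ univ \ {a, b}, |recTerm Y d a b v - M v * cnt Y d|
      ≤ (if v ≠ b ∧ ¬ Y.Adj b v then k * cnt (ad Y b v) (d - uv b - uv v) else 0)
        + E v * cnt Y d) :
    |((d b : ℝ) + 1) * cnt Y (d - uv a + uv b) - d a * cnt Y d - recEdge Y d a b
        - (∑ v ∈ univ \ {a, b}, M v) * cnt Y d|
      ≤ k * (d b * cnt Y d) + (∑ v ∈ univ \ {a, b}, E v) * cnt Y d := by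
  have h1 := cnt_shift_rec Y d hab
  have h2 : ((d b : ℝ) + 1) * cnt Y (d - uv a + uv b) - d a * cnt Y d - recEdge Y d a b
      = ∑ v ∈ univ \ {a, b}, recTerm Y d a b v := by
    rw [h1]; unfold recEdge recTerm; ring
  rw [h2, Finset.sum_mul, ← Finset.sum_sub_distrib]
  refine (Finset.abs_sum_le_sum_abs _ _).trans ((Finset.sum_le_sum h).trans ?_)
  rw [Finset.sum_add_distrib, Finset.sum_mul, ← sum_cnt_edge Y d b, Finset.mul_sum]
  refine add_le_add ?_ le_rfl
  refine (Finset.sum_le_sum_of_subset_of_nonneg (Finset.subset_univ _) fun v _ _ => ?_).trans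
    (Finset.sum_le_sum fun v _ => ?_)
  · split_ifs
    · exact mul_nonneg hk (cnt_nonneg _ _)
    · exact le_rfl
  · split_ifs <;> simp

/-- The effect of moving one unit of degree is `1 + hat`, up to a relative error `m`. -/
def ShiftEst {n : ℕ} (l q σ : ℝ)
    (hat : SimpleGraph (Fin n) → (Fin n → ℤ) → Fin n → Fin n → ℝ) (r m : ℝ) : Prop :=
  ∀ Y d, Good l q σ r Y d → ∀ a b, a ≠ b →
    |cnt Y (d - uv a + uv b) - (1 + hat Y d a b) * cnt Y d| ≤ m * cnt Y d

variable {hat : SimpleGraph (Fin n) → (Fin n → ℤ) → Fin n → Fin n → ℝ} {m m' : ℝ}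

lemma ShiftEst.mono {r' : ℝ} (h : ShiftEst l q σ hat r m) (hr : r' ≤ r) (hm : m ≤ m') :
    ShiftEst l q σ hat r' m' := fun Y d hg a b hab =>
  (h Y d (hg.mono hr) a b hab).trans (mul_le_mul_of_nonneg_right hm (cnt_nonneg _ _))

lemma recTerm_free (hC : ShiftEst l q σ hat (r + 4) m) (h : Good l q σ r Y d)
    {v : Fin n} (hab : a ≠ b) (hav : a ≠ v) (hbv : b ≠ v) (ha : ¬ Y.Adj a v) (hb : ¬ Y.Adj b v) :
    |recTerm Y d a b v - hat (ad (ad Y a v) b v) (d - uv a - uv v - uv b - uv v) a b *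
        cnt (ad (ad Y a v) b v) (d - uv a - uv v - uv b - uv v)|
      ≤ m * cnt (ad (ad Y a v) b v) (d - uv a - uv v - uv b - uv v) := by
  have hb' : ¬ (ad Y a v).Adj b v := by
    rw [ad_adj Y hav]; simp [hb, hab.symm, hbv]
  have h1 := hC _ _ (((h.ad_sub hav ha).ad_sub hbv hb').mono (by linarith)) a b hab
  have e1 : d - uv a - uv v - uv b - uv v - uv a + uv b = d - uv a - uv v - uv a - uv v := by abel
  rw [e1] at h1
  rw [recTerm, if_neg ha, if_neg hb]
  refine le_trans (le_of_eq ?_) h1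
  congr 1; ring

lemma recTerm_left (hC : ShiftEst l q σ hat (r + 4) m) (h : Good l q σ r Y d)
    {v : Fin n} (hab : a ≠ b) (hbv : b ≠ v) (ha : Y.Adj a v) (hb : ¬ Y.Adj b v) :
    |recTerm Y d a b v - (1 + hat (ad Y b v) (d - uv b - uv v) a b) *
        cnt (ad Y b v) (d - uv b - uv v)| ≤ m * cnt (ad Y b v) (d - uv b - uv v) := by
  have h1 := hC _ _ ((h.ad_sub hbv hb).mono (by linarith)) a b hab
  have e1 : d - uv b - uv v - uv a + uv b = d - uv a - uv v := by abel
  rw [e1] at h1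
  rw [recTerm, if_pos ha, if_neg hb]
  exact h1

lemma two_edges_le (hp : Par n l q σ) (h : Good l q σ r Y d) (hr : r + 8 ≤ σ⁻¹)
    {v : Fin n} (hab : a ≠ b) (hav : a ≠ v) (hbv : b ≠ v) (ha : ¬ Y.Adj a v) (hb : ¬ Y.Adj b v) :
    cnt (ad (ad Y a v) b v) (d - uv a - uv v - uv b - uv v)
      ≤ (1 - 1 / q ^ 6) * cnt (ad Y b v) (d - uv b - uv v) := by
  have ha' : ¬ (ad Y b v).Adj a v := by
    rw [ad_adj Y hbv]; simp [ha, hab, hav]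
  have h1 := edge_prob_le hp (h.ad_sub hbv hb) (by linarith) hav ha'
  rw [ad_right_comm Y a v b v]
  have e1 : d - uv a - uv v - uv b - uv v = d - uv b - uv v - uv a - uv v := by abel
  rwa [e1]

lemma one_sub_nonneg (hp : Par n l q σ) (K : ℕ) : 0 ≤ 1 - 1 / q ^ K := by
  have : 1 ≤ q ^ K := one_le_pow₀ (by linarith [hp.q_ge])
  have : 1 / q ^ K ≤ 1 := by rw [div_le_one (by linarith)]; exact this
  linarith

lemma ShiftEst.iterate (hp : Par n l q σ) {R M m0 e : ℝ} (he : 0 ≤ e) (hm0 : 0 ≤ m0)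
    (hM : m0 + e * q ^ 7 ≤ M) (hR : σ⁻¹ / 8 ≤ R) (hm : m0 * σ ^ 3 ≤ e)
    (hstep : ∀ r m, 0 ≤ r → r + 4 ≤ R → 0 ≤ m → m ≤ M → ShiftEst l q σ hat (r + 4) m →
      ShiftEst l q σ hat r ((1 - 1 / q ^ 7) * m + e))
    (h0 : ShiftEst l q σ hat R m0) : ShiftEst l q σ hat (R - σ⁻¹ / 8) (q ^ 8 * e) := by
  have hq := hp.q_ge
  have hk := one_sub_nonneg hp 7
  have hk1 : 1 - 1 / q ^ 7 ≤ 1 := by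
    have : 0 < 1 / q ^ 7 := by have := hp.q_pos; positivity
    linarith
  have key : ∀ t : ℕ, 4 * (t : ℝ) ≤ R →
      ShiftEst l q σ hat (R - 4 * t) ((1 - 1 / q ^ 7) ^ t * m0 + e * q ^ 7) := by
    intro t
    induction t with
    | zero => intro _; exact h0.mono (by simp) (by simp; positivity)
    | succ t ih =>
      intro ht
      push_cast at ht ⊢
      have h1 := ih (by linarith)
      have hkt : (1 - 1 / q ^ 7) ^ t * m0 ≤ m0 :=
        mul_le_of_le_one_left hm0 (pow_le_one₀ hk hk1)
      have h2 := hstep (R - 4 * (t + 1)) _ (by linarith) (by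
        have : (0 : ℝ) ≤ t := Nat.cast_nonneg t
        linarith) (by positivity) (by linarith)
        (h1.mono (by linarith) le_rfl)
      refine h2.mono le_rfl (le_of_eq ?_)
      have h3 : e * q ^ 7 * (1 - 1 / q ^ 7) = e * q ^ 7 - e := by
        have : q ^ 7 ≠ 0 := by have := hp.q_pos; positivity
        field_simp
      generalize 1 - 1 / q ^ 7 = k at *
      calc k * (k ^ t * m0 + e * q ^ 7) + e = k ^ (t + 1) * m0 + e * q ^ 7 * k + e := by ring
        _ = _ := by rw [h3]; ring
  obtain ⟨T, hT1, hT2⟩ : ∃ T : ℕ, q ^ 8 ≤ T ∧ (T : ℝ) ≤ q ^ 8 + 1 :=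
    ⟨⌈q ^ 8⌉₊, Nat.le_ceil _, (Nat.ceil_lt_add_one (by have := hp.q_pos; positivity)).le⟩
  have h8 : q ^ 8 ≤ q ^ 10 := pow_le_pow_right₀ (by linarith) (by norm_num)
  have h81 : 1 ≤ q ^ 8 := one_le_pow₀ (by linarith)
  have hi := hp.inv_ge
  refine (key T (by linarith)).mono (by linarith) ?_
  have h3 : (1 - 1 / q ^ 7) ^ T ≤ σ ^ 3 := by
    refine le_trans ?_ hp.exp_le
    have h4 : 1 - 1 / q ^ 7 ≤ Real.exp (-(1 / q ^ 7)) := by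
      have := Real.add_one_le_exp (-(1 / q ^ 7)); linarith
    refine (pow_le_pow_left₀ hk h4 T).trans ?_
    rw [← Real.exp_nat_mul]
    refine Real.exp_le_exp.2 ?_
    have h7 : 0 < q ^ 7 := by have := hp.q_pos; positivity
    have h5 : q ≤ T * (1 / q ^ 7) := by
      rw [mul_one_div, le_div_iff₀ h7]
      calc q * q ^ 7 = q ^ 8 := by ring
        _ ≤ (T : ℝ) := hT1
    linarith
  have h9 : (1 - 1 / q ^ 7) ^ T * m0 ≤ e := by
    refine le_trans ?_ hm
    rw [mul_comm]; gcongr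
  have h10 : e + e * q ^ 7 ≤ q ^ 8 * e := by
    have h7 : 1 ≤ q ^ 7 := one_le_pow₀ (by linarith)
    have : q ^ 8 = q * q ^ 7 := by ring
    rw [this]
    nlinarith [mul_nonneg he (by linarith : (0:ℝ) ≤ q ^ 7 - 1)]
  linarith

lemma recEdge_crude (hp : Par n l q σ) (h : Good l q σ r Y d) (hr : r + 4 ≤ σ⁻¹) (hab : a ≠ b) :
    |recEdge Y d a b| ≤ q ^ 4 * cnt Y d := by
  unfold recEdge
  have hN := cnt_nonneg Y d
  have hq := hp.q_ge
  have hq4 : 1 ≤ q ^ 4 := one_le_pow₀ (by linarith)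
  split_ifs with hY
  · rw [abs_zero]; positivity
  · have h1 := shift_le hp (h.ad_sub hab hY) (by linarith) hab
    have e1 : d - uv a - uv b - uv a + uv b = d - uv a - uv a := by abel
    rw [e1] at h1
    have h2 := cnt_ad_le (d := d) hab hY
    have h3 := cnt_nonneg (ad Y a b) (d - uv a - uv b)
    have h4 := cnt_nonneg (ad Y a b) (d - uv a - uv a)
    rw [abs_le]
    constructor <;> nlinarith

lemma sum_adj_le (Y : SimpleGraph (Fin n)) (c : Fin n) (s : Finset (Fin n)) :
    ∑ v ∈ s, (if Y.Adj c v then (1 : ℝ) else 0) ≤ dg Y c := by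
  rw [dg_real]
  exact Finset.sum_le_sum_of_subset_of_nonneg (Finset.subset_univ _)
    fun _ _ _ => by split_ifs <;> norm_num

set_option maxHeartbeats 800000 in
lemma shift_est_crude_improve (hp : Par n l q σ) (hr : r + 8 ≤ σ⁻¹) (hm : 0 ≤ m)
    (hC : ShiftEst l q σ (fun (_ : SimpleGraph (Fin n)) _ _ _ => 0) (r + 4) m) :
    ShiftEst l q σ (fun (_ : SimpleGraph (Fin n)) _ _ _ => 0) r
      ((1 - 1 / q ^ 7) * m + q ^ 8 * σ) := by
  intro Y d h a b hab
  have hq := hp.q_ge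
  have hN := cnt_nonneg Y d
  have hq4 : 1 ≤ q ^ 4 := one_le_pow₀ (by linarith)
  have hk := one_sub_nonneg hp 6
  have h1 := recTerm_bound (Y := Y) (d := d) hab (k := (1 - 1 / q ^ 6) * m) (M := fun _ => 0)
    (E := fun v => q ^ 4 * (if Y.Adj a v then 1 else 0) + (if Y.Adj b v then 1 else 0))
    (by positivity) (by
      intro v hv
      have hav : a ≠ v := by rintro rfl; simp at hv
      have hbv : b ≠ v := by rintro rfl; simp at hv
      rw [zero_mul, sub_zero]
      by_cases ha : Y.Adj a v <;> by_cases hb : Y.Adj b v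
      · simp only [recTerm, ha, hb, if_true, abs_zero]
        have : 0 ≤ (if v ≠ b ∧ ¬ True then (1 - 1 / q ^ 6) * m *
          cnt (ad Y b v) (d - uv b - uv v) else 0) := by simp
        positivity
      · have h2 := shift_le hp (h.ad_sub hbv hb) (by linarith) hab
        have e1 : d - uv b - uv v - uv a + uv b = d - uv a - uv v := by abel
        rw [e1] at h2
        have h3 := cnt_ad_le (d := d) hbv hb
        simp only [recTerm, ha, hb, if_true, if_false, hbv.symm, ne_eq, not_false_eq_true,
          and_self, mul_one, add_zero]
        rw [abs_of_nonneg (cnt_nonneg _ _)]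
        have h4 : 0 ≤ (1 - 1 / q ^ 6) * m * cnt (ad Y b v) (d - uv b - uv v) :=
          mul_nonneg (by positivity) (cnt_nonneg _ _)
        have h5 : q ^ 4 * cnt (ad Y b v) (d - uv b - uv v) ≤ q ^ 4 * cnt Y d := by gcongr
        linarith
      · have h3 := cnt_ad_le (d := d) hav ha
        simp only [recTerm, ha, hb, if_true, if_false, not_true_eq_false, and_false, mul_zero,
          zero_add, one_mul, abs_neg]
        rw [abs_of_nonneg (cnt_nonneg _ _)]
        exact h3
      · have h2 := recTerm_free hC h hab hav hbv ha hb
        have h3 := two_edges_le hp h hr hab hav hbv ha hb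
        rw [zero_mul, sub_zero] at h2
        simp only [ha, hb, if_true, if_false, hbv.symm, ne_eq, not_false_eq_true,
          and_self, mul_zero, zero_mul, add_zero]
        refine h2.trans ?_
        calc _ ≤ m * ((1 - 1 / q ^ 6) * cnt (ad Y b v) (d - uv b - uv v)) := by gcongr
          _ = _ := by ring)
  have h2 : ∑ v ∈ univ \ {a, b}, (q ^ 4 * (if Y.Adj a v then (1 : ℝ) else 0)
      + (if Y.Adj b v then 1 else 0)) ≤ q ^ 4 * (4 * q * σ⁻¹) := by
    rw [Finset.sum_add_distrib, ← Finset.mul_sum]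
    have ha := (sum_adj_le Y a (univ \ {a, b})).trans (h.forb' hp (by linarith) a)
    have hb := (sum_adj_le Y b (univ \ {a, b})).trans (h.forb' hp (by linarith) b)
    have h0 : 0 ≤ 2 * q * σ⁻¹ := by have := inv_pos.2 hp.σ_pos; positivity
    nlinarith
  have h3 := recEdge_crude hp h (by linarith) hab
  have h4 := abs_le.1 (h.deg' hp (by linarith) a)
  have h5 := abs_le.1 (h.deg' hp (by linarith) b)
  have h6 := h.deg_ge hp (by linarith) b
  have hs := inv_pos.2 hp.σ_pos
  have hi := hp.inv_ge'
  have hq3 : 1 ≤ q ^ 3 := one_le_pow₀ (by linarith)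
  set N := cnt Y d with hNdef
  set c := cnt Y (d - uv a + uv b) with hc
  simp only [Finset.sum_const_zero, zero_mul, sub_zero, add_zero, one_mul] at h1 ⊢
  have h7 : |((d b : ℝ) + 1) * (c - N)| ≤ (1 - 1 / q ^ 6) * m * (d b * N)
      + (q ^ 7 * σ⁻¹ / 2) * N := by
    have e1 : ((d b : ℝ) + 1) * (c - N)
        = (((d b : ℝ) + 1) * c - d a * N - recEdge Y d a b) + recEdge Y d a b
          + ((d a : ℝ) - d b - 1) * N := by ring
    have h8 : |((d a : ℝ) - d b - 1) * N| ≤ (5 * q * σ⁻¹) * N := by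
      rw [abs_mul, abs_of_nonneg hN]
      refine mul_le_mul_of_nonneg_right ?_ hN
      rw [abs_le]; constructor <;> nlinarith
    have h9 : (∑ v ∈ univ \ {a, b}, (q ^ 4 * (if Y.Adj a v then (1 : ℝ) else 0)
      + (if Y.Adj b v then 1 else 0))) * N ≤ q ^ 4 * (4 * q * σ⁻¹) * N := by gcongr
    have h10 : q ^ 4 * (4 * q * σ⁻¹) + 5 * q * σ⁻¹ + q ^ 4 ≤ q ^ 7 * σ⁻¹ / 2 := by
      have e2 : q ^ 7 = q ^ 4 * q * q ^ 2 := by ring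
      have h11 : (16 : ℝ) ^ 2 ≤ q ^ 2 := by gcongr
      have h12 : q ^ 4 ≤ q ^ 4 * (q * σ⁻¹) := by
        have : 1 ≤ q * σ⁻¹ := by nlinarith
        nlinarith
      have h13 : q * σ⁻¹ ≤ q ^ 4 * (q * σ⁻¹) := by
        have : 0 ≤ q * σ⁻¹ := by positivity
        nlinarith
      have h14 : 16 ^ 2 * (q ^ 4 * (q * σ⁻¹)) ≤ q ^ 2 * (q ^ 4 * (q * σ⁻¹)) := by gcongr
      have e3 : q ^ 7 * σ⁻¹ = q ^ 2 * (q ^ 4 * (q * σ⁻¹)) := by ring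
      linarith
    rw [e1]
    refine (abs_add_three _ _ _).trans ?_
    have := mul_le_mul_of_nonneg_right h10 hN
    linarith
  have hD : (0 : ℝ) < d b + 1 := by
    have := hp.n_pos
    by_contra hcon
    nlinarith
  rw [abs_mul, abs_of_pos hD] at h7
  have h8 : q ^ 7 * σ⁻¹ / 2 ≤ (d b + 1) * (q ^ 8 * σ) := by
    have e1 : q ^ 7 * σ⁻¹ / 2 = (n / 2) * (q ^ 7 * σ) := by
      have := hp.σ_pos
      rw [hp.n_eq']; field_simp
    rw [e1]
    calc (n / 2 : ℝ) * (q ^ 7 * σ) ≤ (q * (d b + 1)) * (q ^ 7 * σ) := by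
          have := hp.σ_pos
          gcongr; nlinarith
      _ = _ := by ring
  have h9 : (d b + 1) * |c - N| ≤ (d b + 1) * (((1 - 1 / q ^ 6) * m + q ^ 8 * σ) * N) := by
    have h10 : (1 - 1 / q ^ 6) * m * (d b * N) ≤ (1 - 1 / q ^ 6) * m * ((d b + 1) * N) := by
      gcongr; linarith
    have h11 : q ^ 7 * σ⁻¹ / 2 * N ≤ (d b + 1) * (q ^ 8 * σ) * N := by gcongr
    linarith
  refine (le_of_mul_le_mul_left h9 hD).trans ?_
  have h10 : 1 / q ^ 7 ≤ 1 / q ^ 6 := by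
    apply one_div_le_one_div_of_le (by positivity)
    exact pow_le_pow_right₀ (by linarith) (by norm_num)
  gcongr

lemma shift_est_crude (hp : Par n l q σ) :
    ShiftEst l q σ (fun (_ : SimpleGraph (Fin n)) _ _ _ => 0) (σ⁻¹ * (3 / 4)) (q ^ 16 * σ) := by
  have hq := hp.q_ge
  have hi := hp.inv_ge
  have hσ := hp.σ_pos
  have hσ1 := hp.σ_le
  have hq10 : 1 ≤ q ^ 10 := one_le_pow₀ (by linarith)
  have hb : ShiftEst l q σ (fun (_ : SimpleGraph (Fin n)) _ _ _ => 0) (σ⁻¹ * (7 / 8)) (q ^ 4) := by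
    intro Y d h a b hab
    have h1 := shift_le hp h (by linarith) hab
    have h2 := cnt_nonneg Y d
    have h3 := cnt_nonneg Y (d - uv a + uv b)
    have hq4 : 1 ≤ q ^ 4 := one_le_pow₀ (by linarith)
    rw [add_zero, one_mul, abs_le]
    constructor <;> nlinarith
  have h := hb.iterate hp (M := q ^ 4 + q ^ 8 * σ * q ^ 7) (e := q ^ 8 * σ) (by positivity)
    (by positivity) le_rfl (by linarith) ?_ (fun r m h0 h1 h2 _ hC =>
      shift_est_crude_improve hp (by linarith) h2 hC)
  · refine h.mono (by linarith) (le_of_eq ?_)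
    ring
  · have h4 : q ^ 4 ≤ q ^ 8 := pow_le_pow_right₀ (by linarith) (by norm_num)
    have h5 : σ ^ 3 ≤ σ := by
      calc σ ^ 3 = σ * (σ ^ 2) := by ring
        _ ≤ σ * 1 := by gcongr; exact pow_le_one₀ hσ.le hσ1
        _ = σ := mul_one _
    gcongr

end Contraction

section Profile

variable {n : ℕ} {l q σ r : ℝ} {Y : SimpleGraph (Fin n)} {d : Fin n → ℤ}

lemma Bd.cast {q θ φ x y : ℝ} {K L : ℕ} (hq : 2 ≤ q) (h : Bd q K θ x) (e : y = x) (hKL : K ≤ L)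
    (hθ : θ = φ) : Bd q L φ y := by
  rw [e]; exact h.mono hq hKL hθ.le

lemma Par.bd_pow (hp : Par n l q σ) {K i j : ℕ} {x : ℝ} (h : Bd q K (σ ^ i) x) (hji : j ≤ i) :
    Bd q K (σ ^ j) x :=
  h.mono hp.two_le le_rfl (pow_le_pow_of_le_one hp.σ_pos.le hp.σ_le hji)

/-- The normalised excess degree `δ_j / n`. -/
def eD (l σ : ℝ) (Y : SimpleGraph (Fin n)) (d : Fin n → ℤ) (j : Fin n) : ℝ :=
  ((d j : ℝ) - l * (n - 1) + l * dg Y j) * σ ^ 2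

/-- The normalised forbidden degree `x_j / n`. -/
def eX (σ : ℝ) (Y : SimpleGraph (Fin n)) (j : Fin n) : ℝ := dg Y j * σ ^ 2

/-- The normalised sum of the excess degrees of the forbidden neighbours. -/
def eS (l σ : ℝ) (Y : SimpleGraph (Fin n)) (d : Fin n → ℤ) (c : Fin n) : ℝ :=
  (∑ v, if Y.Adj c v then eD l σ Y d v else 0) * σ ^ 2

/-- The second order part of the effect of moving one unit of degree. -/
def tail (l Da Db xa xb Sa Sb : ℝ) : ℝ :=
  (l * (1 - l))⁻¹ * ((Da - Db) * (Da * (1 - l)⁻¹ - Db * l⁻¹) + (xa * Da - xb * Db) + (Sa - Sb))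

/-- The predicted effect of moving one unit of degree from `a` to `b`. -/
def shiftHat (l σ : ℝ) (Y : SimpleGraph (Fin n)) (d : Fin n → ℤ) (a b : Fin n) : ℝ :=
  (l * (1 - l))⁻¹ * (eD l σ Y d a - eD l σ Y d b - σ ^ 2)
    + tail l (eD l σ Y d a) (eD l σ Y d b) (eX σ Y a) (eX σ Y b) (eS l σ Y d a) (eS l σ Y d b)

lemma Par.inv_l (hp : Par n l q σ) : Bd q 1 (σ ^ 0) l⁻¹ := by
  have h1 := hp.l_pos
  have h2 := hp.le_l
  unfold Bd
  rw [abs_of_pos (inv_pos.2 h1), pow_zero, pow_one, mul_one, inv_le_iff_one_le_mul₀ h1]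
  exact h2

lemma Par.inv_l' (hp : Par n l q σ) : Bd q 1 (σ ^ 0) (1 - l)⁻¹ := by
  have h1 : 0 < 1 - l := by linarith [hp.l_lt]
  have h2 := hp.le_l'
  unfold Bd
  rw [abs_of_pos (inv_pos.2 h1), pow_zero, pow_one, mul_one, inv_le_iff_one_le_mul₀ h1]
  exact h2

lemma Par.inv_o (hp : Par n l q σ) : Bd q 2 (σ ^ 0) (l * (1 - l))⁻¹ := by
  have h := hp.inv_l.pmul hp.inv_l'
  rw [mul_inv]
  exact h.mono hp.two_le (by norm_num) (by norm_num)

lemma Par.bd_l (hp : Par n l q σ) : Bd q 0 (σ ^ 0) l := by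
  refine Bd.of_abs_le ?_
  rw [abs_of_pos hp.l_pos]; exact hp.l_lt.le

lemma Par.bd_l' (hp : Par n l q σ) : Bd q 0 (σ ^ 0) (1 - l) := by
  refine Bd.of_abs_le ?_
  rw [abs_of_pos (by linarith [hp.l_lt])]; linarith [hp.l_pos]

lemma Par.bd_σ (hp : Par n l q σ) (i : ℕ) : Bd q 0 (σ ^ i) (σ ^ i) := by
  unfold Bd
  rw [abs_of_nonneg (pow_nonneg hp.σ_pos.le i)]; simp

lemma Good.excess_le (hp : Par n l q σ) (h : Good l q σ r Y d) (hr : r ≤ σ⁻¹) (j : Fin n) :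
    |(d j : ℝ) - l * (n - 1) + l * dg Y j| ≤ 4 * q * σ⁻¹ := by
  have h1 := h.deg' hp hr j
  have h2 := h.forb' hp hr j
  have h3 := dg_nonneg Y j
  have h4 : |l * (dg Y j : ℝ)| ≤ 2 * q * σ⁻¹ := by
    rw [abs_mul, abs_of_pos hp.l_pos, abs_of_nonneg h3]
    nlinarith [hp.l_lt, hp.l_pos]
  exact (abs_add_le _ _).trans (by linarith)

lemma Good.bd_eD (hp : Par n l q σ) (h : Good l q σ r Y d) (hr : r ≤ σ⁻¹) (j : Fin n) :
    Bd q 2 (σ ^ 1) (eD l σ Y d j) := by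
  have h1 := h.excess_le hp hr j
  have hσ := hp.σ_pos
  have hq := hp.q_ge
  unfold Bd eD
  rw [abs_mul, abs_of_pos (pow_pos hσ 2)]
  calc _ ≤ (4 * q * σ⁻¹) * σ ^ 2 := by gcongr
    _ = 4 * q * σ := by field_simp
    _ ≤ _ := by
      rw [pow_one]; gcongr; nlinarith

lemma Good.bd_eX (hp : Par n l q σ) (h : Good l q σ r Y d) (hr : r ≤ σ⁻¹) (j : Fin n) :
    Bd q 2 (σ ^ 1) (eX σ Y j) := by
  have h1 := h.forb' hp hr j
  have h2 := dg_nonneg Y j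
  have hσ := hp.σ_pos
  have hq := hp.q_ge
  unfold Bd eX
  rw [abs_mul, abs_of_pos (pow_pos hσ 2), abs_of_nonneg h2]
  calc _ ≤ (2 * q * σ⁻¹) * σ ^ 2 := by gcongr
    _ = 2 * q * σ := by field_simp
    _ ≤ _ := by
      rw [pow_one]; gcongr; nlinarith

/-- A sum over the forbidden neighbours of a vertex. -/
lemma Good.bd_sum_adj (hp : Par n l q σ) (h : Good l q σ r Y d) (hr : r ≤ σ⁻¹) (c : Fin n)
    {K : ℕ} {θ : ℝ} {f : Fin n → ℝ} (hf : ∀ v, Bd q K θ (f v)) :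
    Bd q (K + 2) (σ * θ) ((∑ v, if Y.Adj c v then f v else 0) * σ ^ 2) := by
  have h2 := h.bd_eX hp hr c
  have hθ : 0 ≤ θ := (hf c).nonneg_scale hp.two_le
  have hσ := hp.σ_pos
  have hq := hp.q_pos
  unfold Bd at *
  rw [abs_mul, abs_of_pos (pow_pos hσ 2)]
  have h3 : |∑ v, if Y.Adj c v then f v else 0| ≤ dg Y c * (q ^ K * θ) := by
    refine (Finset.abs_sum_le_sum_abs _ _).trans ?_
    rw [dg_real, Finset.sum_mul]
    refine Finset.sum_le_sum fun v _ => ?_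
    split_ifs
    · rw [one_mul]; exact hf v
    · simp
  calc _ ≤ dg Y c * (q ^ K * θ) * σ ^ 2 := by gcongr
    _ = eX σ Y c * (q ^ K * θ) := by unfold eX; ring
    _ ≤ (q ^ 2 * σ ^ 1) * (q ^ K * θ) := by
      have := (le_abs_self _).trans h2
      gcongr
    _ = _ := by ring

lemma Good.bd_eS (hp : Par n l q σ) (h : Good l q σ r Y d) (hr : r ≤ σ⁻¹) (j : Fin n) :
    Bd q 4 (σ ^ 2) (eS l σ Y d j) :=
  (h.bd_sum_adj hp hr j (h.bd_eD hp hr)).cast hp.two_le rfl le_rfl (by ring)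

lemma Good.bd_sum_eD (hp : Par n l q σ) (h : Good l q σ r Y d) (hr : r ≤ σ⁻¹) :
    Bd q 2 (σ ^ 0) (∑ j, eD l σ Y d j) := by
  have h1 := h.total
  have h2 := h.edges
  have hσ := hp.σ_pos
  have hn := hp.n_eq
  have hq := hp.q_ge
  have h0 : (0 : ℝ) ≤ ∑ j, (dg Y j : ℝ) := Finset.sum_nonneg fun j _ => dg_nonneg Y j
  have h3 : ∑ j, eD l σ Y d j = (∑ j, ((d j : ℝ) - l * (n - 1)) + l * ∑ j, (dg Y j : ℝ)) * σ ^ 2 := by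
    unfold eD
    rw [← Finset.sum_mul, Finset.sum_add_distrib, ← Finset.mul_sum]
  have h4 : r ≤ n := by
    refine hr.trans ?_
    rw [hp.n_eq']
    have : 1 ≤ σ⁻¹ := (one_le_inv₀ hσ).2 hp.σ_le
    nlinarith
  have h5 : |l * ∑ j, (dg Y j : ℝ)| ≤ 2 * q * n := by
    rw [abs_mul, abs_of_pos hp.l_pos, abs_of_nonneg h0]
    have : ∑ j, (dg Y j : ℝ) ≤ 2 * q * n := by nlinarith [hp.n_pos]
    nlinarith [hp.l_lt, hp.l_pos]
  unfold Bd
  rw [h3, abs_mul, abs_of_pos (pow_pos hσ 2), pow_zero, mul_one]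
  have h6 : |∑ j, ((d j : ℝ) - l * (n - 1)) + l * ∑ j, (dg Y j : ℝ)| ≤ q ^ 2 * n := by
    refine (abs_add_le _ _).trans ?_
    nlinarith [hp.n_pos]
  calc _ ≤ q ^ 2 * n * σ ^ 2 := by gcongr
    _ = q ^ 2 := by rw [mul_assoc, hn, mul_one]

variable {a b : Fin n}

lemma eD_ad_sub (hab : a ≠ b) (hY : ¬ Y.Adj a b) (j : Fin n) :
    eD l σ (ad Y a b) (d - uv a - uv b) j
      = eD l σ Y d j - (1 - l) * ((if j = a then 1 else 0) + (if j = b then 1 else 0)) * σ ^ 2 := by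
  unfold eD
  rw [dg_ad hab hY]
  simp only [Pi.sub_apply]
  push_cast
  rw [Good.uv_real, Good.uv_real]
  ring

lemma eD_ad (hab : a ≠ b) (hY : ¬ Y.Adj a b) (j : Fin n) :
    eD l σ (ad Y a b) d j
      = eD l σ Y d j + l * ((if j = a then 1 else 0) + (if j = b then 1 else 0)) * σ ^ 2 := by
  unfold eD
  rw [dg_ad hab hY]
  push_cast
  rw [Good.uv_real, Good.uv_real]
  ring

lemma eX_ad (hab : a ≠ b) (hY : ¬ Y.Adj a b) (j : Fin n) :
    eX σ (ad Y a b) j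
      = eX σ Y j + ((if j = a then 1 else 0) + (if j = b then 1 else 0)) * σ ^ 2 := by
  unfold eX
  rw [dg_ad hab hY]
  push_cast
  rw [Good.uv_real, Good.uv_real]
  ring

/-- Two instances whose local statistics nearly agree. -/
structure Near (l q σ : ℝ) (Y : SimpleGraph (Fin n)) (d : Fin n → ℤ) (Y' : SimpleGraph (Fin n))
    (d' : Fin n → ℤ) (K : ℕ) : Prop where
  eD : ∀ j, Bd q K (σ ^ 2) (eD l σ Y' d' j - eD l σ Y d j)
  eX : ∀ j, Bd q K (σ ^ 2) (eX σ Y' j - eX σ Y j)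
  eS : ∀ j, Bd q (K + 3) (σ ^ 3) (eS l σ Y' d' j - eS l σ Y d j)

lemma Near.mono {Y' : SimpleGraph (Fin n)} {d' : Fin n → ℤ} {K L : ℕ} (hp : Par n l q σ)
    (h : Near l q σ Y d Y' d' K) (hKL : K ≤ L) : Near l q σ Y d Y' d' L where
  eD j := (h.eD j).mono_left hp.two_le hKL
  eX j := (h.eX j).mono_left hp.two_le hKL
  eS j := (h.eS j).mono_left hp.two_le (by omega)

lemma Near.trans {Y' Y'' : SimpleGraph (Fin n)} {d' d'' : Fin n → ℤ} {K : ℕ} (hp : Par n l q σ)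
    (h : Near l q σ Y d Y' d' K) (h' : Near l q σ Y' d' Y'' d'' K) :
    Near l q σ Y d Y'' d'' (K + 1) where
  eD j := ((h'.eD j).add hp.two_le (h.eD j)).cast hp.two_le (by ring) (by simp) rfl
  eX j := ((h'.eX j).add hp.two_le (h.eX j)).cast hp.two_le (by ring) (by simp) rfl
  eS j := ((h'.eS j).add hp.two_le (h.eS j)).cast hp.two_le (by ring) (by simp) rfl

lemma near_of_ad_shift (hp : Par n l q σ) (hab : a ≠ b) (hY : ¬ Y.Adj a b) {d' : Fin n → ℤ} {c : ℝ}
    (hc : |c| ≤ 1) (hg : Good l q σ r (ad Y a b) d') (hr : r ≤ σ⁻¹)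
    (hD : ∀ j, eD l σ (ad Y a b) d' j
      = eD l σ Y d j + c * ((if j = a then 1 else 0) + (if j = b then 1 else 0)) * σ ^ 2) :
    Near l q σ Y d (ad Y a b) d' 1 := by
  have hq := hp.two_le
  have hσ := hp.σ_pos
  have hind : ∀ j : Fin n,
      |(if j = a then (1 : ℝ) else 0) + (if j = b then 1 else 0)| ≤ 1 := by
    intro j
    split_ifs with e1 e2
    · exact absurd (e1.symm.trans e2) hab
    all_goals norm_num
  have h1 : ∀ j, Bd q 0 (σ ^ 2) (eD l σ (ad Y a b) d' j - eD l σ Y d j) := by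
    intro j
    rw [hD, add_sub_cancel_left]
    refine Bd.mul_const ?_ (hp.bd_σ 2)
    rw [abs_mul]
    exact mul_le_one₀ hc (abs_nonneg _) (hind j)
  refine ⟨fun j => (h1 j).mono_left hq (by norm_num), fun j => ?_, fun j => ?_⟩
  · rw [eX_ad hab hY, add_sub_cancel_left]
    exact (Bd.mul_const (hind j) (hp.bd_σ 2)).mono_left hq (by norm_num)
  · have e1 : (∑ v, if (ad Y a b).Adj j v then eD l σ (ad Y a b) d' v else 0)
        = (∑ v, if Y.Adj j v then eD l σ Y d v else 0)
          + c * ((if Y.Adj j a then 1 else 0) + (if Y.Adj j b then 1 else 0)) * σ ^ 2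
          + (if j = a then eD l σ (ad Y a b) d' b else 0)
          + (if j = b then eD l σ (ad Y a b) d' a else 0) := by
      have h2 : ∀ v, (if (ad Y a b).Adj j v then eD l σ (ad Y a b) d' v else 0)
          = (if Y.Adj j v then eD l σ Y d v else 0)
            + ((if v = a then (c * (if Y.Adj j a then 1 else 0) * σ ^ 2) else 0)
            + (if v = b then (c * (if Y.Adj j b then 1 else 0) * σ ^ 2) else 0))
            + (if v = b then (if j = a then eD l σ (ad Y a b) d' b else 0) else 0)
            + (if v = a then (if j = b then eD l σ (ad Y a b) d' a else 0) else 0) := by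
        intro v
        have hY' : ¬ Y.Adj b a := fun h => hY h.symm
        by_cases h3 : v = a
        · subst h3
          by_cases h4 : j = b
          · subst h4
            have : (ad Y v j).Adj j v := (ad_adj Y hab _ _).2 (by simp)
            simp [this, hY', hab]
          · have : (ad Y v b).Adj j v ↔ Y.Adj j v := by
              rw [ad_adj Y hab]; simp [h4, hab]
            by_cases h5 : Y.Adj j v
            · rw [if_pos (this.2 h5), hD]; simp [h5, h4, hab]; try ring
            · rw [if_neg (fun h => h5 (this.1 h))]; simp [h5, h4, hab]
        · by_cases h4 : v = b
          · subst h4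
            by_cases h4 : j = a
            · subst h4
              have : (ad Y j v).Adj j v := (ad_adj Y hab _ _).2 (by simp)
              simp [this, hY, h3]
            · have : (ad Y a v).Adj j v ↔ Y.Adj j v := by
                rw [ad_adj Y hab]; simp [h4, h3]
              by_cases h5 : Y.Adj j v
              · rw [if_pos (this.2 h5), hD]; simp [h5, h4, h3]; try ring
              · rw [if_neg (fun h => h5 (this.1 h))]; simp [h5, h4, h3]
          · have : (ad Y a b).Adj j v ↔ Y.Adj j v := by
              rw [ad_adj Y hab]; simp [h4, h3]
            by_cases h5 : Y.Adj j v
            · rw [if_pos (this.2 h5), hD]; simp [h5, h4, h3]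
            · rw [if_neg (fun h => h5 (this.1 h))]; simp [h5, h4, h3]
      simp only [h2, Finset.sum_add_distrib, Finset.sum_ite_eq', Finset.mem_univ, if_true]
      ring
    have h3 : Bd q 2 (σ ^ 1) (c * ((if Y.Adj j a then 1 else 0) + (if Y.Adj j b then 1 else 0))
        * σ ^ 2) := by
      have h4 : Bd q 1 (σ ^ 0) ((if Y.Adj j a then (1 : ℝ) else 0)
          + (if Y.Adj j b then 1 else 0)) := by
        unfold Bd
        have := hp.q_ge
        rw [pow_zero, pow_one, mul_one, abs_le]
        split_ifs <;> constructor <;> linarith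
      have h5 := (Bd.mul_const hc h4).pmul (hp.bd_σ 2)
      exact (hp.bd_pow h5 (by norm_num : 1 ≤ 0 + 2)).mono_left hq (by norm_num)
    have h0 : Bd q 2 (σ ^ 1) (0 : ℝ) := by
      unfold Bd; rw [abs_zero]; have := hp.q_pos; positivity
    have h4 : Bd q 2 (σ ^ 1) (if j = a then eD l σ (ad Y a b) d' b else 0) := by
      split_ifs
      exacts [hg.bd_eD hp hr b, h0]
    have h4' : Bd q 2 (σ ^ 1) (if j = b then eD l σ (ad Y a b) d' a else 0) := by
      split_ifs
      exacts [hg.bd_eD hp hr a, h0]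
    have h5 := (((h3.add hq h4).add hq h4')).pmul (hp.bd_σ 2)
    refine h5.cast hq ?_ (by norm_num) (by ring)
    have e2 := congrArg (· * σ ^ 2) e1
    have e3 : eS l σ (ad Y a b) d' j
        = (∑ v, if (ad Y a b).Adj j v then eD l σ (ad Y a b) d' v else 0) * σ ^ 2 := by
      unfold eS; congr!
    rw [e3, eS]
    linear_combination e2

lemma near_ad_sub (hp : Par n l q σ) (h : Good l q σ r Y d) (hr : r + 2 ≤ σ⁻¹) (hab : a ≠ b)
    (hY : ¬ Y.Adj a b) : Near l q σ Y d (ad Y a b) (d - uv a - uv b) 1 := by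
  refine near_of_ad_shift hp hab hY (c := -(1 - l)) ?_ (h.ad_sub hab hY) hr fun j => ?_
  · rw [abs_neg, abs_of_pos (by linarith [hp.l_lt])]; linarith [hp.l_pos]
  · rw [eD_ad_sub hab hY]; ring

lemma near_ad (hp : Par n l q σ) (h : Good l q σ r Y d) (hr : r + 2 ≤ σ⁻¹) (hab : a ≠ b)
    (hY : ¬ Y.Adj a b) : Near l q σ Y d (ad Y a b) d 1 := by
  refine near_of_ad_shift hp hab hY (c := l) ?_ (h.ad_forb hab hY) hr fun j => eD_ad hab hY j
  rw [abs_of_pos hp.l_pos]; exact hp.l_lt.le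

/-- The tail of the shift estimate at a pair of vertices. -/
abbrev tailAt (l σ : ℝ) (Y : SimpleGraph (Fin n)) (d : Fin n → ℤ) (a b : Fin n) : ℝ :=
  tail l (eD l σ Y d a) (eD l σ Y d b) (eX σ Y a) (eX σ Y b) (eS l σ Y d a) (eS l σ Y d b)

lemma Good.bd_tail (hp : Par n l q σ) (h : Good l q σ r Y d) (hr : r ≤ σ⁻¹) (a b : Fin n) :
    Bd q 15 (σ ^ 2) (tailAt l σ Y d a b) := by
  have hq := hp.two_le
  have hDa := h.bd_eD hp hr a
  have hDb := h.bd_eD hp hr b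
  have hxa := h.bd_eX hp hr a
  have hxb := h.bd_eX hp hr b
  have hSa := h.bd_eS hp hr a
  have hSb := h.bd_eS hp hr b
  have h1 := (hDa.sub hq hDb).pmul ((hDa.pmul hp.inv_l').sub hq (hDb.pmul hp.inv_l))
  have h2 := (hxa.pmul hDa).sub hq (hxb.pmul hDb)
  have h3 := hSa.sub hq hSb
  exact (hp.inv_o.pmul ((h1.add hq h2).add hq h3)).cast hq rfl (by norm_num) (by norm_num)

lemma Near.tail {Y' : SimpleGraph (Fin n)} {d' : Fin n → ℤ} {r' : ℝ} (hp : Par n l q σ)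
    (h : Good l q σ r Y d) (h' : Good l q σ r' Y' d') (hr : r ≤ σ⁻¹) (hr' : r' ≤ σ⁻¹)
    (hn : Near l q σ Y d Y' d' 2) (a b : Fin n) :
    Bd q 17 (σ ^ 3) (tailAt l σ Y' d' a b - tailAt l σ Y d a b) := by
  have hq := hp.two_le
  have hDa := h.bd_eD hp hr a
  have hDb := h.bd_eD hp hr b
  have hxa := h.bd_eX hp hr a
  have hxb := h.bd_eX hp hr b
  have hDa' := h'.bd_eD hp hr' a
  have hDb' := h'.bd_eD hp hr' b
  have a1 := hn.eD a
  have a2 := hn.eD b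
  have a3 := hn.eX a
  have a4 := hn.eX b
  have a5 := hn.eS a
  have a6 := hn.eS b
  have b1 := ((a1.sub hq a2).pmul ((hDa'.pmul hp.inv_l').sub hq (hDb'.pmul hp.inv_l))).add hq
    ((hDa.sub hq hDb).pmul ((a1.pmul hp.inv_l').sub hq (a2.pmul hp.inv_l)))
  have b2 := (a3.pmul hDa').add hq (hxa.pmul a1)
  have b3 := (a4.pmul hDb').add hq (hxb.pmul a2)
  have b4 := a5.sub hq a6
  refine (hp.inv_o.pmul ((b1.add hq (b2.sub hq b3)).add hq b4)).cast hq ?_ (by norm_num) (by norm_num)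
  unfold tailAt _root_.tail; ring

end Profile

section EdgeProb

variable {n : ℕ} {l q σ r m : ℝ} {Y : SimpleGraph (Fin n)} {d : Fin n → ℤ} {a b v : Fin n}
  {hat : SimpleGraph (Fin n) → (Fin n → ℤ) → Fin n → Fin n → ℝ}

/-- The number of graphs counted by `cnt Y d` that contain the edge `av`. -/
def ec (Y : SimpleGraph (Fin n)) (d : Fin n → ℤ) (a v : Fin n) : ℝ :=
  cnt (ad Y a v) (d - uv a - uv v)

lemma ec_comm (Y : SimpleGraph (Fin n)) (d : Fin n → ℤ) (a v : Fin n) :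
    ec Y d a v = ec Y d v a := by
  unfold ec; rw [ad_comm, sub_right_comm]

lemma ec_nonneg (Y : SimpleGraph (Fin n)) (d : Fin n → ℤ) (a v : Fin n) : 0 ≤ ec Y d a v :=
  cnt_nonneg _ _

lemma ec_le (hav : a ≠ v) (hY : ¬ Y.Adj a v) : ec Y d a v ≤ cnt Y d := cnt_ad_le hav hY

lemma sum_ec (Y : SimpleGraph (Fin n)) (d : Fin n → ℤ) (v : Fin n) :
    ∑ a, (if a ≠ v ∧ ¬ Y.Adj v a then ec Y d a v else 0) = d v * cnt Y d := by
  rw [← sum_cnt_edge]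
  refine Finset.sum_congr rfl fun a _ => ?_
  rw [ec_comm]; rfl

lemma sum_non_adj_fun (Y : SimpleGraph (Fin n)) (v : Fin n) (f : Fin n → ℝ) :
    ∑ a, (if a ≠ v ∧ ¬ Y.Adj v a then f a else 0)
      = ∑ a, f a - f v - ∑ a, if Y.Adj v a then f a else 0 := by
  have h1 : ∀ a, (if a ≠ v ∧ ¬ Y.Adj v a then f a else 0)
      = f a - (if a = v then f v else 0) - if Y.Adj v a then f a else 0 := by
    intro a
    by_cases h : a = v
    · subst h; simp
    · by_cases h' : Y.Adj v a <;> simp [h, h']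
  simp only [h1, Finset.sum_sub_distrib]
  simp

/-- Edge probabilities at a vertex are determined by their differences. -/
lemma edge_average (hp : Par n l q σ) (h : Good l q σ r Y d) (hr : r ≤ σ⁻¹) {Q : Fin n → ℝ}
    {μ : ℝ} (hbv : b ≠ v) (hb : ¬ Y.Adj v b)
    (hdiff : ∀ a, a ≠ b → a ≠ v → ¬ Y.Adj v a →
      |ec Y d b v - ec Y d a v - (Q b - Q a) * cnt Y d| ≤ μ * cnt Y d)
    (hsum : |(∑ a, (if a ≠ v ∧ ¬ Y.Adj v a then Q a else 0) - d v) * σ ^ 2| ≤ μ) :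
    |ec Y d b v - Q b * cnt Y d| ≤ q ^ 2 * μ * cnt Y d := by
  have hq := hp.q_ge
  have hn := hp.n_pos
  have hσ := hp.σ_pos
  have hN := cnt_nonneg Y d
  have hμ : 0 ≤ μ := (abs_nonneg _).trans hsum
  have h1 := sum_non_adj Y v
  set N := cnt Y d with hNd
  set s : ℝ := n - 1 - dg Y v with hs
  have hdiff' : ∀ a, |if a ≠ v ∧ ¬ Y.Adj v a then ec Y d b v - ec Y d a v - (Q b - Q a) * N
      else 0| ≤ μ * N := by
    intro a
    split_ifs with h2
    · by_cases h3 : a = b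
      · subst h3; simp; positivity
      · exact hdiff a h3 h2.1 h2.2
    · rw [abs_zero]; positivity
  have h2 : |∑ a, if a ≠ v ∧ ¬ Y.Adj v a then ec Y d b v - ec Y d a v - (Q b - Q a) * N
      else 0| ≤ n * (μ * N) := by
    refine (Finset.abs_sum_le_sum_abs _ _).trans
      ((Finset.sum_le_card_nsmul univ _ _ fun a _ => hdiff' a).trans ?_)
    simp
  have h3 : s * (ec Y d b v - Q b * N)
      = (∑ a, if a ≠ v ∧ ¬ Y.Adj v a then ec Y d b v - ec Y d a v - (Q b - Q a) * N else 0)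
        - (∑ a, (if a ≠ v ∧ ¬ Y.Adj v a then Q a else 0) - d v) * N := by
    have h4 := sum_ec Y d v
    have h5 : ∀ a, (if a ≠ v ∧ ¬ Y.Adj v a then ec Y d b v - ec Y d a v - (Q b - Q a) * N else 0)
        = (if a ≠ v ∧ ¬ Y.Adj v a then 1 else 0) * (ec Y d b v - Q b * N)
          - (if a ≠ v ∧ ¬ Y.Adj v a then ec Y d a v else 0)
          + (if a ≠ v ∧ ¬ Y.Adj v a then Q a else 0) * N := by
      intro a; split_ifs <;> ring
    simp only [h5, Finset.sum_add_distrib, Finset.sum_sub_distrib, ← Finset.sum_mul, h1, h4]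
    ring
  have h6 : |∑ a, (if a ≠ v ∧ ¬ Y.Adj v a then Q a else 0) - d v| ≤ n * μ := by
    rw [abs_mul, abs_of_pos (pow_pos hσ 2)] at hsum
    have h7 := mul_le_mul_of_nonneg_left hsum hn.le
    have h8 := hp.n_eq
    calc _ = |∑ a, (if a ≠ v ∧ ¬ Y.Adj v a then Q a else 0) - d v| * (n * σ ^ 2) := by
          rw [h8, mul_one]
      _ = n * (|∑ a, (if a ≠ v ∧ ¬ Y.Adj v a then Q a else 0) - d v| * σ ^ 2) := by ring
      _ ≤ _ := h7
  have h7 : (n : ℝ) ≤ 2 * q * s := by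
    have h8 := h.codeg_ge hp hr v
    have h9 := h.deg_ge hp hr v
    have h10 : 0 ≤ (d v : ℝ) := by
      by_contra hc
      nlinarith
    nlinarith
  have hs0 : 0 < s := by
    by_contra hc
    nlinarith
  have h8 : s * |ec Y d b v - Q b * N| ≤ s * (q ^ 2 * μ * N) := by
    rw [← abs_of_pos hs0, ← abs_mul, h3, abs_of_pos hs0]
    have h9 : |(∑ a, (if a ≠ v ∧ ¬ Y.Adj v a then Q a else 0) - d v) * N| ≤ n * μ * N := by
      rw [abs_mul, abs_of_nonneg hN]; gcongr
    calc _ ≤ n * (μ * N) + n * μ * N := (abs_sub _ _).trans (add_le_add h2 h9)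
      _ = n * (2 * (μ * N)) := by ring
      _ ≤ (2 * q * s) * (2 * (μ * N)) := by gcongr
      _ = s * (4 * q * (μ * N)) := by ring
      _ ≤ s * (q ^ 2 * (μ * N)) := by gcongr; nlinarith
      _ = _ := by ring
  exact le_of_mul_le_mul_left h8 hs0

/-- The probability of an edge `av` is `Q a v` up to an error `m`. -/
def EdgeEst {n : ℕ} (l q σ : ℝ)
    (Q : SimpleGraph (Fin n) → (Fin n → ℤ) → Fin n → Fin n → ℝ) (r m : ℝ) : Prop :=
  ∀ Y d, Good l q σ r Y d → ∀ a v, a ≠ v → ¬ Y.Adj a v →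
    |ec Y d a v - Q Y d a v * cnt Y d| ≤ m * cnt Y d

lemma EdgeEst.mono {Q : SimpleGraph (Fin n) → (Fin n → ℤ) → Fin n → Fin n → ℝ} {r' m' : ℝ}
    (h : EdgeEst l q σ Q r m) (hr : r' ≤ r) (hm : m ≤ m') : EdgeEst l q σ Q r' m' :=
  fun Y d hg a v hav hY =>
    (h Y d (hg.mono hr) a v hav hY).trans (mul_le_mul_of_nonneg_right hm (cnt_nonneg _ _))

/-- The number of graphs containing `av` but not `bv`. -/
def wc (Y : SimpleGraph (Fin n)) (d : Fin n → ℤ) (a b v : Fin n) : ℝ :=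
  cnt (ad (ad Y a v) b v) (d - uv a - uv v)

lemma not_adj_ad (hab : a ≠ b) (hav : a ≠ v) (hbv : b ≠ v) (hb : ¬ Y.Adj b v) :
    ¬ (ad Y a v).Adj b v := by
  rw [ad_adj Y hav]; simp [hb, hab.symm, hbv]

lemma wc_nonneg (Y : SimpleGraph (Fin n)) (d : Fin n → ℤ) (a b v : Fin n) : 0 ≤ wc Y d a b v :=
  cnt_nonneg _ _

lemma wc_eq (hab : a ≠ b) (hav : a ≠ v) (hbv : b ≠ v) (hb : ¬ Y.Adj b v) :
    wc Y d a b v = ec Y d a v - ec (ad Y a v) (d - uv a - uv v) b v := by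
  have := cnt_split hbv (not_adj_ad hab hav hbv hb) (d - uv a - uv v)
  unfold wc ec; linarith

lemma wc_le (hab : a ≠ b) (hav : a ≠ v) (hbv : b ≠ v) (ha : ¬ Y.Adj a v) (hb : ¬ Y.Adj b v) :
    wc Y d a b v ≤ cnt Y d := by
  rw [wc_eq hab hav hbv hb]
  linarith [ec_le (d := d) hav ha, ec_nonneg (ad Y a v) (d - uv a - uv v) b v]

lemma Good.wc (h : Good l q σ r Y d) (hab : a ≠ b) (hav : a ≠ v) (hbv : b ≠ v)
    (ha : ¬ Y.Adj a v) (hb : ¬ Y.Adj b v) :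
    Good l q σ (r + 4) (ad (ad Y a v) b v) (d - uv a - uv v) :=
  ((h.ad_sub hav ha).ad_forb hbv (not_adj_ad hab hav hbv hb)).mono (by linarith)

lemma edge_diff (hC : ShiftEst l q σ hat (r + 4) m) (h : Good l q σ r Y d) (hm : 0 ≤ m)
    (hab : a ≠ b) (hav : a ≠ v) (hbv : b ≠ v) (ha : ¬ Y.Adj a v) (hb : ¬ Y.Adj b v) :
    |ec Y d b v - ec Y d a v
        - hat (ad (ad Y a v) b v) (d - uv a - uv v) b a * wc Y d a b v| ≤ m * cnt Y d := by
  have h1 := cnt_edge_diff Y d hab hav hbv ha hb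
  have h2 := hC _ _ (h.wc hab hav hbv ha hb) b a hab.symm
  have h3 := wc_le (d := d) hab hav hbv ha hb
  unfold ec
  rw [h1]
  refine le_trans (le_of_eq ?_) (h2.trans (mul_le_mul_of_nonneg_left h3 hm))
  unfold wc
  congr 1; ring

lemma deg_scale (hp : Par n l q σ) (Y : SimpleGraph (Fin n)) (d : Fin n → ℤ) (v : Fin n) :
    (d v : ℝ) * σ ^ 2 = l * (1 - σ ^ 2 - eX σ Y v) + eD l σ Y d v := by
  unfold eX eD; linear_combination l * hp.n_eq

lemma edge_est_crude (hp : Par n l q σ) (hr : r + 4 ≤ σ⁻¹ * (3 / 4)) :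
    EdgeEst l q σ (fun _ _ _ _ => l) (n := n) r (q ^ 18 * σ) := by
  intro Y d h b v hbv hb
  have hσ := hp.σ_pos
  have hi := hp.inv_ge
  have hq := hp.q_pos
  have hrr : r ≤ σ⁻¹ := by
    have : 0 < σ⁻¹ := inv_pos.2 hσ
    linarith
  have hb' : ¬ Y.Adj v b := fun h => hb h.symm
  have h1 := edge_average hp h hrr (Q := fun _ => l) (μ := q ^ 16 * σ) hbv hb' ?_ ?_
  · refine h1.trans (le_of_eq ?_); ring
  · intro a hab hav ha
    have h2 := edge_diff ((shift_est_crude hp).mono hr le_rfl) h (by positivity) hab hav hbv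
      (fun h => ha h.symm) hb
    simpa using h2
  · have h3 : (∑ a, (if a ≠ v ∧ ¬ Y.Adj v a then l else 0) - d v) * σ ^ 2 = - eD l σ Y d v := by
      have h4 := sum_non_adj Y v
      have h5 : ∑ a, (if a ≠ v ∧ ¬ Y.Adj v a then l else 0) = l * (n - 1 - dg Y v) := by
        rw [← h4, Finset.mul_sum]
        refine Finset.sum_congr rfl fun a _ => ?_
        split_ifs <;> simp
      rw [h5]; unfold eD; ring
    rw [h3, abs_neg]
    have := (h.bd_eD hp hrr v).mono_left hp.two_le (by norm_num : 2 ≤ 16)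
    unfold Bd at this
    simpa using this

/-- Passing from counts to proportions. -/
lemma rel_iff {N x y m : ℝ} (hN : 0 < N) : |x - y * N| ≤ m * N ↔ |x / N - y| ≤ m := by
  have : x - y * N = (x / N - y) * N := by field_simp
  rw [this, abs_mul, abs_of_pos hN, mul_le_mul_iff_left₀ hN]

/-- Estimating the proportion of graphs containing one edge but not another one. -/
lemma wc_est {Q : SimpleGraph (Fin n) → (Fin n → ℤ) → Fin n → Fin n → ℝ}
    (hE : EdgeEst l q σ Q (r + 2) m) (h : Good l q σ r Y d) (hm : 0 ≤ m) (hN : 0 < cnt Y d)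
    (hab : a ≠ b) (hav : a ≠ v) (hbv : b ≠ v) (ha : ¬ Y.Adj a v) (hb : ¬ Y.Adj b v) :
    ∃ p w : ℝ, |p - Q Y d a v| ≤ m ∧ |w| ≤ m ∧ |p| ≤ 1 ∧
      wc Y d a b v / cnt Y d = p * (1 - Q (ad Y a v) (d - uv a - uv v) b v) + w := by
  have h1 := (hE.mono (by linarith : r ≤ r + 2) le_rfl) Y d h a v hav ha
  have h2 := hE _ _ (h.ad_sub hav ha) b v hbv (not_adj_ad hab hav hbv hb)
  have h3 := ec_le (d := d) hav ha
  have h4 := ec_nonneg Y d a v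
  refine ⟨ec Y d a v / cnt Y d, wc Y d a b v / cnt Y d
    - ec Y d a v / cnt Y d * (1 - Q (ad Y a v) (d - uv a - uv v) b v), (rel_iff hN).1 h1, ?_, ?_, ?_⟩
  rotate_left
  · rw [abs_of_nonneg (by positivity), div_le_one hN]; exact h3
  · exact (add_sub_cancel _ _).symm
  · rw [wc_eq hab hav hbv hb]
    have e1 : (ec Y d a v - ec (ad Y a v) (d - uv a - uv v) b v) / cnt Y d
        - ec Y d a v / cnt Y d * (1 - Q (ad Y a v) (d - uv a - uv v) b v)
        = -((ec (ad Y a v) (d - uv a - uv v) b v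
          - Q (ad Y a v) (d - uv a - uv v) b v * ec Y d a v) / cnt Y d) := by
      field_simp; ring
    rw [e1, abs_neg, abs_div, abs_of_pos hN, div_le_iff₀ hN]
    refine h2.trans ?_
    change m * ec Y d a v ≤ _
    gcongr

/-- First order estimate of the edge probability. -/
def edgeHat (l σ : ℝ) (Y : SimpleGraph (Fin n)) (d : Fin n → ℤ) (a v : Fin n) : ℝ :=
  l + eD l σ Y d a + eD l σ Y d v

lemma wc_crude (hp : Par n l q σ) (hr : r + 6 ≤ σ⁻¹ * (3 / 4)) (h : Good l q σ r Y d)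
    (hN : 0 < cnt Y d)
    (hab : a ≠ b) (hav : a ≠ v) (hbv : b ≠ v) (ha : ¬ Y.Adj a v) (hb : ¬ Y.Adj b v) :
    Bd q 20 (σ ^ 1) (wc Y d a b v / cnt Y d - l * (1 - l)) := by
  have hσ := hp.σ_pos
  have hq := hp.q_pos
  obtain ⟨p, w, h1, h2, -, h4⟩ := wc_est (edge_est_crude hp (by linarith)) h (by positivity) hN
    hab hav hbv ha hb
  have b1 : Bd q 18 (σ ^ 1) (p - l) := by unfold Bd; simpa using h1
  have b2 : Bd q 18 (σ ^ 1) w := by unfold Bd; simpa using h2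
  exact ((b1.pmul hp.bd_l').add hp.two_le b2).cast hp.two_le (by rw [h4]; ring) (by norm_num)
    (by norm_num)

lemma eD_wc (h1 : a ≠ b) (hav : a ≠ v) (hbv : b ≠ v) (ha : ¬ Y.Adj a v) (hb : ¬ Y.Adj b v)
    (j : Fin n) :
    eD l σ (ad (ad Y a v) b v) (d - uv a - uv v) j
      = eD l σ Y d j - (1 - l) * ((if j = a then 1 else 0) + (if j = v then 1 else 0)) * σ ^ 2
        + l * ((if j = b then 1 else 0) + (if j = v then 1 else 0)) * σ ^ 2 := by
  rw [eD_ad hbv (not_adj_ad h1 hav hbv hb), eD_ad_sub hav ha]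

lemma shiftHat_wc (h1 : a ≠ b) (hav : a ≠ v) (hbv : b ≠ v) (ha : ¬ Y.Adj a v)
    (hb : ¬ Y.Adj b v) :
    shiftHat l σ (ad (ad Y a v) b v) (d - uv a - uv v) b a
      = (l * (1 - l))⁻¹ * (eD l σ Y d b - eD l σ Y d a)
        + tailAt l σ (ad (ad Y a v) b v) (d - uv a - uv v) b a := by
  unfold shiftHat
  congr 1
  rw [eD_wc h1 hav hbv ha hb, eD_wc h1 hav hbv ha hb]
  simp only [h1, h1.symm, hav, hbv, if_true, if_false]
  ring

lemma edge_est (hp : Par n l q σ) (hr : r + 6 ≤ σ⁻¹ * (3 / 4)) (hm : 0 ≤ m)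
    (hC : ShiftEst l q σ (shiftHat l σ) (n := n) (r + 4) m) :
    EdgeEst l q σ (edgeHat l σ) (n := n) r (q ^ 2 * (m + q ^ 30 * σ ^ 2)) := by
  intro Y d h b v hbv hb
  have hσ := hp.σ_pos
  have hi := hp.inv_ge
  have hq := hp.q_pos
  have hq2 := hp.two_le
  have hrr : r + 4 ≤ σ⁻¹ := by
    have : 0 < σ⁻¹ := inv_pos.2 hσ
    linarith
  have hr0 : r ≤ σ⁻¹ := by linarith
  have hb' : ¬ Y.Adj v b := fun h => hb h.symm
  rcases (cnt_nonneg Y d).eq_or_lt with hN | hN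
  · have h1 := ec_le (d := d) hbv hb
    have h2 := ec_nonneg Y d b v
    have h3 : ec Y d b v = 0 := by linarith
    simp [← hN, h3]
  refine edge_average hp h hr0 (Q := fun a => edgeHat l σ Y d a v) hbv hb' ?_ ?_
  · intro a hab hav ha
    have ha' : ¬ Y.Adj a v := fun h => ha h.symm
    have h2 := edge_diff hC h hm hab hav hbv ha' hb
    rw [shiftHat_wc hab hav hbv ha' hb] at h2
    have h3 := wc_crude hp hr h hN hab hav hbv ha' hb
    set w := wc Y d a b v with hw
    have h4 := (h.wc hab hav hbv ha' hb).bd_tail hp hrr b a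
    have hDa := h.bd_eD hp hr0 a
    have hDb := h.bd_eD hp hr0 b
    have hw1 : Bd q 0 (σ ^ 0) (w / cnt Y d) := by
      refine Bd.of_abs_le ?_
      rw [abs_of_nonneg (div_nonneg (wc_nonneg _ _ _ _ _) hN.le), div_le_one hN]
      exact wc_le hab hav hbv ha' hb
    have ho : (l * (1 - l))⁻¹ * (l * (1 - l)) = 1 :=
      inv_mul_cancel₀ (mul_ne_zero hp.l_pos.ne' (by linarith [hp.l_lt]))
    have h5 := (((hp.inv_o.pmul (hDb.sub hq2 hDa)).pmul h3).add hq2 (h4.pmul hw1))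
    have h6 : Bd q 30 (σ ^ 2) (((l * (1 - l))⁻¹ * (eD l σ Y d b - eD l σ Y d a)
        + tailAt l σ (ad (ad Y a v) b v) (d - uv a - uv v) b a) * (w / cnt Y d)
        - (eD l σ Y d b - eD l σ Y d a)) := by
      refine h5.cast hq2 ?_ (by norm_num) (by norm_num)
      linear_combination (eD l σ Y d b - eD l σ Y d a) * ho
    unfold Bd at h6
    rw [rel_iff hN]
    have h7 : |(ec Y d b v - ec Y d a v - ((l * (1 - l))⁻¹ * (eD l σ Y d b - eD l σ Y d a)
        + tailAt l σ (ad (ad Y a v) b v) (d - uv a - uv v) b a) * w) / cnt Y d - 0| ≤ m :=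
      (rel_iff hN).1 (by rwa [zero_mul, sub_zero])
    have e1 : (ec Y d b v - ec Y d a v) / cnt Y d - (edgeHat l σ Y d b v - edgeHat l σ Y d a v)
        = ((ec Y d b v - ec Y d a v - ((l * (1 - l))⁻¹ * (eD l σ Y d b - eD l σ Y d a)
        + tailAt l σ (ad (ad Y a v) b v) (d - uv a - uv v) b a) * w) / cnt Y d - 0)
        + (((l * (1 - l))⁻¹ * (eD l σ Y d b - eD l σ Y d a)
        + tailAt l σ (ad (ad Y a v) b v) (d - uv a - uv v) b a) * (w / cnt Y d)
        - (eD l σ Y d b - eD l σ Y d a)) := by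
      unfold edgeHat; ring
    rw [e1]
    exact (abs_add_le _ _).trans (add_le_add h7 h6)
  · rw [sum_non_adj_fun]
    have e1 : (∑ a, edgeHat l σ Y d a v - edgeHat l σ Y d v v
        - (∑ a, if Y.Adj v a then edgeHat l σ Y d a v else 0) - d v) * σ ^ 2
        = (∑ a, eD l σ Y d a) * σ ^ 2 - 2 * (eD l σ Y d v * σ ^ 2) - eS l σ Y d v
          - eX σ Y v * eD l σ Y d v := by
      have e2 := deg_scale hp Y d v
      have e3 : (∑ a, if Y.Adj v a then edgeHat l σ Y d a v else 0)
          = (l + eD l σ Y d v) * dg Y v + ∑ a, if Y.Adj v a then eD l σ Y d a else 0 := by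
        rw [dg_real, Finset.mul_sum, ← Finset.sum_add_distrib]
        refine Finset.sum_congr rfl fun a _ => ?_
        unfold edgeHat
        split_ifs <;> ring
      have e4 : ∑ a, edgeHat l σ Y d a v = n * (l + eD l σ Y d v) + ∑ a, eD l σ Y d a := by
        unfold edgeHat
        simp only [Finset.sum_add_distrib, Finset.sum_const, Finset.card_univ, Fintype.card_fin,
          nsmul_eq_mul]
        ring
      rw [e3, e4]
      unfold edgeHat eS
      unfold eX at *
      linear_combination -e2 + (l + eD l σ Y d v) * hp.n_eq
    have b1 := (h.bd_sum_eD hp hr0).pmul (hp.bd_σ 2)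
    have b2 := (h.bd_eD hp hr0 v).pmul (hp.bd_σ 2)
    have b2' := hp.bd_pow b2 (by norm_num : 2 ≤ 1 + 2)
    have b3 := h.bd_eS hp hr0 v
    have b4 := (h.bd_eX hp hr0 v).pmul (h.bd_eD hp hr0 v)
    have b5 := (((b1.sub hq2 b2').sub hq2 b2').sub hq2 b3).sub hq2 b4
    have b6 : Bd q 30 (σ ^ 2) _ := b5.cast hq2 (y := (∑ a, eD l σ Y d a) * σ ^ 2
      - 2 * (eD l σ Y d v * σ ^ 2) - eS l σ Y d v - eX σ Y v * eD l σ Y d v) (by ring)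
      (by norm_num) (by norm_num)
    rw [e1]
    unfold Bd at b6
    linarith

end EdgeProb

section SecondOrder

variable {n : ℕ} {l q σ r m μ : ℝ} {Y : SimpleGraph (Fin n)} {d : Fin n → ℤ} {a b v : Fin n}

lemma shiftHat_eq (l σ : ℝ) (Y : SimpleGraph (Fin n)) (d : Fin n → ℤ) (a b : Fin n) :
    shiftHat l σ Y d a b
      = (l * (1 - l))⁻¹ * (eD l σ Y d a - eD l σ Y d b - σ ^ 2) + tailAt l σ Y d a b := rfl

lemma Good.bd_shiftHat (hp : Par n l q σ) (h : Good l q σ r Y d) (hr : r ≤ σ⁻¹) (a b : Fin n) :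
    Bd q 16 (σ ^ 1) (shiftHat l σ Y d a b) := by
  have hq := hp.two_le
  have h1 := hp.inv_o.pmul (((h.bd_eD hp hr a).sub hq (h.bd_eD hp hr b)).sub hq
    (hp.bd_pow (hp.bd_σ 2) (by norm_num : 1 ≤ 2)))
  exact (h1.add hq (hp.bd_pow (h.bd_tail hp hr a b) (by norm_num : 0 + 1 ≤ 2))).cast hq rfl
    (by norm_num) (by norm_num)

lemma Good.bd_shiftHat_sub (hp : Par n l q σ) (h : Good l q σ r Y d) (hr : r ≤ σ⁻¹)
    (a b : Fin n) : Bd q 16 (σ ^ 2)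
      (shiftHat l σ Y d a b - (l * (1 - l))⁻¹ * (eD l σ Y d a - eD l σ Y d b)) := by
  have hq := hp.two_le
  have h1 := hp.inv_o.pmul (hp.bd_σ 2)
  refine ((h.bd_tail hp hr a b).sub hq h1).cast hq ?_ (by norm_num) (by norm_num)
  unfold shiftHat; ring

lemma Good.bd_edgeHat (hp : Par n l q σ) (h : Good l q σ r Y d) (hr : r ≤ σ⁻¹) (a v : Fin n) :
    Bd q 4 (σ ^ 0) (edgeHat l σ Y d a v) := by
  have hq := hp.two_le
  exact ((hp.bd_l.add hq (hp.bd_pow (h.bd_eD hp hr a) (by norm_num : 0 ≤ 1))).add hq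
    (hp.bd_pow (h.bd_eD hp hr v) (by norm_num : 0 ≤ 1))).cast hq rfl (by norm_num) rfl

/-- The predicted value of `recTerm`, relative to the total count. -/
def mainTerm (l σ : ℝ) (Y : SimpleGraph (Fin n)) (d : Fin n → ℤ) (a b v : Fin n) : ℝ :=
  l ^ 2 * shiftHat l σ Y d a b
    + l * (eD l σ Y d a + eD l σ Y d b + 2 * eD l σ Y d v) * shiftHat l σ Y d a b
    + (if Y.Adj a v then l * (1 - l) * shiftHat l σ Y d a b + l + eD l σ Y d b + eD l σ Y d v
        else 0)
    - (if Y.Adj b v then l ^ 2 * shiftHat l σ Y d a b + l + eD l σ Y d a + eD l σ Y d v else 0)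

/-- The count of graphs containing two edges at `v`. -/
lemma two_est {Q : SimpleGraph (Fin n) → (Fin n → ℤ) → Fin n → Fin n → ℝ}
    (hE : EdgeEst l q σ Q (r + 2) m) (h : Good l q σ r Y d) (hm : 0 ≤ m) (hN : 0 < cnt Y d)
    (hab : a ≠ b) (hav : a ≠ v) (hbv : b ≠ v) (ha : ¬ Y.Adj a v) (hb : ¬ Y.Adj b v) :
    ∃ p w : ℝ, |p - Q Y d a v| ≤ m ∧ |w| ≤ m ∧
      cnt (ad (ad Y a v) b v) (d - uv a - uv v - uv b - uv v) / cnt Y d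
        = p * Q (ad Y a v) (d - uv a - uv v) b v + w := by
  have h1 := (hE.mono (by linarith : r ≤ r + 2) le_rfl) Y d h a v hav ha
  have h2 := hE _ _ (h.ad_sub hav ha) b v hbv (not_adj_ad hab hav hbv hb)
  have h3 := ec_le (d := d) hav ha
  refine ⟨ec Y d a v / cnt Y d, ec (ad Y a v) (d - uv a - uv v) b v / cnt Y d
    - ec Y d a v / cnt Y d * Q (ad Y a v) (d - uv a - uv v) b v, (rel_iff hN).1 h1, ?_,
    (add_sub_cancel _ _).symm⟩
  have e1 : ec (ad Y a v) (d - uv a - uv v) b v / cnt Y d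
      - ec Y d a v / cnt Y d * Q (ad Y a v) (d - uv a - uv v) b v
      = (ec (ad Y a v) (d - uv a - uv v) b v
        - Q (ad Y a v) (d - uv a - uv v) b v * ec Y d a v) / cnt Y d := by
    field_simp
  rw [e1, abs_div, abs_of_pos hN, div_le_iff₀ hN]
  refine h2.trans ?_
  change m * ec Y d a v ≤ _
  gcongr

lemma recTerm_free_est (hp : Par n l q σ) (hr : r + 12 ≤ σ⁻¹) (hm : 0 ≤ m)
    (hμ : σ ^ 2 ≤ μ) (hE : EdgeEst l q σ (edgeHat l σ) (n := n) (r + 2) μ)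
    (hC : ShiftEst l q σ (shiftHat l σ) (n := n) (r + 4) m) (h : Good l q σ r Y d)
    (hN : 0 < cnt Y d)
    (hab : a ≠ b) (hav : a ≠ v) (hbv : b ≠ v) (ha : ¬ Y.Adj a v) (hb : ¬ Y.Adj b v) :
    |recTerm Y d a b v - mainTerm l σ Y d a b v * cnt Y d|
      ≤ (1 - 1 / q ^ 6) * m * ec Y d b v + q ^ 30 * (σ * μ) * cnt Y d := by
  have hq := hp.two_le
  have hσ := hp.σ_pos
  have hr0 : r ≤ σ⁻¹ := by linarith
  have hμ0 : 0 ≤ μ := le_trans (by positivity) hμ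
  have h1 := recTerm_free hC h hab hav hbv ha hb
  have h2 := two_edges_le hp h (by linarith) hab hav hbv ha hb
  obtain ⟨p, w, hp1, hw, hx⟩ := two_est hE h hμ0 hN hab hav hbv ha hb
  have hb' := not_adj_ad hab hav hbv hb
  have g1 := h.ad_sub hav ha
  have g2 := g1.ad_sub hbv hb'
  have n1 := near_ad_sub hp h (by linarith) hav ha
  have n2 := n1.trans hp (near_ad_sub hp g1 (by linarith) hbv hb')
  have t1 := n2.tail hp h g2 hr0 (by linarith) a b
  have e1 : shiftHat l σ (ad (ad Y a v) b v) (d - uv a - uv v - uv b - uv v) a b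
      - shiftHat l σ Y d a b
      = tailAt l σ (ad (ad Y a v) b v) (d - uv a - uv v - uv b - uv v) a b
        - tailAt l σ Y d a b := by
    have i1 : eD l σ (ad (ad Y a v) b v) (d - uv a - uv v - uv b - uv v) a
        = eD l σ Y d a - (1 - l) * σ ^ 2 := by
      rw [eD_ad_sub hbv hb', eD_ad_sub hav ha]
      simp only [hab, hav, if_true, if_false]; ring
    have i2 : eD l σ (ad (ad Y a v) b v) (d - uv a - uv v - uv b - uv v) b
        = eD l σ Y d b - (1 - l) * σ ^ 2 := by
      rw [eD_ad_sub hbv hb', eD_ad_sub hav ha]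
      simp only [hab.symm, hbv, if_true, if_false]; ring
    rw [shiftHat_eq, shiftHat_eq, i1, i2]
    ring
  have e2 : edgeHat l σ (ad Y a v) (d - uv a - uv v) b v
      = l + eD l σ Y d b + eD l σ Y d v - (1 - l) * σ ^ 2 := by
    unfold edgeHat
    rw [eD_ad_sub hav ha, eD_ad_sub hav ha]
    simp only [hab.symm, hav.symm, hbv, if_true, if_false]
    ring
  have bE := g1.bd_edgeHat hp (by linarith) b v
  have bE' := h.bd_edgeHat hp (by linarith) a v
  have bDa := h.bd_eD hp hr0 a
  have bDb := h.bd_eD hp hr0 b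
  have bDv := h.bd_eD hp hr0 v
  have bρ := h.bd_shiftHat hp hr0 a b
  set ρ := shiftHat l σ Y d a b
  set ρ' := shiftHat l σ (ad (ad Y a v) b v) (d - uv a - uv v - uv b - uv v) a b
  set c2 := cnt (ad (ad Y a v) b v) (d - uv a - uv v - uv b - uv v)
  rw [← e1] at t1
  have bp : Bd q 0 μ (p - edgeHat l σ Y d a v) := by unfold Bd; simpa using hp1
  have bw : Bd q 0 μ w := by unfold Bd; simpa using hw
  have b1 := (bp.mul bE).add hq (bw.cast hq rfl le_rfl (by ring : μ = μ * σ ^ 0))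
  have b2 := ((bDa.add hq bDv).pmul (bDb.add hq bDv)).sub hq
    ((bE'.pmul (hp.bd_l'.pmul (hp.bd_σ 2))))
  have b3 := b1.add hq (b2.mono hq le_rfl (by simpa using hμ : _ ≤ μ * σ ^ 0))
  have b4 : Bd q 12 μ (c2 / cnt Y d
      - (l ^ 2 + l * (eD l σ Y d a + eD l σ Y d b + 2 * eD l σ Y d v))) := by
    refine b3.cast hq ?_ (by norm_num) (by ring)
    rw [hx, e2]
    unfold edgeHat
    ring
  have bx : Bd q 0 1 (c2 / cnt Y d) := by
    unfold Bd
    have h5 := cnt_ad_le (d := d) hbv hb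
    have h6 := one_sub_nonneg hp 6
    have h7 := cnt_nonneg (ad Y b v) (d - uv b - uv v)
    have h8 : c2 ≤ cnt Y d := by
      refine h2.trans ((mul_le_of_le_one_left h7 ?_).trans h5)
      have : 0 < 1 / q ^ 6 := by positivity
      linarith
    rw [abs_of_nonneg (div_nonneg (cnt_nonneg _ _) hN.le), pow_zero, mul_one, div_le_one hN]
    exact h8
  have b5 := (bρ.mul b4).add hq ((t1.mul bx).mono hq le_rfl
    (by
      have : σ ^ 3 * 1 = σ * σ ^ 2 := by ring
      rw [this, pow_one]; gcongr : σ ^ 3 * 1 ≤ σ ^ 1 * μ))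
  have b6 : Bd q 30 (σ * μ) (ρ' * (c2 / cnt Y d) - mainTerm l σ Y d a b v) := by
    refine b5.cast hq ?_ (by norm_num) (by ring)
    unfold mainTerm
    simp only [ha, hb, if_false]
    ring
  unfold Bd at b6
  have b7 : |ρ' * c2 - mainTerm l σ Y d a b v * cnt Y d| ≤ q ^ 30 * (σ * μ) * cnt Y d := by
    rw [rel_iff hN, mul_div_assoc]; exact b6
  have e3 : recTerm Y d a b v - mainTerm l σ Y d a b v * cnt Y d
      = (recTerm Y d a b v - ρ' * c2) + (ρ' * c2 - mainTerm l σ Y d a b v * cnt Y d) := by ring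
  rw [e3]
  refine (abs_add_le _ _).trans (add_le_add (h1.trans ?_) b7)
  calc m * c2 ≤ m * ((1 - 1 / q ^ 6) * cnt (ad Y b v) (d - uv b - uv v)) := by gcongr
    _ = _ := by unfold ec; ring

lemma recTerm_left_est (hp : Par n l q σ) (hr : r + 12 ≤ σ⁻¹) (hm : 0 ≤ m)
    (hμ : σ ^ 2 ≤ μ) (hE : EdgeEst l q σ (edgeHat l σ) (n := n) (r + 2) μ)
    (hC : ShiftEst l q σ (shiftHat l σ) (n := n) (r + 4) m) (h : Good l q σ r Y d)
    (hN : 0 < cnt Y d)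
    (hab : a ≠ b) (hbv : b ≠ v) (ha : Y.Adj a v) (hb : ¬ Y.Adj b v) :
    |recTerm Y d a b v - mainTerm l σ Y d a b v * cnt Y d|
      ≤ (1 - 1 / q ^ 6) * m * ec Y d b v + (q ^ 30 * μ + m) * cnt Y d := by
  have hq := hp.two_le
  have hσ := hp.σ_pos
  have hr0 : r ≤ σ⁻¹ := by linarith
  have hμ0 : 0 ≤ μ := le_trans (by positivity) hμ
  have h1 := recTerm_left hC h hab hbv ha hb
  have hav := ha.ne
  have g1 := h.ad_sub hbv hb
  have n1 := (near_ad_sub hp h (by linarith) hbv hb).mono hp (by norm_num : 1 ≤ 2)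
  have t1 := n1.tail hp h g1 hr0 (by linarith) a b
  have e1 : shiftHat l σ (ad Y b v) (d - uv b - uv v) a b - shiftHat l σ Y d a b
      = (l * (1 - l))⁻¹ * ((1 - l) * σ ^ 2)
        + (tailAt l σ (ad Y b v) (d - uv b - uv v) a b - tailAt l σ Y d a b) := by
    have i1 : eD l σ (ad Y b v) (d - uv b - uv v) a = eD l σ Y d a := by
      rw [eD_ad_sub hbv hb]
      simp only [hab, hav, if_false]; ring
    have i2 : eD l σ (ad Y b v) (d - uv b - uv v) b = eD l σ Y d b - (1 - l) * σ ^ 2 := by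
      rw [eD_ad_sub hbv hb]
      simp only [hbv, if_true, if_false]; ring
    rw [shiftHat_eq, shiftHat_eq, i1, i2]
    ring
  have bE := h.bd_edgeHat hp (by linarith) b v
  have bDa := h.bd_eD hp hr0 a
  have bDb := h.bd_eD hp hr0 b
  have bDv := h.bd_eD hp hr0 v
  have bρ := h.bd_shiftHat hp hr0 a b
  have bρ' := g1.bd_shiftHat hp (by linarith) a b
  set ρ := shiftHat l σ Y d a b
  set ρ' := shiftHat l σ (ad Y b v) (d - uv b - uv v) a b
  have bd : Bd q 19 (σ ^ 2) (ρ' - ρ) := by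
    rw [e1]
    exact ((hp.inv_o.pmul (hp.bd_l'.pmul (hp.bd_σ 2))).add hq (hp.bd_pow t1
      (by norm_num : 0 + (0 + 2) ≤ 3))).cast hq rfl (by norm_num) rfl
  have hpE := (rel_iff hN).1 ((hE.mono (by linarith : r ≤ r + 2) le_rfl) Y d h b v hbv hb)
  set p := ec Y d b v / cnt Y d with hpdef
  have bp : Bd q 0 μ (p - edgeHat l σ Y d b v) := by unfold Bd; simpa using hpE
  have b1 : Bd q 17 (σ ^ 0) (1 + ρ') :=
    ((Bd.of_abs_le (by simp) : Bd q 0 (σ ^ 0) 1).add hq (hp.bd_pow bρ' (by norm_num : 0 ≤ 1))).cast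
      hq rfl (by norm_num) rfl
  have b2 := (bd.pmul bE).add hq (bρ.pmul (((bDb.add hq bDv).sub hq
    (hp.bd_l.pmul ((bDa.add hq bDb).add hq (bDv.add hq bDv))))))
  have b3 := (bp.mul b1).add hq (b2.mono hq le_rfl (by simpa using hμ : _ ≤ μ * σ ^ 0))
  have b6 : Bd q 30 μ ((1 + ρ') * p - mainTerm l σ Y d a b v) := by
    refine b3.cast hq ?_ (by norm_num) (by ring)
    unfold mainTerm
    simp only [ha, hb, if_true, if_false]
    unfold edgeHat
    ring
  unfold Bd at b6
  have b7 : |(1 + ρ') * ec Y d b v - mainTerm l σ Y d a b v * cnt Y d|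
      ≤ q ^ 30 * μ * cnt Y d := by
    rw [rel_iff hN, mul_div_assoc]; exact b6
  have e3 : recTerm Y d a b v - mainTerm l σ Y d a b v * cnt Y d
      = (recTerm Y d a b v - (1 + ρ') * ec Y d b v)
        + ((1 + ρ') * ec Y d b v - mainTerm l σ Y d a b v * cnt Y d) := by ring
  have h3 : 1 / q ^ 6 * (m * ec Y d b v) ≤ 1 * (m * cnt Y d) := by
    have h4 := ec_le (d := d) hbv hb
    have h5 : 1 / q ^ 6 ≤ 1 := by linarith [one_sub_nonneg hp 6]
    have h6 := ec_nonneg Y d b v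
    gcongr
  have h4 : |recTerm Y d a b v - (1 + ρ') * ec Y d b v| ≤ m * ec Y d b v := h1
  rw [e3]
  refine (abs_add_le _ _).trans ((add_le_add h4 b7).trans ?_)
  linarith

lemma recTerm_right_est (hp : Par n l q σ) (hr : r + 12 ≤ σ⁻¹) 
    (hμ : σ ^ 2 ≤ μ) (hE : EdgeEst l q σ (edgeHat l σ) (n := n) (r + 2) μ)
    (h : Good l q σ r Y d) (hN : 0 < cnt Y d)
    (hav : a ≠ v) (ha : ¬ Y.Adj a v) (hb : Y.Adj b v) :
    |recTerm Y d a b v - mainTerm l σ Y d a b v * cnt Y d| ≤ q ^ 30 * μ * cnt Y d := by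
  have hq := hp.two_le
  have hσ := hp.σ_pos
  have hr0 : r ≤ σ⁻¹ := by linarith
  have bDa := h.bd_eD hp hr0 a
  have bDb := h.bd_eD hp hr0 b
  have bDv := h.bd_eD hp hr0 v
  have bρ := h.bd_shiftHat hp hr0 a b
  set ρ := shiftHat l σ Y d a b
  have hpE := (rel_iff hN).1 ((hE.mono (by linarith : r ≤ r + 2) le_rfl) Y d h a v hav ha)
  set p := ec Y d a v / cnt Y d with hpdef
  have bp : Bd q 0 μ (p - edgeHat l σ Y d a v) := by unfold Bd; simpa using hpE
  have b2 := (hp.bd_l.pmul ((bDa.add hq bDb).add hq (bDv.add hq bDv))).pmul bρ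
  have b3 := bp.neg.sub hq (b2.mono hq le_rfl (by simpa using hμ : _ ≤ μ))
  have b6 : Bd q 30 μ (-p - mainTerm l σ Y d a b v) := by
    refine b3.cast hq ?_ (by norm_num) rfl
    unfold mainTerm
    simp only [ha, hb, if_true, if_false]
    unfold edgeHat
    ring
  unfold Bd at b6
  have e1 : recTerm Y d a b v = - ec Y d a v := by
    simp only [recTerm, ha, hb, if_true, if_false]; rfl
  rw [rel_iff hN, e1, neg_div]
  exact b6

lemma recTerm_both_est (hp : Par n l q σ) (hr : r + 12 ≤ σ⁻¹)
    (hμ : σ ^ 2 ≤ μ) (h : Good l q σ r Y d) (ha : Y.Adj a v) (hb : Y.Adj b v) :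
    |recTerm Y d a b v - mainTerm l σ Y d a b v * cnt Y d| ≤ q ^ 30 * μ * cnt Y d := by
  have hq := hp.two_le
  have hσ := hp.σ_pos
  have hr0 : r ≤ σ⁻¹ := by linarith
  have bDa := h.bd_eD hp hr0 a
  have bDb := h.bd_eD hp hr0 b
  have bDv := h.bd_eD hp hr0 v
  have bρ := h.bd_shiftHat hp hr0 a b
  have bτ := h.bd_shiftHat_sub hp hr0 a b
  set ρ := shiftHat l σ Y d a b
  have ho : (l * (1 - l)) * (l * (1 - l))⁻¹ = 1 :=
    mul_inv_cancel₀ (mul_ne_zero hp.l_pos.ne' (by linarith [hp.l_lt]))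
  have b2 := ((hp.bd_l.pmul ((bDa.add hq bDb).add hq (bDv.add hq bDv))).pmul bρ).add hq
    ((hp.bd_l.pmul hp.bd_l').pmul bτ)
  have b6 : Bd q 30 μ (mainTerm l σ Y d a b v) := by
    refine (b2.cast hq (y := mainTerm l σ Y d a b v) ?_ (by norm_num : _ ≤ 30) rfl).mono hq le_rfl
      (by simpa using hμ)
    unfold mainTerm
    simp only [ha, hb, if_true]
    linear_combination (-(eD l σ Y d b - eD l σ Y d a)) * ho
  have e1 : recTerm Y d a b v = 0 := by
    simp only [recTerm, ha, hb, if_true]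
  rw [e1, zero_sub, abs_neg, abs_mul, abs_of_nonneg (cnt_nonneg Y d)]
  exact mul_le_mul_of_nonneg_right b6 (cnt_nonneg _ _)

end SecondOrder

section ShiftSecondOrder

variable {n : ℕ} {l q σ r m μ : ℝ} {Y : SimpleGraph (Fin n)} {d : Fin n → ℤ} {a b v : Fin n}

lemma sum_mainTerm (hp : Par n l q σ) (Y : SimpleGraph (Fin n)) (d : Fin n → ℤ) (a b : Fin n) :
    (∑ v, mainTerm l σ Y d a b v) * σ ^ 2
      = l ^ 2 * shiftHat l σ Y d a b
        + l * (eD l σ Y d a + eD l σ Y d b) * shiftHat l σ Y d a b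
        + 2 * l * shiftHat l σ Y d a b * ((∑ v, eD l σ Y d v) * σ ^ 2)
        + eX σ Y a * (l * (1 - l) * shiftHat l σ Y d a b + l + eD l σ Y d b) + eS l σ Y d a
        - eX σ Y b * (l ^ 2 * shiftHat l σ Y d a b + l + eD l σ Y d a) - eS l σ Y d b := by
  have hn := hp.n_eq
  have key : ∀ (c : Fin n) (k : ℝ), ∑ v, (if Y.Adj c v then k + eD l σ Y d v else 0)
      = dg Y c * k + ∑ v, (if Y.Adj c v then eD l σ Y d v else 0) := by
    intro c k
    rw [dg_real, Finset.sum_mul, ← Finset.sum_add_distrib]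
    refine Finset.sum_congr rfl fun v _ => ?_
    split_ifs <;> ring
  unfold mainTerm
  have e1 : ∑ v, (l ^ 2 * shiftHat l σ Y d a b
      + l * (eD l σ Y d a + eD l σ Y d b + 2 * eD l σ Y d v) * shiftHat l σ Y d a b)
      = n * (l ^ 2 * shiftHat l σ Y d a b
        + l * (eD l σ Y d a + eD l σ Y d b) * shiftHat l σ Y d a b)
        + 2 * l * shiftHat l σ Y d a b * ∑ v, eD l σ Y d v := by
    have e2 : ∀ k : ℝ, (n : ℝ) * k = ∑ _v : Fin n, k := fun k => by simp
    rw [Finset.mul_sum, e2, ← Finset.sum_add_distrib]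
    exact Finset.sum_congr rfl fun v _ => by ring
  rw [Finset.sum_sub_distrib, Finset.sum_add_distrib, e1, key, key]
  unfold eX eS
  linear_combination (l ^ 2 * shiftHat l σ Y d a b
    + l * (eD l σ Y d a + eD l σ Y d b) * shiftHat l σ Y d a b) * hn

lemma bd_mainTerm_ends (hp : Par n l q σ) (h : Good l q σ r Y d) (hr : r ≤ σ⁻¹) (a b : Fin n) :
    Bd q 24 (σ ^ 1) (mainTerm l σ Y d a b a + mainTerm l σ Y d a b b) := by
  have hq := hp.two_le
  have bDa := h.bd_eD hp hr a
  have bDb := h.bd_eD hp hr b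
  have bρ := h.bd_shiftHat hp hr a b
  have hyb : |if Y.Adj a b then (1 : ℝ) else 0| ≤ 1 := by split_ifs <;> simp
  set y : ℝ := if Y.Adj a b then 1 else 0 with hy
  have b1 := (hp.bd_l.pmul hp.bd_l).pmul bρ
  have b2 := (hp.bd_l.pmul (bDa.add hq bDb)).pmul bρ
  have b3 := ((hp.bd_l.pmul (hp.bd_l'.sub hq hp.bd_l)).pmul bρ).add hq
    ((bDb.sub hq bDa).add hq (bDb.sub hq bDa))
  have b4 := hp.bd_pow ((b2.add hq b2).add hq (b2.add hq b2)) (by norm_num : 1 ≤ 0 + 1 + 1)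
  refine (((b1.add hq b1).add hq b4).add hq (b3.mul_const hyb)).cast hq ?_ (by norm_num) rfl
  have e1 : ∀ k : ℝ, (if Y.Adj a b then k else 0) = y * k := by
    intro k; rw [hy]; split_ifs <;> simp
  unfold mainTerm
  simp only [SimpleGraph.irrefl, if_false, Y.adj_comm b a, e1]
  ring

lemma bd_drift (hp : Par n l q σ) (h : Good l q σ r Y d) (hr : r ≤ σ⁻¹) (hab : a ≠ b) :
    Bd q 30 (σ ^ 3) ((d a + ∑ v ∈ univ \ {a, b}, mainTerm l σ Y d a b v
      - (1 + shiftHat l σ Y d a b) * (d b + 1)) * σ ^ 2) := by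
  have hq := hp.two_le
  have bDa := h.bd_eD hp hr a
  have bDb := h.bd_eD hp hr b
  have bxa := h.bd_eX hp hr a
  have bxb := h.bd_eX hp hr b
  have bρ := h.bd_shiftHat hp hr a b
  have bτ := h.bd_shiftHat_sub hp hr a b
  have bm := bd_mainTerm_ends hp h hr a b
  have bs := h.bd_sum_eD hp hr
  have e1 := sum_mainTerm hp Y d a b
  have e2 := deg_scale hp Y d a
  have e3 := deg_scale hp Y d b
  have e4 : ∑ v ∈ univ \ {a, b}, mainTerm l σ Y d a b v
      = ∑ v, mainTerm l σ Y d a b v - (mainTerm l σ Y d a b a + mainTerm l σ Y d a b b) := by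
    rw [← Finset.sum_sdiff (Finset.subset_univ {a, b}), Finset.sum_pair hab, add_sub_cancel_right]
  have e5 := shiftHat_eq l σ Y d a b
  have hl := hp.l_pos.ne'
  have hl' : 1 - l ≠ 0 := by linarith [hp.l_lt]
  have bσ := hp.bd_σ 2
  have c1 := bτ.pmul ((hp.bd_l.pmul bDa).sub hq (hp.bd_l'.pmul bDb))
  have c2 := ((hp.bd_l.pmul hp.bd_l').pmul bτ).pmul (bxa.add hq bxb)
  have c3 := (hp.bd_l'.pmul bρ).pmul bσ
  have c4 := (hp.bd_l.pmul bρ).pmul (bs.pmul bσ)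
  have c5 := bm.pmul bσ
  refine ((((((c1.add hq c2).sub hq c3).add hq c4).add hq c4).sub hq c5)).cast hq ?_ (by norm_num)
    (by norm_num)
  rw [e4]
  have e6 : l * (1 - l) * (shiftHat l σ Y d a b) = (eD l σ Y d a - eD l σ Y d b - σ ^ 2)
      + ((eD l σ Y d a - eD l σ Y d b) * (eD l σ Y d a * (1 - l)⁻¹ - eD l σ Y d b * l⁻¹)
        + (eX σ Y a * eD l σ Y d a - eX σ Y b * eD l σ Y d b)
        + (eS l σ Y d a - eS l σ Y d b)) := by
    rw [e5]; unfold tailAt tail; field_simp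
  have e7 : (l * (1 - l))⁻¹ * (eD l σ Y d a - eD l σ Y d b)
        * (l * eD l σ Y d a - (1 - l) * eD l σ Y d b)
      = (eD l σ Y d a - eD l σ Y d b) * (eD l σ Y d a * (1 - l)⁻¹ - eD l σ Y d b * l⁻¹) := by
    field_simp
  have e8 : (l * (1 - l)) * (l * (1 - l))⁻¹ = 1 := mul_inv_cancel₀ (mul_ne_zero hl hl')
  generalize shiftHat l σ Y d a b = ρ at *
  generalize (l * (1 - l))⁻¹ = w at *
  linear_combination e1 + e2 - (1 + ρ) * e3 - e6 + e7
    + ((eD l σ Y d a - eD l σ Y d b) * (eX σ Y a + eX σ Y b)) * e8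

lemma recTerm_est (hp : Par n l q σ) (hr : r + 12 ≤ σ⁻¹) (hm : 0 ≤ m)
    (hμ : σ ^ 2 ≤ μ) (hE : EdgeEst l q σ (edgeHat l σ) (n := n) (r + 2) μ)
    (hC : ShiftEst l q σ (shiftHat l σ) (n := n) (r + 4) m) (h : Good l q σ r Y d)
    (hN : 0 < cnt Y d) (hab : a ≠ b) (hav : a ≠ v) (hbv : b ≠ v) :
    |recTerm Y d a b v - mainTerm l σ Y d a b v * cnt Y d|
      ≤ (if v ≠ b ∧ ¬ Y.Adj b v then
          (1 - 1 / q ^ 6) * m * cnt (ad Y b v) (d - uv b - uv v) else 0)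
        + (q ^ 30 * (σ * μ) + ((if Y.Adj a v then 1 else 0) + (if Y.Adj b v then 1 else 0))
          * (q ^ 30 * μ + m)) * cnt Y d := by
  have hq := hp.q_pos
  have hσ := hp.σ_pos
  have hμ0 : 0 ≤ μ := le_trans (by positivity) hμ
  have k1 : 0 ≤ q ^ 30 * (σ * μ) * cnt Y d := by positivity
  have k2 : 0 ≤ m * cnt Y d := by positivity
  have k3 : 0 ≤ q ^ 30 * μ * cnt Y d := by positivity
  by_cases ha : Y.Adj a v <;> by_cases hb : Y.Adj b v
  · have h1 := recTerm_both_est hp hr hμ h ha hb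
    simp only [ha, hb, not_true_eq_false, and_false, if_true, if_false]
    linarith
  · have h1 := recTerm_left_est hp hr hm hμ hE hC h hN hab hbv ha hb
    unfold ec at h1
    simp only [ha, hb, hbv.symm, ne_eq, not_false_eq_true, and_self, if_true, if_false]
    linarith
  · have h1 := recTerm_right_est hp hr hμ hE h hN hav ha hb
    simp only [ha, hb, not_true_eq_false, and_false, if_true, if_false]
    linarith
  · have h1 := recTerm_free_est hp hr hm hμ hE hC h hN hab hav hbv ha hb
    unfold ec at h1
    simp only [ha, hb, hbv.symm, ne_eq, not_false_eq_true, and_self, if_true, if_false]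
    linarith

lemma recEdge_bound (hp : Par n l q σ) (h : Good l q σ r Y d) (hr : r + 2 ≤ σ⁻¹ * (3 / 4))
    (hab : a ≠ b) : |recEdge Y d a b| ≤ q ^ 16 * σ * cnt Y d := by
  have hN := cnt_nonneg Y d
  have hσ := hp.σ_pos
  have hq := hp.q_pos
  unfold recEdge
  split_ifs with hY
  · rw [abs_zero]; positivity
  · have h1 := (shift_est_crude hp) _ _ ((h.ad_sub hab hY).mono hr) a b hab
    have e1 : d - uv a - uv b - uv a + uv b = d - uv a - uv a := by abel
    rw [e1, add_zero, one_mul] at h1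
    exact h1.trans (mul_le_mul_of_nonneg_left (cnt_ad_le hab hY) (by positivity))

lemma shift_est_improve (hp : Par n l q σ) (hr : r + 12 ≤ σ⁻¹ * (3 / 4)) (hm : 0 ≤ m)
    (hμ : σ ^ 2 ≤ μ) (hE : EdgeEst l q σ (edgeHat l σ) (n := n) (r + 2) μ)
    (hC : ShiftEst l q σ (shiftHat l σ) (n := n) (r + 4) m) :
    ShiftEst l q σ (shiftHat l σ) (n := n) r ((1 - 1 / q ^ 7) * m + q ^ 35 * (σ * μ)) := by
  intro Y d h a b hab
  have hq := hp.q_ge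
  have hσ := hp.σ_pos
  have hs := inv_pos.2 hσ
  have hμ0 : 0 ≤ μ := le_trans (by positivity) hμ
  have hr' : r + 12 ≤ σ⁻¹ := by linarith
  have hr0 : r ≤ σ⁻¹ := by linarith
  rcases (cnt_nonneg Y d).eq_or_lt with hN | hN
  · have h1 := shift_le hp h hr0 hab
    have h2 := cnt_nonneg Y (d - uv a + uv b)
    rw [← hN, mul_zero] at h1
    rw [← hN, le_antisymm h1 h2]
    simp
  have h1 := recTerm_bound (Y := Y) (d := d) hab (k := (1 - 1 / q ^ 6) * m)
    (M := mainTerm l σ Y d a b)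
    (E := fun v => q ^ 30 * (σ * μ) + ((if Y.Adj a v then 1 else 0) + (if Y.Adj b v then 1 else 0))
          * (q ^ 30 * μ + m))
    (mul_nonneg (one_sub_nonneg hp 6) hm) (by
      intro v hv
      have hav : a ≠ v := by rintro rfl; simp at hv
      have hbv : b ≠ v := by rintro rfl; simp at hv
      exact recTerm_est hp hr' hm hμ hE hC h hN hab hav hbv)
  have h2 : ∑ v ∈ univ \ {a, b}, (q ^ 30 * (σ * μ) + ((if Y.Adj a v then (1 : ℝ) else 0)
      + (if Y.Adj b v then 1 else 0)) * (q ^ 30 * μ + m))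
      ≤ n * (q ^ 30 * (σ * μ)) + 4 * q * σ⁻¹ * (q ^ 30 * μ + m) := by
    rw [Finset.sum_add_distrib, ← Finset.sum_mul _ _ (q ^ 30 * μ + m), Finset.sum_add_distrib]
    have ha := (sum_adj_le Y a (univ \ {a, b})).trans (h.forb' hp (by linarith) a)
    have hb := (sum_adj_le Y b (univ \ {a, b})).trans (h.forb' hp (by linarith) b)
    have h0 : 0 ≤ q ^ 30 * (σ * μ) := by positivity
    refine add_le_add ?_ (mul_le_mul_of_nonneg_right (by linarith) (by positivity))
    rw [Finset.sum_const, nsmul_eq_mul]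
    refine mul_le_mul_of_nonneg_right ?_ h0
    exact_mod_cast (Finset.card_le_univ _).trans (by simp)
  have h3 := recEdge_bound hp h (by linarith) hab
  have h4 : |(d a : ℝ) + ∑ v ∈ univ \ {a, b}, mainTerm l σ Y d a b v
      - (1 + shiftHat l σ Y d a b) * (d b + 1)| ≤ q ^ 30 * σ := by
    have h5 := bd_drift hp h hr0 hab
    unfold Bd at h5
    rw [abs_mul, abs_of_pos (by positivity : 0 < σ ^ 2)] at h5
    refine le_of_mul_le_mul_right (h5.trans (le_of_eq ?_)) (by positivity : 0 < σ ^ 2)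
    ring
  have h6 := h.deg_ge hp hr0 b
  set N := cnt Y d with hNdef
  set c := cnt Y (d - uv a + uv b) with hc
  set ρ := shiftHat l σ Y d a b
  have hD : (0 : ℝ) < d b + 1 := by
    have := hp.n_pos
    by_contra hcon
    nlinarith
  have hn0 := hp.n_pos
  have hnσ : σ ≤ n * (σ * μ) := by
    calc σ = (n * σ ^ 2) * σ := by rw [hp.n_eq, one_mul]
      _ = n * (σ * σ ^ 2) := by ring
      _ ≤ n * (σ * μ) := by gcongr
  have hσn : σ⁻¹ = n * σ := by rw [hp.n_eq']; field_simp
  have hq30 : ∀ k ≤ 32, q ^ k ≤ q ^ 32 := fun k hk => pow_le_pow_right₀ (by linarith) hk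
  have k16 := hq30 16 (by norm_num)
  have k30 := hq30 30 (by norm_num)
  have h9 : (d b + 1) * |c - (1 + ρ) * N| ≤ (1 - 1 / q ^ 6) * m * (d b * N)
      + (n * (7 * q ^ 32 * (σ * μ) + 4 * q * (σ * m))) * N := by
    have e1 : ((d b : ℝ) + 1) * (c - (1 + ρ) * N)
        = (((d b : ℝ) + 1) * c - d a * N - recEdge Y d a b
            - (∑ v ∈ univ \ {a, b}, mainTerm l σ Y d a b v) * N) + recEdge Y d a b
          + ((d a : ℝ) + ∑ v ∈ univ \ {a, b}, mainTerm l σ Y d a b v - (1 + ρ) * (d b + 1)) * N := by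
      ring
    have e2 : (d b + 1) * |c - (1 + ρ) * N| = |((d b : ℝ) + 1) * (c - (1 + ρ) * N)| := by
      rw [abs_mul, abs_of_pos hD]
    rw [e2, e1]
    refine (abs_add_three _ _ _).trans ?_
    rw [abs_mul _ N, abs_of_pos hN]
    have h10 := mul_le_mul_of_nonneg_right h2 hN.le
    have h11 := mul_le_mul_of_nonneg_right h4 hN.le
    have h12 : n * (q ^ 30 * (σ * μ)) + 4 * q * σ⁻¹ * (q ^ 30 * μ + m) + q ^ 16 * σ + q ^ 30 * σ
        ≤ n * (7 * q ^ 32 * (σ * μ) + 4 * q * (σ * m)) := by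
      have i1 : n * (q ^ 30 * (σ * μ)) ≤ n * (q ^ 32 * (σ * μ)) := by gcongr
      have i2 : q ^ 16 * σ ≤ q ^ 32 * (n * (σ * μ)) := by gcongr
      have i3 : q ^ 30 * σ ≤ q ^ 32 * (n * (σ * μ)) := by gcongr
      have i4 : n * (4 * q * σ * (q ^ 30 * μ)) ≤ n * (4 * (q ^ 32 * (σ * μ))) := by
        have := hq30 31 (by norm_num)
        calc (n : ℝ) * (4 * q * σ * (q ^ 30 * μ)) = n * (4 * (q ^ 31 * (σ * μ))) := by ring
          _ ≤ _ := by gcongr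
      rw [hσn]
      linarith
    have h13 := mul_le_mul_of_nonneg_right h12 hN.le
    linarith
  have h14 : (n : ℝ) * (7 * q ^ 32 * (σ * μ) + 4 * q * (σ * m))
      ≤ (d b + 1) * (q ^ 35 * (σ * μ) + (1 / q ^ 6 - 1 / q ^ 7) * m) := by
    have i1 : (n : ℝ) ≤ 2 * q * (d b + 1) := by nlinarith
    have i2 : 2 * q * (7 * q ^ 32 * (σ * μ) + 4 * q * (σ * m))
        ≤ q ^ 35 * (σ * μ) + (1 / q ^ 6 - 1 / q ^ 7) * m := by
      have j1 : 14 * q ^ 33 ≤ q ^ 35 := by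
        have : (14 : ℝ) ≤ q ^ 2 := by nlinarith
        calc 14 * q ^ 33 ≤ q ^ 2 * q ^ 33 := by gcongr
          _ = _ := by ring
      have j2 : 8 * q ^ 2 * σ ≤ 1 / q ^ 6 - 1 / q ^ 7 := by
        have : 1 / q ^ 6 - 1 / q ^ 7 = (q - 1) / q ^ 7 := by field_simp
        rw [this, le_div_iff₀ (by positivity)]
        have := hp.pow_small (K := 9) (by norm_num)
        calc 8 * q ^ 2 * σ * q ^ 7 = 8 * (q ^ 9 * σ) := by ring
          _ ≤ q - 1 := by linarith
      have j3 := mul_le_mul_of_nonneg_right j1 (by positivity : 0 ≤ σ * μ)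
      have j4 := mul_le_mul_of_nonneg_right j2 hm
      linarith
    calc (n : ℝ) * (7 * q ^ 32 * (σ * μ) + 4 * q * (σ * m))
        ≤ (2 * q * (d b + 1)) * (7 * q ^ 32 * (σ * μ) + 4 * q * (σ * m)) := by gcongr
      _ = (d b + 1) * (2 * q * (7 * q ^ 32 * (σ * μ) + 4 * q * (σ * m))) := by ring
      _ ≤ _ := by gcongr
  have h15 := mul_le_mul_of_nonneg_right h14 hN.le
  have hk := mul_nonneg (mul_nonneg (one_sub_nonneg hp 6) hm) hN.le
  refine le_of_mul_le_mul_left ?_ hD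
  linarith

end ShiftSecondOrder

section Bootstrap

variable {n : ℕ} {l q σ r m μ : ℝ} {Y : SimpleGraph (Fin n)} {d : Fin n → ℤ} {a b v : Fin n}

lemma edgeHat_est_crude (hp : Par n l q σ) (hr : r + 4 ≤ σ⁻¹ * (3 / 4)) :
    EdgeEst l q σ (edgeHat l σ) (n := n) r (q ^ 19 * σ) := by
  intro Y d h a v hav hY
  have hq := hp.two_le
  have hr0 : r ≤ σ⁻¹ := by
    have : 0 < σ⁻¹ := inv_pos.2 hp.σ_pos
    linarith
  rcases (cnt_nonneg Y d).eq_or_lt with hN | hN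
  · have h1 := ec_le (d := d) hav hY
    have h2 := ec_nonneg Y d a v
    have h3 : ec Y d a v = 0 := by linarith
    simp [← hN, h3]
  have h1 := (rel_iff hN).1 (edge_est_crude hp hr Y d h a v hav hY)
  rw [rel_iff hN]
  have b1 : Bd q 18 (σ ^ 1) (ec Y d a v / cnt Y d - l) := by unfold Bd; simpa using h1
  have b2 := (h.bd_eD hp hr0 a).add hq (h.bd_eD hp hr0 v)
  have b3 : Bd q 19 (σ ^ 1) (ec Y d a v / cnt Y d - edgeHat l σ Y d a v) :=
    (b1.sub hq b2).cast hq (by unfold edgeHat; ring) (by norm_num) rfl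
  unfold Bd at b3
  simpa using b3

lemma ShiftEst.improve (hp : Par n l q σ) {ρ m0 : ℝ} (hρ0 : 1 / 8 ≤ ρ) (hρ : ρ ≤ 11 / 16)
    (hm0 : 0 ≤ m0) (hμ : σ ^ 2 ≤ μ) (hm : m0 * σ ^ 3 ≤ q ^ 35 * (σ * μ))
    (hE : EdgeEst l q σ (edgeHat l σ) (n := n) (σ⁻¹ * ρ) μ)
    (h0 : ShiftEst l q σ (shiftHat l σ) (n := n) (σ⁻¹ * ρ) m0) :
    ShiftEst l q σ (shiftHat l σ) (n := n) (σ⁻¹ * (ρ - 1 / 8)) (q ^ 43 * (σ * μ)) := by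
  have hq := hp.q_pos
  have hσ := hp.σ_pos
  have hs := inv_pos.2 hσ
  have hμ0 : 0 ≤ μ := le_trans (by positivity) hμ
  have hi := hp.inv_ge
  have hq10 : 1 ≤ q ^ 10 := one_le_pow₀ (by linarith [hp.two_le])
  have h := h0.iterate hp (e := q ^ 35 * (σ * μ)) (by positivity) hm0 le_rfl (by nlinarith) hm
    (fun r m _ h1 h2 _ hC => shift_est_improve hp (by nlinarith) h2 hμ (hE.mono (by linarith) le_rfl) hC)
  exact h.mono (by linarith) (le_of_eq (by ring))

lemma shift_est_first (hp : Par n l q σ) :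
    ShiftEst l q σ (shiftHat l σ) (n := n) (σ⁻¹ * (9 / 16)) (q ^ 62 * σ ^ 2) := by
  have hq := hp.two_le
  have hσ := hp.σ_pos
  have hσ1 := hp.σ_le
  have hs := inv_pos.2 hσ
  have hi := hp.inv_ge
  have hq10 : 1 ≤ q ^ 10 := one_le_pow₀ (by linarith)
  have h0 : ShiftEst l q σ (shiftHat l σ) (n := n) (σ⁻¹ * (11 / 16)) (q ^ 17 * σ) := by
    intro Y d h a b hab
    have hN := cnt_nonneg Y d
    have h1 := (shift_est_crude hp) Y d (h.mono (by linarith)) a b hab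
    have h2 := h.bd_shiftHat hp (by linarith) a b
    unfold Bd at h2
    rw [add_zero, one_mul] at h1
    have e1 : cnt Y (d - uv a + uv b) - (1 + shiftHat l σ Y d a b) * cnt Y d
        = (cnt Y (d - uv a + uv b) - cnt Y d) + -(shiftHat l σ Y d a b) * cnt Y d := by ring
    rw [e1]
    refine (abs_add_le _ _).trans ((add_le_add_left h1 _).trans ?_)
    rw [abs_mul, abs_neg, abs_of_nonneg hN]
    have h3 := mul_le_mul_of_nonneg_right h2 hN
    have h4 : q ^ 16 * σ * cnt Y d + q ^ 16 * σ ^ 1 * cnt Y d = 2 * (q ^ 16 * σ * cnt Y d) := by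
      ring
    have h5 : 2 * (q ^ 16 * σ * cnt Y d) ≤ q * (q ^ 16 * σ * cnt Y d) := by gcongr
    have h6 : q ^ 17 * σ * cnt Y d = q * (q ^ 16 * σ * cnt Y d) := by ring
    linarith
  have hk : q ^ 17 ≤ q ^ 35 := pow_le_pow_right₀ (by linarith) (by norm_num)
  have hk' : 1 ≤ q ^ 19 := one_le_pow₀ (by linarith)
  have hσ2 : σ ^ 2 ≤ q ^ 19 * σ := by nlinarith
  have hσ3 : σ ^ 2 ≤ 1 := pow_le_one₀ hσ.le hσ1
  refine (h0.improve hp (by norm_num) le_rfl (by positivity) hσ2 ?_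
    (edgeHat_est_crude hp (by linarith))).mono (by linarith) (le_of_eq (by ring))
  calc q ^ 17 * σ * σ ^ 3 = q ^ 17 * (σ * (σ ^ 2 * σ)) := by ring
    _ ≤ q ^ 35 * (σ * (1 * (q ^ 19 * σ))) := by gcongr; nlinarith
    _ = _ := by ring

lemma edgeHat_est (hp : Par n l q σ) :
    EdgeEst l q σ (edgeHat l σ) (n := n) (σ⁻¹ * (1 / 2)) (q ^ 65 * σ ^ 2) := by
  have hq := hp.two_le
  have hσ := hp.σ_pos
  have hs := inv_pos.2 hσ
  have hi := hp.inv_ge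
  have hq10 : 1 ≤ q ^ 10 := one_le_pow₀ (by linarith)
  refine (edge_est hp (r := σ⁻¹ * (1 / 2)) (by linarith) (by positivity)
    ((shift_est_first hp).mono (by linarith) le_rfl)).mono le_rfl ?_
  have h1 : q ^ 30 ≤ q ^ 62 := pow_le_pow_right₀ (by linarith) (by norm_num)
  calc q ^ 2 * (q ^ 62 * σ ^ 2 + q ^ 30 * σ ^ 2) ≤ q ^ 2 * (q ^ 62 * σ ^ 2 + q ^ 62 * σ ^ 2) := by
        gcongr
    _ = 2 * (q ^ 64 * σ ^ 2) := by ring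
    _ ≤ q * (q ^ 64 * σ ^ 2) := by gcongr
    _ = _ := by ring

lemma shift_est (hp : Par n l q σ) :
    ShiftEst l q σ (shiftHat l σ) (n := n) (σ⁻¹ * (5 / 16)) (q ^ 108 * σ ^ 3) := by
  have hq := hp.two_le
  have hσ := hp.σ_pos
  have hσ1 := hp.σ_le
  have hs := inv_pos.2 hσ
  have hk : q ^ 62 ≤ q ^ 100 := pow_le_pow_right₀ (by linarith) (by norm_num)
  have hσ3 : σ ^ 2 ≤ 1 := pow_le_one₀ hσ.le hσ1
  have hk' : 1 ≤ q ^ 65 := one_le_pow₀ (by linarith)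
  refine (((shift_est_first hp).mono (by linarith : σ⁻¹ * (7 / 16) ≤ _) le_rfl).improve hp
    (by norm_num) (by norm_num) (by positivity) (by nlinarith [sq_nonneg σ]) ?_
    ((edgeHat_est hp).mono (by linarith) le_rfl)).mono (by linarith) (le_of_eq (by ring))
  calc q ^ 62 * σ ^ 2 * σ ^ 3 ≤ q ^ 100 * 1 * σ ^ 3 := by gcongr
    _ = _ := by ring

/-- Second order estimate of the edge probability. -/
def edgeTop (l σ : ℝ) (Y : SimpleGraph (Fin n)) (d : Fin n → ℤ) (a v : Fin n) : ℝ :=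
  l + eD l σ Y d a + eD l σ Y d v + (1 - 2 * l) * (l * (1 - l))⁻¹ * (eD l σ Y d a * eD l σ Y d v)
    + (eX σ Y a * eD l σ Y d a + eS l σ Y d a) + (eX σ Y v * eD l σ Y d v + eS l σ Y d v)
    - l * (∑ j, (dg Y j : ℝ)) * σ ^ 4

lemma wc_first_order (hp : Par n l q σ) (hr : r + 6 ≤ σ⁻¹ * (1 / 2)) (h : Good l q σ r Y d)
    (hN : 0 < cnt Y d)
    (hab : a ≠ b) (hav : a ≠ v) (hbv : b ≠ v) (ha : ¬ Y.Adj a v) (hb : ¬ Y.Adj b v) :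
    Bd q 75 (σ ^ 2) (wc Y d a b v / cnt Y d - (l * (1 - l)
      + (1 - l) * (eD l σ Y d a + eD l σ Y d v) - l * (eD l σ Y d b + eD l σ Y d v))) := by
  have hσ := hp.σ_pos
  have hq := hp.q_pos
  have hq2 := hp.two_le
  have hs := inv_pos.2 hσ
  have hr0 : r ≤ σ⁻¹ := by linarith
  obtain ⟨p, w, h1, h2, h3, h4⟩ := wc_est ((edgeHat_est hp).mono (by linarith : r + 2 ≤ _) le_rfl) h
    (by positivity) hN hab hav hbv ha hb
  have b1 : Bd q 65 (σ ^ 2) (p - edgeHat l σ Y d a v) := h1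
  have b2 : Bd q 65 (σ ^ 2) w := h2
  have b3 : Bd q 0 (σ ^ 0) p := Bd.of_abs_le h3
  have bDa := h.bd_eD hp hr0 a
  have bDb := h.bd_eD hp hr0 b
  have bDv := h.bd_eD hp hr0 v
  have e1 : edgeHat l σ (ad Y a v) (d - uv a - uv v) b v
      = l + eD l σ Y d b + eD l σ Y d v - (1 - l) * σ ^ 2 := by
    unfold edgeHat
    rw [eD_ad_sub hav ha, eD_ad_sub hav ha]
    simp only [hab.symm, hav.symm, hbv, if_true, if_false]
    ring
  have bE := h.bd_edgeHat hp hr0 b v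
  have c1 := b1.pmul ((Bd.of_abs_le (by simp) : Bd q 0 (σ ^ 0) 1).sub hq2 bE)
  have c2 := b3.pmul (hp.bd_l'.pmul (hp.bd_σ 2))
  have c3 := (bDa.add hq2 bDv).pmul (bDb.add hq2 bDv)
  have c4 := hp.bd_pow c3 (by norm_num : 0 + 2 ≤ 1 + 1)
  refine (((c1.add hq2 c2).sub hq2 c4).add hq2 b2).cast hq2 ?_ (by norm_num) rfl
  rw [h4, e1]
  unfold edgeHat
  ring

lemma edgeTop_diff (hp : Par n l q σ) (h : Good l q σ 0 Y d) (hN : 0 < cnt Y d)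
    (hab : a ≠ b) (hav : a ≠ v) (hbv : b ≠ v) (ha : ¬ Y.Adj a v) (hb : ¬ Y.Adj b v) :
    |ec Y d b v - ec Y d a v - (edgeTop l σ Y d b v - edgeTop l σ Y d a v) * cnt Y d|
      ≤ q ^ 109 * σ ^ 3 * cnt Y d := by
  have hσ := hp.σ_pos
  have hq := hp.q_pos
  have hq2 := hp.two_le
  have hs := inv_pos.2 hσ
  have hi := hp.inv_ge
  have hq10 : 1 ≤ q ^ 10 := one_le_pow₀ (by linarith)
  have hr0 : 0 ≤ σ⁻¹ := hs.le
  have h2 := edge_diff ((shift_est hp).mono (by linarith : (0:ℝ) + 4 ≤ σ⁻¹ * (5 / 16)) le_rfl) h (by positivity)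
    hab hav hbv ha hb
  rw [shiftHat_wc hab hav hbv ha hb] at h2
  have h3 := wc_first_order hp (by linarith) h hN hab hav hbv ha hb
  have g1 := h.ad_sub hav ha
  have n1 := (near_ad_sub hp h (by linarith) hav ha).trans hp
    (near_ad hp g1 (by linarith) hbv (not_adj_ad hab hav hbv hb))
  have t1 := n1.tail hp h (h.wc hab hav hbv ha hb) hr0 (by linarith) b a
  have t0 := h.bd_tail hp hr0 b a
  set w := wc Y d a b v with hw
  have bDa := h.bd_eD hp hr0 a
  have bDb := h.bd_eD hp hr0 b
  have bDv := h.bd_eD hp hr0 v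
  have hw1 : Bd q 0 (σ ^ 0) (w / cnt Y d) := by
    refine Bd.of_abs_le ?_
    rw [abs_of_nonneg (div_nonneg (wc_nonneg _ _ _ _ _) hN.le), div_le_one hN]
    exact wc_le hab hav hbv ha hb
  have hl := hp.l_pos.ne'
  have hl' : 1 - l ≠ 0 := by linarith [hp.l_lt]
  have hwc := wc_crude hp (by linarith) h hN hab hav hbv ha hb
  have c1 := (hp.inv_o.pmul (bDb.sub hq2 bDa)).pmul h3
  have c2 := t1.pmul hw1
  have c3 := t0.pmul hwc
  have c4 := (c1.add hq2 c2).add hq2 c3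
  have h6 : Bd q 100 (σ ^ 3) (((l * (1 - l))⁻¹ * (eD l σ Y d b - eD l σ Y d a)
      + tailAt l σ (ad (ad Y a v) b v) (d - uv a - uv v) b a) * (w / cnt Y d)
      - (edgeTop l σ Y d b v - edgeTop l σ Y d a v)) := by
    refine c4.cast hq2 ?_ (by norm_num) (by norm_num)
    have e1 : l * (1 - l) * tailAt l σ Y d b a
        = (eD l σ Y d b - eD l σ Y d a) * (eD l σ Y d b * (1 - l)⁻¹ - eD l σ Y d a * l⁻¹)
        + (eX σ Y b * eD l σ Y d b - eX σ Y a * eD l σ Y d a)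
        + (eS l σ Y d b - eS l σ Y d a) := by
      unfold tailAt tail; field_simp
    generalize tailAt l σ Y d b a = t at *
    generalize tailAt l σ (ad (ad Y a v) b v) (d - uv a - uv v) b a = t' at *
    have e2 : (l * (1 - l))⁻¹ * (l * (1 - l)) = 1 := inv_mul_cancel₀ (mul_ne_zero hl hl')
    have e3 : (l * (1 - l))⁻¹ * (1 - l) = l⁻¹ := by field_simp
    have e4 : (l * (1 - l))⁻¹ * l = (1 - l)⁻¹ := by field_simp
    unfold edgeTop
    generalize (l * (1 - l))⁻¹ = o at *
    linear_combination e1 + (eD l σ Y d b - eD l σ Y d a) * (e2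
      + eD l σ Y d a * e3 - eD l σ Y d b * e4)
  unfold Bd at h6
  rw [rel_iff hN]
  have h7 : |(ec Y d b v - ec Y d a v - ((l * (1 - l))⁻¹ * (eD l σ Y d b - eD l σ Y d a)
      + tailAt l σ (ad (ad Y a v) b v) (d - uv a - uv v) b a) * w) / cnt Y d - 0|
      ≤ q ^ 108 * σ ^ 3 :=
    (rel_iff hN).1 (by rwa [zero_mul, sub_zero])
  have e1 : (ec Y d b v - ec Y d a v) / cnt Y d - (edgeTop l σ Y d b v - edgeTop l σ Y d a v)
      = ((ec Y d b v - ec Y d a v - ((l * (1 - l))⁻¹ * (eD l σ Y d b - eD l σ Y d a)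
      + tailAt l σ (ad (ad Y a v) b v) (d - uv a - uv v) b a) * w) / cnt Y d - 0)
      + (((l * (1 - l))⁻¹ * (eD l σ Y d b - eD l σ Y d a)
      + tailAt l σ (ad (ad Y a v) b v) (d - uv a - uv v) b a) * (w / cnt Y d)
      - (edgeTop l σ Y d b v - edgeTop l σ Y d a v)) := by ring
  have b1 : Bd q 108 (σ ^ 3) _ := h7
  have b2 := (b1.add hq2 (show Bd q 100 (σ ^ 3) _ from h6)).mono_left hq2
    (by norm_num : max 108 100 + 1 ≤ 109)
  rw [e1]
  exact b2

end Bootstrap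

section Second

variable {n : ℕ} {l q σ r m μ : ℝ} {Y : SimpleGraph (Fin n)} {d : Fin n → ℤ} {a b v : Fin n}

lemma Good.sum_dg (h : Good l q σ 0 Y d) (hp : Par n l q σ) :
    Bd q 1 (σ ^ 0) ((∑ j, (dg Y j : ℝ)) * σ ^ 2) := by
  have h1 := h.edges
  have hσ := hp.σ_pos
  have hn := hp.n_eq
  have h0 : (0 : ℝ) ≤ ∑ j, (dg Y j : ℝ) := Finset.sum_nonneg fun j _ => dg_nonneg Y j
  unfold Bd
  rw [abs_of_nonneg (by positivity)]
  calc _ ≤ (q * n + 0) * σ ^ 2 := by gcongr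
    _ = q * (n * σ ^ 2) := by ring
    _ = _ := by rw [hn]; ring

lemma Good.bd_sum_eX_mul (h : Good l q σ 0 Y d) (hp : Par n l q σ) {f : Fin n → ℝ} {K : ℕ} {θ : ℝ}
    (hf : ∀ j, Bd q K θ (f j)) : Bd q (K + 1) θ (∑ j, eX σ Y j * f j) := by
  have h1 := h.sum_dg hp
  have hσ := hp.σ_pos
  have hq := hp.q_pos
  have h0 : (0 : ℝ) ≤ ∑ j, (dg Y j : ℝ) := Finset.sum_nonneg fun j _ => dg_nonneg Y j
  have hθ : 0 ≤ θ := by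
    have : Nonempty (Fin n) := by
      have := hp.n_pos
      exact ⟨⟨0, by exact_mod_cast this⟩⟩
    exact (hf (Classical.arbitrary _)).nonneg_scale hp.two_le
  unfold Bd at *
  rw [abs_of_nonneg (by positivity)] at h1
  calc _ ≤ ∑ j, |eX σ Y j * f j| := Finset.abs_sum_le_sum_abs _ _
    _ ≤ ∑ j, (dg Y j : ℝ) * σ ^ 2 * (q ^ K * θ) := by
      refine Finset.sum_le_sum fun j _ => ?_
      have h2 := dg_nonneg Y j
      unfold eX
      rw [abs_mul, abs_of_nonneg (by positivity)]
      exact mul_le_mul_of_nonneg_left (hf j) (by positivity)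
    _ = ((∑ j, (dg Y j : ℝ)) * σ ^ 2) * (q ^ K * θ) := by
      rw [← Finset.sum_mul, ← Finset.sum_mul]
    _ ≤ (q ^ 1 * σ ^ 0) * (q ^ K * θ) := by gcongr
    _ = _ := by ring

lemma sum_eS (l σ : ℝ) (Y : SimpleGraph (Fin n)) (d : Fin n → ℤ) :
    ∑ j, eS l σ Y d j = ∑ j, eX σ Y j * eD l σ Y d j := by
  unfold eS eX
  rw [← Finset.sum_mul, Finset.sum_comm, Finset.sum_mul]
  refine Finset.sum_congr rfl fun v _ => ?_
  have : ∑ c, (if Y.Adj c v then eD l σ Y d v else 0) = dg Y v * eD l σ Y d v := by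
    rw [dg_real, Finset.sum_mul]
    refine Finset.sum_congr rfl fun c _ => ?_
    simp only [Y.adj_comm c v]
    split_ifs <;> simp
  rw [this]; ring

/-- The part of `edgeTop` of second order. -/
def edgeQuad (l σ : ℝ) (Y : SimpleGraph (Fin n)) (d : Fin n → ℤ) (a v : Fin n) : ℝ :=
  (1 - 2 * l) * (l * (1 - l))⁻¹ * (eD l σ Y d a * eD l σ Y d v)
    + (eX σ Y a * eD l σ Y d a + eS l σ Y d a) + (eX σ Y v * eD l σ Y d v + eS l σ Y d v)
    - l * (∑ j, (dg Y j : ℝ)) * σ ^ 4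

lemma edgeTop_eq (l σ : ℝ) (Y : SimpleGraph (Fin n)) (d : Fin n → ℤ) (a v : Fin n) :
    edgeTop l σ Y d a v = l + eD l σ Y d a + eD l σ Y d v + edgeQuad l σ Y d a v := by
  unfold edgeTop edgeQuad; ring

lemma Par.bd_skew (hp : Par n l q σ) : Bd q 0 (σ ^ 0) (1 - 2 * l) := by
  refine Bd.of_abs_le (abs_le.2 ⟨?_, ?_⟩) <;> linarith [hp.l_pos, hp.l_lt]

lemma Good.bd_edgeQuad (h : Good l q σ 0 Y d) (hp : Par n l q σ) (a v : Fin n) :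
    Bd q 10 (σ ^ 2) (edgeQuad l σ Y d a v) := by
  have hq := hp.two_le
  have hr : (0 : ℝ) ≤ σ⁻¹ := (inv_pos.2 hp.σ_pos).le
  have b1 := (hp.bd_skew.pmul hp.inv_o).pmul ((h.bd_eD hp hr a).pmul (h.bd_eD hp hr v))
  have b2 := fun j => ((h.bd_eX hp hr j).pmul (h.bd_eD hp hr j)).add hq (h.bd_eS hp hr j)
  have b3 := hp.bd_l.pmul ((h.sum_dg hp).pmul (hp.bd_σ 2))
  exact (((b1.add hq (b2 a)).add hq (b2 v)).sub hq b3).cast hq (by unfold edgeQuad; ring)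
    (by norm_num) rfl

lemma edgeTop_sum (hp : Par n l q σ) (h : Good l q σ 0 Y d) (v : Fin n) :
    (∑ a, (if a ≠ v ∧ ¬ Y.Adj v a then edgeTop l σ Y d a v else 0) - d v) * σ ^ 2
      = (1 - 2 * l) * (l * (1 - l))⁻¹ * ((∑ a, eD l σ Y d a) * eD l σ Y d v) * σ ^ 2
        + (2 * ∑ a, eX σ Y a * eD l σ Y d a) * σ ^ 2 - 2 * (eD l σ Y d v * σ ^ 2)
        - edgeQuad l σ Y d v v * σ ^ 2
        - (∑ a, if Y.Adj v a then edgeQuad l σ Y d a v else 0) * σ ^ 2 := by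
  rw [sum_non_adj_fun]
  have e1 : ∑ a, eD l σ Y d a = l * (∑ j, (dg Y j : ℝ)) * σ ^ 2 := by
    have h1 := abs_nonpos_iff.1 h.total
    unfold eD
    rw [← Finset.sum_mul, Finset.sum_add_distrib, h1, ← Finset.mul_sum, zero_add]
  have e2 := deg_scale hp Y d v
  have e3 : (∑ a, if Y.Adj v a then edgeTop l σ Y d a v else 0)
      = (l + eD l σ Y d v) * dg Y v + (∑ a, if Y.Adj v a then eD l σ Y d a else 0)
        + ∑ a, if Y.Adj v a then edgeQuad l σ Y d a v else 0 := by
    rw [dg_real, Finset.mul_sum, ← Finset.sum_add_distrib, ← Finset.sum_add_distrib]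
    refine Finset.sum_congr rfl fun a _ => ?_
    rw [edgeTop_eq]
    split_ifs <;> ring
  have e4 : ∑ a, edgeTop l σ Y d a v = n * (l + eD l σ Y d v + (eX σ Y v * eD l σ Y d v
      + eS l σ Y d v) - l * (∑ j, (dg Y j : ℝ)) * σ ^ 4) + ∑ a, eD l σ Y d a
      + (1 - 2 * l) * (l * (1 - l))⁻¹ * ((∑ a, eD l σ Y d a) * eD l σ Y d v)
      + 2 * ∑ a, eX σ Y a * eD l σ Y d a := by
    have e5 := sum_eS l σ Y d
    have e6 : ∀ a, edgeTop l σ Y d a v = (l + eD l σ Y d v + (eX σ Y v * eD l σ Y d v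
      + eS l σ Y d v) - l * (∑ j, (dg Y j : ℝ)) * σ ^ 4) + eD l σ Y d a
      + ((1 - 2 * l) * (l * (1 - l))⁻¹ * eD l σ Y d v) * eD l σ Y d a
      + eX σ Y a * eD l σ Y d a + eS l σ Y d a := by
      intro a; unfold edgeTop; ring
    simp only [e6, Finset.sum_add_distrib, Finset.sum_const, Finset.card_univ, Fintype.card_fin,
      nsmul_eq_mul, e5, ← Finset.mul_sum]
    ring
  rw [e3, e4, edgeTop_eq l σ Y d v v]
  unfold eS
  unfold eX at *
  linear_combination -e2 + σ ^ 2 * e1 + (l + eD l σ Y d v + (dg Y v * σ ^ 2 * eD l σ Y d v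
      + (∑ a, if Y.Adj v a then eD l σ Y d a else 0) * σ ^ 2)
      - l * (∑ j, (dg Y j : ℝ)) * σ ^ 4) * hp.n_eq

lemma edgeTop_est (hp : Par n l q σ) :
    EdgeEst l q σ (edgeTop l σ) (n := n) 0 (q ^ 111 * σ ^ 3) := by
  intro Y d h b v hbv hb
  have hσ := hp.σ_pos
  have hq2 := hp.two_le
  have hr : (0 : ℝ) ≤ σ⁻¹ := (inv_pos.2 hp.σ_pos).le
  rcases (cnt_nonneg Y d).eq_or_lt with hN | hN
  · have h1 := ec_le (d := d) hbv hb
    have h2 := ec_nonneg Y d b v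
    have h3 : ec Y d b v = 0 := by linarith
    simp [← hN, h3]
  refine (edge_average hp h hr (Q := fun a => edgeTop l σ Y d a v) (μ := q ^ 109 * σ ^ 3) hbv
    (fun h => hb h.symm) ?_ ?_).trans (le_of_eq (by ring))
  · intro a hab hav ha
    exact edgeTop_diff hp h hN hab hav hbv (fun h => ha h.symm) hb
  · rw [edgeTop_sum hp h]
    have bD := h.bd_eD hp hr v
    have b1 := ((hp.bd_skew.pmul hp.inv_o).pmul ((h.bd_sum_eD hp hr).pmul bD)).pmul (hp.bd_σ 2)
    have b2 := (h.bd_sum_eX_mul hp (h.bd_eD hp hr)).pmul (hp.bd_σ 2)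
    have b3 := bD.pmul (hp.bd_σ 2)
    have b4 := hp.bd_pow ((h.bd_edgeQuad hp v v).pmul (hp.bd_σ 2)) (by norm_num : 3 ≤ 2 + 2)
    have b5 := h.bd_sum_adj hp hr v (fun a => h.bd_edgeQuad hp a v)
    have b6 := (((((b1.cast hq2 rfl le_rfl (by ring : _ = σ ^ 3)).add hq2
      ((b2.add hq2 b2).cast hq2 rfl le_rfl (by ring : _ = σ ^ 3))).sub hq2
      ((b3.add hq2 b3).cast hq2 rfl le_rfl (by ring : _ = σ ^ 3))).sub hq2 b4).sub hq2
      (b5.cast hq2 rfl le_rfl (by ring : _ = σ ^ 3)))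
    refine b6.cast hq2 ?_ (by norm_num) rfl
    ring

end Second

section Existence

variable {n : ℕ}

lemma exists_sum_dg (k : ℕ) (hk : 2 * (k : ℤ) ≤ n * (n - 1)) :
    ∃ H : SimpleGraph (Fin n), ∑ v, dg H v = 2 * k := by
  induction k with
  | zero => exact ⟨⊥, by simp [dg]⟩
  | succ k ih =>
    obtain ⟨H, hH⟩ := ih (by push_cast at hk; linarith)
    have h1 : ∃ a b, a ≠ b ∧ ¬ H.Adj a b := by
      by_contra! hc
      have h2 : ∀ v, dg H v = n - 1 := by
        intro v
        have h3 : ∀ u, (if H.Adj v u then (1 : ℤ) else 0) = 1 - if u = v then 1 else 0 := by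
          intro u
          by_cases h4 : u = v
          · subst h4; simp
          · simp [h4, hc v u (Ne.symm h4)]
        simp [dg, h3]
      simp only [h2, Finset.sum_const, Finset.card_univ, Fintype.card_fin, nsmul_eq_mul] at hH
      push_cast at hk
      linarith
    obtain ⟨a, b, hab, h⟩ := h1
    refine ⟨ad H a b, ?_⟩
    simp only [dg_ad hab h, Finset.sum_add_distrib, hH, uv, Finset.sum_pi_single', Finset.mem_univ,
      if_true]
    push_cast; ring

lemma exists_move {H : SimpleGraph (Fin n)} {a b : Fin n} (h : dg H b + 2 ≤ dg H a) :
    ∃ H' : SimpleGraph (Fin n), ∀ v, dg H' v = dg H v - uv a v + uv b v := by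
  have hab : a ≠ b := by rintro rfl; linarith
  have h1 : ∃ u, u ≠ b ∧ H.Adj a u ∧ ¬ H.Adj b u := by
    by_contra! hc
    have : dg H a ≤ dg H b + 1 := by
      have h2 : dg H b + 1 = ∑ u, ((if H.Adj b u then 1 else 0) + if u = b then 1 else 0) := by
        simp [dg, Finset.sum_add_distrib]
      rw [h2]
      refine Finset.sum_le_sum fun u _ => ?_
      by_cases h3 : u = b
      · subst h3; simp only [SimpleGraph.irrefl, if_true, if_false]; split_ifs <;> simp
      · by_cases h4 : H.Adj a u
        · simp [h3, h4, hc u h3 h4]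
        · simp only [h4, h3, if_false]; split_ifs <;> simp
    linarith
  obtain ⟨u, hub, hau, hbu⟩ := h1
  have h2 : ¬ (H \ SimpleGraph.edge a u).Adj b u := fun h => hbu ((SimpleGraph.sdiff_adj ..).1 h).1
  refine ⟨ad (H \ SimpleGraph.edge a u) b u, fun v => ?_⟩
  rw [dg_ad hub.symm h2, dg_sdiff hau]
  ring

lemma exists_balanced (k : ℕ) (hk : 2 * (k : ℤ) ≤ n * (n - 1)) :
    ∃ H : SimpleGraph (Fin n), ∑ v, dg H v = 2 * k ∧ ∀ a b, dg H a ≤ dg H b + 1 := by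
  obtain ⟨H0, hH0⟩ := exists_sum_dg k hk
  obtain ⟨H, hH, hmin⟩ := Finset.exists_min_image
    (univ.filter fun H : SimpleGraph (Fin n) => ∑ v, dg H v = 2 * k) (fun H => ∑ v, dg H v ^ 2)
    ⟨H0, by simpa using hH0⟩
  have hs : ∑ v, dg H v = 2 * k := by simpa using hH
  refine ⟨H, hs, fun a b => ?_⟩
  by_contra! hc
  have hab : a ≠ b := by rintro rfl; linarith
  obtain ⟨H', hH'⟩ := exists_move (show dg H b + 2 ≤ dg H a by linarith)
  have h1 := hmin H' (by simp [hH', Finset.sum_add_distrib, Finset.sum_sub_distrib, hs])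
  have h2 : ∀ v, dg H' v ^ 2 = dg H v ^ 2 + (if v = a then 1 - 2 * dg H a else 0)
      + (if v = b then 1 + 2 * dg H b else 0) := by
    intro v
    rw [hH']
    by_cases hva : v = a
    · subst hva; simp [hab]; ring
    · by_cases hvb : v = b
      · subst hvb; simp [hab.symm]; ring
      · simp [hva, hvb]
  simp only [h2, Finset.sum_add_distrib, Finset.sum_ite_eq', Finset.mem_univ, if_true] at h1
  linarith

lemma exists_of_cnt_pos {Y : SimpleGraph (Fin n)} {d : Fin n → ℤ} (h : 0 < cnt Y d) :
    ∃ H : SimpleGraph (Fin n), ∀ v, dg H v = d v := by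
  obtain ⟨H, hH⟩ := Finset.card_pos.1 (Nat.cast_pos.1 h)
  exact ⟨H, (mem_cls.1 hH).1⟩

lemma cnt_bot_pos_iff {d : Fin n → ℤ} :
    0 < cnt ⊥ d ↔ ∃ H : SimpleGraph (Fin n), ∀ v, dg H v = d v := by
  refine ⟨exists_of_cnt_pos, fun ⟨H, hH⟩ => Nat.cast_pos.2 (Finset.card_pos.2 ⟨H, ?_⟩)⟩
  exact mem_cls.2 ⟨hH, fun _ _ _ h => h⟩

variable {l q σ : ℝ} {d : Fin n → ℤ}

lemma cnt_bot_pos (hp : Par n l q σ) (h : Good l q σ 0 ⊥ d) (he : Even (∑ j, d j)) :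
    0 < cnt ⊥ d := by
  have hq := hp.two_le
  have hs := inv_pos.2 hp.σ_pos
  have hi : 1 ≤ σ⁻¹ := (one_le_inv₀ hp.σ_pos).2 hp.σ_le
  have hn := hp.n_pos
  have htot : ∑ j, (d j : ℝ) = n * (l * (n - 1)) := by
    have := abs_nonpos_iff.1 h.total
    rw [Finset.sum_sub_distrib] at this
    simp at this
    linarith
  have hn1 : (1 : ℝ) ≤ n := by
    have : 0 < n := by exact_mod_cast hn
    exact_mod_cast this
  obtain ⟨k, hk⟩ : ∃ k : ℕ, ∑ j, d j = 2 * k := by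
    obtain ⟨m, hm⟩ := he
    have : 0 ≤ m := by
      have h1 : (0 : ℝ) ≤ ∑ j, (d j : ℝ) := by
        rw [htot]; exact mul_nonneg hn.le (mul_nonneg hp.l_pos.le (by linarith))
      have h2 : (0 : ℤ) ≤ ∑ j, d j := by exact_mod_cast h1
      linarith
    lift m to ℕ using this
    exact ⟨m, by rw [hm]; ring⟩
  have hk' : ∑ j, (d j : ℝ) = 2 * k := by exact_mod_cast hk
  obtain ⟨H0, hH0, hb0⟩ := exists_balanced (n := n) k (by
    have h1 : (2 : ℝ) * k ≤ n * (n - 1) := by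
      rw [← hk', htot]
      have : l * (n - 1) ≤ n - 1 := mul_le_of_le_one_left (by linarith) hp.l_lt.le
      gcongr
    exact_mod_cast h1)
  have hbox0 : ∀ v, |(dg H0 v : ℝ) - l * (n - 1)| ≤ q * σ⁻¹ := by
    intro v
    have h1 : ∑ j, (dg H0 j : ℝ) = n * (l * (n - 1)) := by
      rw [← htot, hk']; exact_mod_cast hH0
    have h2 : (n : ℝ) * (dg H0 v - 1) ≤ ∑ j, (dg H0 j : ℝ) := by
      have := Finset.card_nsmul_le_sum (univ : Finset (Fin n)) (fun j => (dg H0 j : ℝ))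
        (dg H0 v - 1) (fun j _ => by
          have : (dg H0 v : ℝ) ≤ dg H0 j + 1 := by exact_mod_cast hb0 v j
          linarith)
      simpa using this
    have h3 : ∑ j, (dg H0 j : ℝ) ≤ (n : ℝ) * (dg H0 v + 1) := by
      have := Finset.sum_le_card_nsmul (univ : Finset (Fin n)) (fun j => (dg H0 j : ℝ))
        (dg H0 v + 1) (fun j _ => by exact_mod_cast hb0 j v)
      simpa [mul_add] using this
    rw [h1] at h2 h3
    have h4 := le_of_mul_le_mul_left h2 hn
    have h5 := le_of_mul_le_mul_left h3 hn
    rw [abs_le]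
    constructor <;> nlinarith
  obtain ⟨H, hH, hmin⟩ := Finset.exists_min_image
    (univ.filter fun H : SimpleGraph (Fin n) => ∑ v, dg H v = 2 * k ∧
      ∀ v, |(dg H v : ℝ) - l * (n - 1)| ≤ q * σ⁻¹) (fun H => ∑ v, |dg H v - d v|)
    ⟨H0, by simpa using ⟨hH0, hbox0⟩⟩
  obtain ⟨hs, hbox⟩ : ∑ v, dg H v = 2 * k ∧ ∀ v, |(dg H v : ℝ) - l * (n - 1)| ≤ q * σ⁻¹ := by
    simpa using hH
  rw [cnt_bot_pos_iff]
  refine ⟨H, ?_⟩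
  by_contra hne
  have hsum : ∑ v, dg H v = ∑ v, d v := by rw [hs, hk]
  obtain ⟨a, ha⟩ : ∃ a, dg H a < d a := by
    by_contra! hc
    refine hne fun v => ?_
    exact ((Finset.sum_eq_sum_iff_of_le fun i _ => hc i).1 hsum.symm v (Finset.mem_univ _)).symm
  obtain ⟨b, hb⟩ : ∃ b, d b < dg H b := by
    by_contra! hc
    refine hne fun v => ?_
    exact (Finset.sum_eq_sum_iff_of_le fun i _ => hc i).1 hsum v (Finset.mem_univ _)
  have hab : a ≠ b := by rintro rfl; linarith
  set c : Fin n → ℤ := fun v => dg H v + uv a v - uv b v with hc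
  have hcbox : ∀ v, |(c v : ℝ) - l * (n - 1)| ≤ q * σ⁻¹ := by
    intro v
    have h1 := abs_le.1 (hbox v)
    have h2 : |(d v : ℝ) - l * (n - 1)| ≤ q * σ⁻¹ := by simpa using h.deg v
    have h2 := abs_le.1 h2
    by_cases hva : v = a
    · subst hva
      have e1 : c v = dg H v + 1 := by simp [hc, hab]
      have h3 : (dg H v : ℝ) + 1 ≤ d v := by exact_mod_cast ha
      rw [e1, abs_le]; push_cast
      constructor <;> linarith
    · by_cases hvb : v = b
      · subst hvb
        have e1 : c v = dg H v - 1 := by simp [hc, hab.symm]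
        have h3 : (d v : ℝ) ≤ dg H v - 1 := by
          have : d v ≤ dg H v - 1 := by linarith
          exact_mod_cast this
        rw [e1, abs_le]; push_cast
        constructor <;> linarith
      · have e1 : c v = dg H v := by simp [hc, hva, hvb]
        rw [e1]; exact hbox v
  have hcsum : ∑ v, c v = 2 * k := by
    simp [hc, Finset.sum_add_distrib, Finset.sum_sub_distrib, hs]
  have hg : Good l q σ 0 (⊥ : SimpleGraph (Fin n)) c := by
    refine ⟨by simpa using hcbox, h.forb, h.edges, ?_⟩
    have h1 : ∑ v, (c v : ℝ) = 2 * k := by exact_mod_cast hcsum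
    rw [Finset.sum_sub_distrib, h1, ← hk', htot]
    simp
  have h1 := shift_le hp hg (by linarith) hab
  have h2 : c - uv a + uv b = dg H := by
    funext v; simp only [hc, Pi.add_apply, Pi.sub_apply]; ring
  rw [h2] at h1
  have h3 : 0 < cnt ⊥ (dg H) := cnt_bot_pos_iff.2 ⟨H, fun _ => rfl⟩
  have h4 : 0 < cnt ⊥ c := by
    by_contra h5
    have : 0 < q ^ 4 := by positivity
    nlinarith
  obtain ⟨H', hH'⟩ := exists_of_cnt_pos h4
  have h5 := hmin H' (by simpa [hH'] using ⟨hcsum, hcbox⟩)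
  have h6 : ∀ v, |dg H' v - d v| = |dg H v - d v| - (if v = a then 1 else 0)
      - (if v = b then 1 else 0) := by
    intro v
    rw [hH']
    by_cases hva : v = a
    · subst hva
      have e1 : c v = dg H v + 1 := by simp [hc, hab]
      rw [e1, abs_of_nonpos (by linarith), abs_of_neg (by linarith)]
      simp [hab]; ring
    · by_cases hvb : v = b
      · subst hvb
        have e1 : c v = dg H v - 1 := by simp [hc, hab.symm]
        rw [e1, abs_of_nonneg (by linarith), abs_of_pos (by linarith)]
        simp [hab.symm]; ring
      · have e1 : c v = dg H v := by simp [hc, hva, hvb]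
        rw [e1]; simp [hva, hvb]
  simp only [h6, Finset.sum_sub_distrib, Finset.sum_ite_eq', Finset.mem_univ, if_true] at h5
  linarith

end Existence

section Increment

variable {n : ℕ} {l q σ : ℝ} {Y : SimpleGraph (Fin n)} {d : Fin n → ℤ} {a b : Fin n}

/-- The quadratic form of the adjacency matrix of `Y`. -/
def adjForm (Y : SimpleGraph (Fin n)) (f : Fin n → ℝ) : ℝ :=
  ∑ j, ∑ k, if Y.Adj j k then f j * f k else 0

lemma adjForm_ad (hab : a ≠ b) (h : ¬ Y.Adj a b) (f : Fin n → ℝ) :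
    adjForm (ad Y a b) f = adjForm Y f + 2 * (f a * f b) := by
  have h' : ¬ Y.Adj b a := fun hh => h hh.symm
  have h1 : ∀ j k, (if (ad Y a b).Adj j k then f j * f k else 0)
      = (if Y.Adj j k then f j * f k else 0)
        + (if k = b then (if j = a then f a * f b else 0) else 0)
        + (if k = a then (if j = b then f a * f b else 0) else 0) := by
    intro j k
    simp only [ad_adj Y hab]
    by_cases h1 : j = a
    · subst h1
      by_cases h2 : k = b
      · subst h2; simp [h, hab]
      · simp [h2, hab]
    · by_cases h3 : j = b
      · subst h3
        by_cases h2 : k = a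
        · subst h2; simp [h', hab.symm, mul_comm]
        · simp [h2, hab.symm]
      · simp [h1, h3]
  have h2 : adjForm (ad Y a b) f = ∑ j, ∑ k, ((if Y.Adj j k then f j * f k else 0)
        + (if k = b then (if j = a then f a * f b else 0) else 0)
        + (if k = a then (if j = b then f a * f b else 0) else 0)) := by
    unfold adjForm
    refine Finset.sum_congr rfl fun j _ => Finset.sum_congr rfl fun k _ => ?_
    rw [← h1]
    congr!
  rw [h2]
  unfold adjForm
  simp only [Finset.sum_add_distrib, Finset.sum_ite_eq', Finset.mem_univ, if_true]
  ring

lemma adjForm_add_single (Y : SimpleGraph (Fin n)) (f : Fin n → ℝ) (a : Fin n) (c : ℝ) :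
    adjForm Y (fun j => f j + if j = a then c else 0)
      = adjForm Y f + 2 * c * ∑ k, if Y.Adj a k then f k else 0 := by
  have h1 : ∀ j k, (if Y.Adj j k then (f j + if j = a then c else 0) * (f k + if k = a then c else 0)
      else 0) = (if Y.Adj j k then f j * f k else 0)
        + (if j = a then c * (if Y.Adj a k then f k else 0) else 0)
        + (if k = a then c * (if Y.Adj a j then f j else 0) else 0) := by
    intro j k
    by_cases h1 : j = a
    · subst h1
      by_cases h2 : k = j
      · subst h2; simp
      · by_cases h3 : Y.Adj j k <;> simp [h2, h3]; ring
    · by_cases h2 : k = a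
      · subst h2
        by_cases h3 : Y.Adj j k
        · simp [h1, h3, h3.symm]; ring
        · have h4 : ¬ Y.Adj k j := fun hh => h3 hh.symm
          simp [h1, h3, h4]
      · simp [h1, h2]
  have h2 : ∀ j, ∑ k, (if j = a then c * (if Y.Adj a k then f k else 0) else 0)
      = if j = a then c * ∑ k, (if Y.Adj a k then f k else 0) else 0 := by
    intro j
    split_ifs
    · rw [Finset.mul_sum]
    · simp
  unfold adjForm
  simp only [h1, Finset.sum_add_distrib, h2, Finset.sum_ite_eq', Finset.mem_univ, if_true,
    ← Finset.mul_sum]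
  ring

/-- The excess degree of a vertex. -/
def exDeg (l : ℝ) (Y : SimpleGraph (Fin n)) (d : Fin n → ℤ) (j : Fin n) : ℝ :=
  (d j : ℝ) - l * (n - 1) + l * dg Y j

/-- The contribution of a vertex to `missExp`. -/
def vertexExp (l σ x δ : ℝ) : ℝ :=
  l * (1 - l)⁻¹ * x ^ 2 * σ ^ 2 / 2 + l * (1 - 2 * l) * (1 - l)⁻¹ ^ 2 * x ^ 3 * σ ^ 4 / 6
    - (1 - l)⁻¹ * (δ * x) * σ ^ 2 - (1 - 2 * l) * (1 - l)⁻¹ ^ 2 * (δ * x ^ 2) * σ ^ 4 / 2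
    - (1 - l)⁻¹ ^ 2 * (δ ^ 2 * x) * σ ^ 4 / 2

/-- The exponent in the asymptotic formula for the probability of avoiding `Y`. -/
def missExp (l σ : ℝ) (Y : SimpleGraph (Fin n)) (d : Fin n → ℤ) : ℝ :=
  l * (1 - l)⁻¹ * ((∑ j, (dg Y j : ℝ)) / 2) * σ ^ 2
    + l * (1 - l)⁻¹ * ((∑ j, (dg Y j : ℝ)) / 2) ^ 2 * σ ^ 4
    - l⁻¹ * (1 - l)⁻¹ * (adjForm Y (exDeg l Y d) / 2) * σ ^ 4
    + ∑ j, vertexExp l σ (dg Y j) (exDeg l Y d j)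

lemma sum_dg_ad (hab : a ≠ b) (h : ¬ Y.Adj a b) :
    ∑ j, (dg (ad Y a b) j : ℝ) = ∑ j, (dg Y j : ℝ) + 2 := by
  have : ∑ j, dg (ad Y a b) j = ∑ j, dg Y j + 2 := by
    simp only [dg_ad hab h, Finset.sum_add_distrib, uv, Finset.sum_pi_single', Finset.mem_univ,
      if_true]
    ring
  exact_mod_cast this

lemma dg_ad_real (hab : a ≠ b) (h : ¬ Y.Adj a b) (j : Fin n) :
    (dg (ad Y a b) j : ℝ) = dg Y j + (if j = a then 1 else 0) + (if j = b then 1 else 0) := by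
  rw [dg_ad hab h]
  simp [Pi.single_apply]

lemma missExp_ad (hab : a ≠ b) (h : ¬ Y.Adj a b) :
    missExp l σ (ad Y a b) d - missExp l σ Y d
      = l * (1 - l)⁻¹ * σ ^ 2 + l * (1 - l)⁻¹ * (∑ j, (dg Y j : ℝ) + 1) * σ ^ 4
        - l⁻¹ * (1 - l)⁻¹ * (l * (∑ k, if Y.Adj a k then exDeg l Y d k else 0)
          + l * (∑ k, if Y.Adj b k then exDeg l Y d k else 0)
          + (exDeg l Y d a + l) * (exDeg l Y d b + l)) * σ ^ 4
        + (vertexExp l σ (dg Y a + 1) (exDeg l Y d a + l)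
          - vertexExp l σ (dg Y a) (exDeg l Y d a))
        + (vertexExp l σ (dg Y b + 1) (exDeg l Y d b + l)
          - vertexExp l σ (dg Y b) (exDeg l Y d b)) := by
  have h' : ¬ Y.Adj b a := fun hh => h hh.symm
  have e1 : exDeg l (ad Y a b) d = fun j => (exDeg l Y d j + if j = a then l else 0)
      + if j = b then l else 0 := by
    funext j
    unfold exDeg
    rw [dg_ad_real hab h]
    split_ifs <;> ring
  have e2 : adjForm (ad Y a b) (exDeg l (ad Y a b) d) = adjForm Y (exDeg l Y d)
      + 2 * l * (∑ k, if Y.Adj a k then exDeg l Y d k else 0)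
      + 2 * l * (∑ k, if Y.Adj b k then exDeg l Y d k else 0)
      + 2 * ((exDeg l Y d a + l) * (exDeg l Y d b + l)) := by
    rw [adjForm_ad hab h, e1, adjForm_add_single, adjForm_add_single]
    have e3 : ∀ k, (if Y.Adj b k then exDeg l Y d k + (if k = a then l else 0) else 0)
        = if Y.Adj b k then exDeg l Y d k else 0 := by
      intro k
      by_cases hk : k = a
      · subst hk; simp [h']
      · simp [hk]
    simp only [e3, hab, hab.symm, if_true, if_false]
    ring
  have e4 : ∑ j, vertexExp l σ (dg (ad Y a b) j) (exDeg l (ad Y a b) d j)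
      = ∑ j, vertexExp l σ (dg Y j) (exDeg l Y d j)
        + (vertexExp l σ (dg Y a + 1) (exDeg l Y d a + l)
          - vertexExp l σ (dg Y a) (exDeg l Y d a))
        + (vertexExp l σ (dg Y b + 1) (exDeg l Y d b + l)
          - vertexExp l σ (dg Y b) (exDeg l Y d b)) := by
    have e5 : ∀ j, vertexExp l σ (dg (ad Y a b) j) (exDeg l (ad Y a b) d j)
        = vertexExp l σ (dg Y j) (exDeg l Y d j)
        + (if j = a then vertexExp l σ (dg Y a + 1) (exDeg l Y d a + l)
          - vertexExp l σ (dg Y a) (exDeg l Y d a) else 0)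
        + (if j = b then vertexExp l σ (dg Y b + 1) (exDeg l Y d b + l)
          - vertexExp l σ (dg Y b) (exDeg l Y d b) else 0) := by
      intro j
      rw [dg_ad_real hab h, e1]
      by_cases h1 : j = a
      · subst h1; simp [hab]
      · by_cases h2 : j = b
        · subst h2; simp [hab.symm]
        · simp [h1, h2]
    simp only [e5, Finset.sum_add_distrib, Finset.sum_ite_eq', Finset.mem_univ, if_true]
  unfold missExp
  rw [e2, e4, sum_dg_ad hab h]
  ring

lemma missExp_ad_eq (hl : l ≠ 0) (hl' : 1 - l ≠ 0) (hab : a ≠ b) (h : ¬ Y.Adj a b) :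
    missExp l σ (ad Y a b) d - missExp l σ Y d
      + (1 - l)⁻¹ * (edgeTop l σ Y d a b - l) + ((1 - l)⁻¹ * (edgeTop l σ Y d a b - l)) ^ 2 / 2
      = (1 - l)⁻¹ ^ 2 * ((-(l * (1 - l)) / 2) * ((eX σ Y a + eX σ Y b) * σ ^ 2)
          + (-1 / 2 - (1 - l)) * ((eD l σ Y d a + eD l σ Y d b) * σ ^ 2)
          + (-2 * l / 3 + l ^ 2 / 3) * (σ ^ 2 * σ ^ 2)
          + (eD l σ Y d a + eD l σ Y d b) * edgeQuad l σ Y d a b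
          + edgeQuad l σ Y d a b * edgeQuad l σ Y d a b / 2) := by
  rw [missExp_ad hab h, edgeTop_eq]
  have e1 : ∀ c, eS l σ Y d c = (∑ k, if Y.Adj c k then exDeg l Y d k else 0) * σ ^ 4 := by
    intro c
    unfold eS eD
    have : ∀ v, (if Y.Adj c v then ((d v : ℝ) - l * (n - 1) + l * dg Y v) * σ ^ 2 else 0)
        = (if Y.Adj c v then exDeg l Y d v else 0) * σ ^ 2 := by
      intro v; unfold exDeg; split_ifs <;> ring
    simp only [this, ← Finset.sum_mul]
    ring
  have e2 : ∀ c, eD l σ Y d c = exDeg l Y d c * σ ^ 2 := fun c => rfl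
  unfold edgeQuad eX vertexExp
  simp only [e1, e2]
  generalize exDeg l Y d a = Da
  generalize exDeg l Y d b = Db
  generalize (dg Y a : ℝ) = xa
  generalize (dg Y b : ℝ) = xb
  generalize (∑ k, if Y.Adj a k then exDeg l Y d k else 0) = Sa
  generalize (∑ k, if Y.Adj b k then exDeg l Y d k else 0) = Sb
  generalize (∑ j, (dg Y j : ℝ)) = T
  field_simp
  ring

lemma missExp_ad_est (hp : Par n l q σ) (h : Good l q σ 0 Y d) (hab : a ≠ b) (hY : ¬ Y.Adj a b) :
    Bd q 30 (σ ^ 3) (missExp l σ (ad Y a b) d - missExp l σ Y d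
      + (1 - l)⁻¹ * (edgeTop l σ Y d a b - l)
      + ((1 - l)⁻¹ * (edgeTop l σ Y d a b - l)) ^ 2 / 2) := by
  have hq := hp.two_le
  have hr : (0 : ℝ) ≤ σ⁻¹ := (inv_pos.2 hp.σ_pos).le
  have h0 := hp.l_pos
  have h1 := hp.l_lt
  rw [missExp_ad_eq h0.ne' (by linarith) hab hY]
  have bx := (h.bd_eX hp hr a).add hq (h.bd_eX hp hr b)
  have bD := (h.bd_eD hp hr a).add hq (h.bd_eD hp hr b)
  have bR := h.bd_edgeQuad hp a b
  have c1 : Bd q 0 (σ ^ 0) (-(l * (1 - l)) / 2) :=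
    Bd.of_abs_le (abs_le.2 ⟨by nlinarith, by nlinarith⟩)
  have c2 : Bd q 1 (σ ^ 0) (-1 / 2 - (1 - l)) := by
    unfold Bd
    rw [abs_le]
    constructor <;> simp <;> linarith
  have c3 : Bd q 0 (σ ^ 0) (-2 * l / 3 + l ^ 2 / 3) :=
    Bd.of_abs_le (abs_le.2 ⟨by nlinarith, by nlinarith⟩)
  have ch : Bd q 0 (σ ^ 0) (1 / 2 : ℝ) := Bd.of_abs_le (by norm_num [abs_le])
  have t1 := c1.pmul (bx.pmul (hp.bd_σ 2))
  have t2 := c2.pmul (bD.pmul (hp.bd_σ 2))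
  have t3 := hp.bd_pow (c3.pmul ((hp.bd_σ 2).pmul (hp.bd_σ 2))) (by norm_num : 3 ≤ 0 + (2 + 2))
  have t4 := bD.pmul bR
  have t5 := hp.bd_pow (ch.pmul (bR.pmul bR)) (by norm_num : 3 ≤ 0 + (2 + 2))
  have t6 := (((t1.add hq (t2.cast hq rfl le_rfl (by ring))).add hq
    (t3.cast hq rfl le_rfl (by ring))).add hq (t4.cast hq rfl le_rfl (by ring))).add hq
    (t5.cast hq rfl le_rfl (by ring))
  refine ((hp.inv_l'.pmul hp.inv_l').pmul t6).cast hq ?_ (by norm_num) (by ring)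
  ring

lemma log_one_sub_est {u : ℝ} (hu : |u| ≤ 1 / 2) :
    |Real.log (1 - u) + u + u ^ 2 / 2| ≤ 2 * |u| ^ 3 := by
  have h1 := Real.abs_log_sub_add_sum_range_le (show |u| < 1 by linarith) 2
  simp only [Finset.sum_range_succ, Finset.sum_range_zero] at h1
  norm_num at h1
  have e : Real.log (1 - u) + u + u ^ 2 / 2 = u + u ^ 2 / 2 + Real.log (1 - u) := by ring
  rw [e]
  refine h1.trans ?_
  rw [div_le_iff₀ (by linarith)]
  nlinarith [pow_nonneg (abs_nonneg u) 3]

lemma log_cnt_ad (hp : Par n l q σ) (h : Good l q σ 0 Y d) (hN : 0 < cnt Y d) (hab : a ≠ b)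
    (hY : ¬ Y.Adj a b) :
    0 < cnt (ad Y a b) d ∧
      |Real.log (cnt (ad Y a b) d) - Real.log (cnt Y d) - Real.log (1 - l)
        - (missExp l σ (ad Y a b) d - missExp l σ Y d)| ≤ q ^ 360 * σ ^ 3 := by
  have hq := hp.two_le
  have hσ := hp.σ_pos
  have hr : (0 : ℝ) ≤ σ⁻¹ := (inv_pos.2 hp.σ_pos).le
  have h0 := hp.l_pos
  have h1 := hp.l_lt
  set p := ec Y d a b / cnt Y d with hpd
  set t := edgeTop l σ Y d a b with ht
  set o := (1 - l)⁻¹ with ho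
  have ho1 : o * (1 - l) = 1 := inv_mul_cancel₀ (by linarith)
  have b1 : Bd q 111 (σ ^ 3) (p - t) := (rel_iff hN).1 (edgeTop_est hp Y d h a b hab hY)
  have b2 : Bd q 111 (σ ^ 1) (p - t) := hp.bd_pow b1 (by norm_num)
  have bt : Bd q 12 (σ ^ 1) (t - l) := by
    have b3 := hp.bd_pow (h.bd_edgeQuad hp a b) (by norm_num : 1 ≤ 2)
    refine (((h.bd_eD hp hr a).add hq (h.bd_eD hp hr b)).add hq b3).cast hq ?_ (by norm_num) rfl
    rw [ht, edgeTop_eq]; ring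
  have bu' : Bd q 14 (σ ^ 1) (o * (t - l)) :=
    (hp.inv_l'.pmul bt).cast hq rfl (by norm_num) (by norm_num)
  have bd : Bd q 112 (σ ^ 3) (o * (p - t)) :=
    (hp.inv_l'.pmul b1).cast hq rfl (by norm_num) (by norm_num)
  have bu : Bd q 114 (σ ^ 1) (o * (p - l)) :=
    (bu'.add hq (hp.inv_l'.pmul b2)).cast hq (by ring) (by norm_num) rfl
  set u := o * (p - l) with hu
  set u' := o * (t - l) with hu'
  have hu2 : |u| ≤ 1 / 2 := by
    refine bu.trans ?_
    have h2 := hp.small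
    have h3 : q ^ 114 * q ≤ q ^ 400 := by
      rw [← pow_succ]; exact pow_le_pow_right₀ (by linarith) (by norm_num)
    have h4 : 0 ≤ q ^ 114 * σ := by positivity
    rw [pow_one]
    nlinarith [mul_le_mul_of_nonneg_right h3 hσ.le]
  have hsplit : cnt (ad Y a b) d = cnt Y d * ((1 - l) * (1 - u)) := by
    have h2 := cnt_split hab hY d
    have h3 : (1 - l) * (1 - u) = 1 - p := by
      rw [hu]; linear_combination -(p - l) * ho1
    rw [h3, hpd]
    unfold ec
    field_simp
    linarith
  have hu1 : 0 < 1 - u := by linarith [(abs_le.1 hu2).2]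
  have hl1 : 0 < 1 - l := by linarith
  have hpos : 0 < cnt (ad Y a b) d := by rw [hsplit]; positivity
  refine ⟨hpos, ?_⟩
  have e1 : Real.log (cnt (ad Y a b) d) - Real.log (cnt Y d) - Real.log (1 - l)
      = Real.log (1 - u) := by
    rw [hsplit, Real.log_mul hN.ne' (by positivity), Real.log_mul hl1.ne' hu1.ne']
    ring
  have b4 : Bd q 343 (σ ^ 3) (Real.log (1 - u) + u + u ^ 2 / 2) := by
    have h2 := log_one_sub_est hu2
    have h3 : |u| ^ 3 ≤ (q ^ 114 * σ ^ 1) ^ 3 := pow_le_pow_left₀ (abs_nonneg _) bu 3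
    unfold Bd
    calc _ ≤ 2 * (q ^ 114 * σ ^ 1) ^ 3 := h2.trans (by gcongr)
      _ ≤ q * (q ^ 114 * σ ^ 1) ^ 3 := by gcongr
      _ = _ := by ring
  have b5 := missExp_ad_est hp h hab hY
  have ch : Bd q 0 (σ ^ 0) (1 / 2 : ℝ) := Bd.of_abs_le (by norm_num [abs_le])
  have b6 := hp.bd_pow ((bd.pmul (bu.add hq bu')).pmul ch) (by norm_num : 3 ≤ 3 + 1 + 0)
  have b7 := ((b4.sub hq b5).sub hq bd).sub hq b6
  have b8 : Bd q 360 (σ ^ 3) (Real.log (1 - u) - (missExp l σ (ad Y a b) d - missExp l σ Y d)) := by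
    refine b7.cast hq ?_ (by norm_num) rfl
    have : u = u' + o * (p - t) := by rw [hu, hu']; ring
    rw [this]; ring
  rw [e1]
  exact b8

lemma Good.of_ad (hab : a ≠ b) (hY : ¬ Y.Adj a b) (h : Good l q σ 0 (ad Y a b) d) :
    Good l q σ 0 Y d := by
  have h1 : ∀ j, (dg Y j : ℝ) ≤ dg (ad Y a b) j := by
    intro j
    rw [dg_ad_real hab hY]
    split_ifs <;> linarith
  exact ⟨h.deg, fun j => (h1 j).trans (h.forb j),
    (Finset.sum_le_sum fun j _ => h1 j).trans h.edges, h.total⟩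

lemma missExp_bot : missExp l σ (⊥ : SimpleGraph (Fin n)) d = 0 := by
  simp [missExp, vertexExp, adjForm, dg]

lemma log_cnt (hp : Par n l q σ) (he : Even (∑ j, d j)) (k : ℕ) :
    ∀ Y : SimpleGraph (Fin n), ∑ j, dg Y j = 2 * k → Good l q σ 0 Y d →
      0 < cnt Y d ∧ |Real.log (cnt Y d) - Real.log (cnt ⊥ d) - k * Real.log (1 - l)
        - missExp l σ Y d| ≤ k * (q ^ 360 * σ ^ 3) := by
  induction k with
  | zero =>
    intro Y hk h
    have hY : Y = ⊥ := by
      rw [eq_bot_iff]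
      intro a b hab
      obtain ⟨h1, h2⟩ := dg_eq_of_sdiff hab
      have h3 := sum_dg_ad hab.ne h2
      rw [h1] at h3
      have h4 : (0 : ℝ) ≤ ∑ j, (dg (Y \ SimpleGraph.edge a b) j : ℝ) :=
        Finset.sum_nonneg fun j _ => dg_nonneg _ j
      have h5 : ∑ j, (dg Y j : ℝ) = 0 := by exact_mod_cast hk
      linarith
    subst hY
    exact ⟨cnt_bot_pos hp h he, by simp [missExp_bot]⟩
  | succ k ih =>
    intro Y hk h
    obtain ⟨a, b, hab⟩ : ∃ a b, Y.Adj a b := by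
      by_contra! hc
      have : ∑ j, dg Y j = 0 := by simp [dg, hc]
      rw [this] at hk
      push_cast at hk
      linarith
    obtain ⟨h1, h2⟩ := dg_eq_of_sdiff hab
    set Z := Y \ SimpleGraph.edge a b with hZ
    rw [← h1] at h hk ⊢
    have hg := Good.of_ad hab.ne h2 h
    have h3 : ∑ j, dg Z j = 2 * k := by
      have h4 := sum_dg_ad hab.ne h2
      have h5 : ∑ j, dg (ad Z a b) j = ∑ j, dg Z j + 2 := by exact_mod_cast h4
      push_cast at hk
      linarith
    obtain ⟨h4, h5⟩ := ih Z h3 hg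
    obtain ⟨h6, h7⟩ := log_cnt_ad hp hg h4 hab.ne h2
    refine ⟨h6, ?_⟩
    push_cast
    calc _ = |(Real.log (cnt Z d) - Real.log (cnt ⊥ d) - k * Real.log (1 - l) - missExp l σ Z d)
          + (Real.log (cnt (ad Z a b) d) - Real.log (cnt Z d) - Real.log (1 - l)
          - (missExp l σ (ad Z a b) d - missExp l σ Z d))| := by congr 1; ring
      _ ≤ k * (q ^ 360 * σ ^ 3) + q ^ 360 * σ ^ 3 :=
        (abs_add_le _ _).trans (add_le_add h5 h7)
      _ = _ := by ring

end Increment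

section Bridge

variable {n : ℕ}

lemma dg_eq_card (H : SimpleGraph (Fin n)) (v : Fin n) : dg H v = Nat.card (H.neighborSet v) := by
  rw [Nat.card_eq_fintype_card, SimpleGraph.card_neighborSet_eq_degree,
    ← SimpleGraph.card_neighborFinset_eq_degree, SimpleGraph.neighborFinset_eq_filter,
    Finset.card_filter]
  unfold dg
  push_cast
  congr!

lemma sum_dg_eq (H : SimpleGraph (Fin n)) : ∑ v, dg H v = 2 * (xEdges H : ℤ) := by
  have h1 := H.sum_degrees_eq_twice_card_edges
  have h2 : xEdges H = H.edgeFinset.card := by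
    unfold xEdges
    rw [Nat.card_eq_fintype_card, SimpleGraph.edgeFinset_card]
  rw [h2]
  have h3 : ∀ v, dg H v = (H.degree v : ℤ) := by
    intro v
    rw [dg_eq_card, Nat.card_eq_fintype_card, SimpleGraph.card_neighborSet_eq_degree]
  simp only [h3]
  exact_mod_cast h1

lemma gCount_eq (d : Fin n → ℕ) (X : SimpleGraph (Fin n)) :
    (gCount d X : ℝ) = cnt X (fun j => (d j : ℤ)) := by
  unfold gCount cnt cls
  rw [Nat.card_eq_fintype_card, Fintype.card_subtype]
  congr 2
  ext H
  simp only [Finset.mem_filter, Finset.mem_univ, true_and, dg_eq_card, Nat.cast_inj]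
  refine and_congr_right fun _ => ?_
  rw [Set.disjoint_left]
  constructor
  · intro h i j hij hX
    exact h ((SimpleGraph.mem_edgeSet H).2 hij) ((SimpleGraph.mem_edgeSet X).2 hX)
  · intro h e
    induction e with
    | _ i j => exact fun h1 h2 => h i j h1 h2

/-- The exponent in the asymptotic formula in terms of the parameters of the problem. -/
lemma missExp_eq {σ : ℝ} (d : Fin n → ℕ) (X : SimpleGraph (Fin n)) (hn : 1 < n)
    (hσ : (n : ℝ) * σ ^ 2 = 1) :
    missExp (lamb d) σ X (fun j => (d j : ℤ)) =
        lamb d * (xEdges X : ℝ) / ((1 - lamb d) * (n : ℝ))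
      + lamb d * xPow X 2 / (2 * (1 - lamb d) * (n : ℝ))
      + lamb d * (1 - 2 * lamb d) * xPow X 3 / (6 * (1 - lamb d)^2 * (n : ℝ)^2)
      + lamb d * (xEdges X : ℝ)^2 / ((1 - lamb d) * (n : ℝ)^2)
      - pairSum X (deltaPar d X) / (lamb d * (1 - lamb d) * (n : ℝ)^2)
      - cPar d X 1 1 / ((1 - lamb d) * (n : ℝ))
      - (1 - 2 * lamb d) * cPar d X 1 2 / (2 * (1 - lamb d)^2 * (n : ℝ)^2)
      - cPar d X 2 1 / (2 * (1 - lamb d)^2 * (n : ℝ)^2) := by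
  have hn0 : (n : ℝ) ≠ 0 := by positivity
  have hn1 : (n : ℝ) - 1 ≠ 0 := by
    have : (1 : ℝ) < n := by exact_mod_cast hn
    linarith
  have e0 : lamb d * ((n : ℝ) - 1) = dBar d := div_mul_cancel₀ _ hn1
  have e1 : exDeg (lamb d) X (fun j => (d j : ℤ)) = deltaPar d X := by
    funext j
    unfold exDeg deltaPar xDeg
    rw [e0, dg_eq_card]
    push_cast; ring
  have e2 : ∑ j, (dg X j : ℝ) = 2 * xEdges X := by exact_mod_cast sum_dg_eq X
  have e3 : σ ^ 2 = (n : ℝ)⁻¹ := eq_inv_of_mul_eq_one_right hσ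
  have e4 : σ ^ 4 = (n : ℝ)⁻¹ ^ 2 := by rw [← e3]; ring
  have e5 : ∀ j, (dg X j : ℝ) = xDeg X j := fun j => by rw [dg_eq_card]; rfl
  have e6 : adjForm X (deltaPar d X) / 2 = pairSum X (deltaPar d X) := rfl
  have e7 : ∑ j, vertexExp (lamb d) σ (dg X j) (deltaPar d X j)
      = lamb d * (1 - lamb d)⁻¹ * xPow X 2 * (n : ℝ)⁻¹ / 2
        + lamb d * (1 - 2 * lamb d) * (1 - lamb d)⁻¹ ^ 2 * xPow X 3 * (n : ℝ)⁻¹ ^ 2 / 6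
        - (1 - lamb d)⁻¹ * cPar d X 1 1 * (n : ℝ)⁻¹
        - (1 - 2 * lamb d) * (1 - lamb d)⁻¹ ^ 2 * cPar d X 1 2 * (n : ℝ)⁻¹ ^ 2 / 2
        - (1 - lamb d)⁻¹ ^ 2 * cPar d X 2 1 * (n : ℝ)⁻¹ ^ 2 / 2 := by
    unfold vertexExp xPow cPar
    simp only [e3, e4, e5, Finset.sum_sub_distrib, Finset.sum_add_distrib, ← Finset.sum_mul,
      ← Finset.mul_sum, ← Finset.sum_div, pow_one]
  unfold missExp
  rw [e1, e6, e7, e2, e3, e4]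
  simp only [div_eq_mul_inv, mul_inv, inv_pow]
  ring

lemma missPar_eq {q σ : ℝ} {d : Fin n → ℕ} {X : SimpleGraph (Fin n)} (hp : Par n (lamb d) q σ)
    (h : Good (lamb d) q σ 0 X (fun j => (d j : ℤ))) (he : Even (∑ j, d j)) :
    ∃ err : ℝ, |err| ≤ xEdges X * (q ^ 360 * σ ^ 3) ∧
      missPar d X = Real.exp (missExp (lamb d) σ X (fun j => (d j : ℤ)) + err) := by
  have he' : Even (∑ j, (d j : ℤ)) := by exact_mod_cast he
  have hl : 0 < 1 - lamb d := by linarith [hp.l_lt]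
  have hbot : Good (lamb d) q σ 0 (⊥ : SimpleGraph (Fin n)) (fun j => (d j : ℤ)) := by
    have hq := hp.q_pos
    have hs := inv_pos.2 hp.σ_pos
    refine ⟨h.deg, fun j => ?_, ?_, h.total⟩
    · simp [dg]; positivity
    · simp [dg]; positivity
  have h0 := cnt_bot_pos hp hbot he'
  obtain ⟨h1, h2⟩ := log_cnt hp he' (xEdges X) X (sum_dg_eq X) h
  refine ⟨_, h2, ?_⟩
  unfold missPar
  rw [gCount_eq, gCount_eq]
  have e1 : ∀ x y z w : ℝ, x + (y - z - w - x) = y - (w + z) := fun x y z w => by ring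
  rw [e1, Real.exp_sub, Real.exp_add, Real.exp_log h1, Real.exp_log h0, Real.exp_nat_mul,
    Real.exp_log hl]

end Bridge

section Asymptotics

lemma eventually_log_le {η : ℝ} (hη : 0 < η) (M : ℝ) :
    ∀ᶠ n : ℕ in atTop, M * Real.log n ≤ (n : ℝ) ^ η := by
  have h1 := ((isLittleO_log_rpow_atTop hη).comp_tendsto tendsto_natCast_atTop_atTop).def
    (show (0 : ℝ) < (|M| + 1)⁻¹ by positivity)
  filter_upwards [h1, eventually_ge_atTop 1] with n h2 hn
  have hn1 : (1 : ℝ) ≤ n := by exact_mod_cast hn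
  have h3 : 0 ≤ Real.log n := Real.log_nonneg hn1
  simp only [Function.comp_apply, Real.norm_eq_abs, abs_of_nonneg h3,
    abs_of_nonneg (Real.rpow_nonneg (by linarith : (0 : ℝ) ≤ n) η)] at h2
  have h4 : 0 < |M| + 1 := by positivity
  rw [inv_mul_eq_div, le_div_iff₀ h4] at h2
  nlinarith [le_abs_self M]

lemma eventually_const_le {η : ℝ} (hη : 0 < η) (M : ℝ) :
    ∀ᶠ n : ℕ in atTop, M ≤ (n : ℝ) ^ η :=
  ((tendsto_rpow_atTop hη).comp tendsto_natCast_atTop_atTop).eventually_ge_atTop M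

lemma par_of_large {n : ℕ} {η a l : ℝ} (hn : 2 ≤ n) (ha : 0 < a) (hη : 400 * η ≤ 1 / 2)
    (h16 : 16 ≤ (n : ℝ) ^ η) (hlog : 3 * a * Real.log n ≤ (n : ℝ) ^ η)
    (hlog' : 3 / 2 * Real.log n ≤ (n : ℝ) ^ η)
    (hl : (n : ℝ) / (3 * a * Real.log n)
      ≤ min (l * ((n : ℝ) - 1)) ((n : ℝ) - l * ((n : ℝ) - 1) - 1)) :
    Par n l ((n : ℝ) ^ η) ((n : ℝ) ^ (-(1 / 2) : ℝ)) := by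
  have hn0 : (0 : ℝ) < n := by positivity
  have hn2 : (2 : ℝ) ≤ n := by exact_mod_cast hn
  have hlogp : 0 < Real.log n := Real.log_pos (by linarith)
  have hL : 0 < 3 * a * Real.log n := by positivity
  have key : ∀ x : ℝ, (n : ℝ) / (3 * a * Real.log n) ≤ x * (n - 1) → 1 ≤ (n : ℝ) ^ η * x := by
    intro x hx
    rw [div_le_iff₀ hL] at hx
    have hx0 : 0 < x := by
      by_contra hc
      have : x * (n - 1) ≤ 0 := mul_nonpos_of_nonpos_of_nonneg (not_lt.1 hc) (by linarith)
      nlinarith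
    have h1 : (n : ℝ) ≤ (n : ℝ) ^ η * x * (n - 1) :=
      calc (n : ℝ) ≤ x * (n - 1) * (3 * a * Real.log n) := hx
        _ ≤ x * (n - 1) * (n : ℝ) ^ η :=
          mul_le_mul_of_nonneg_left hlog (mul_nonneg hx0.le (by linarith))
        _ = _ := by ring
    by_contra hc
    nlinarith
  refine ⟨h16, key l (hl.trans (min_le_left _ _)), key (1 - l) ?_, by positivity, ?_, ?_, ?_⟩
  · refine (hl.trans (min_le_right _ _)).trans (le_of_eq ?_); ring
  · rw [← Real.rpow_natCast, ← Real.rpow_mul hn0.le]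
    norm_num
    rw [Real.rpow_neg_one, mul_inv_cancel₀ hn0.ne']
  · rw [← Real.rpow_natCast, ← Real.rpow_mul hn0.le, ← Real.rpow_add hn0]
    refine Real.rpow_le_one_of_one_le_of_nonpos (by linarith) ?_
    push_cast; linarith
  · rw [← Real.rpow_natCast, ← Real.rpow_mul hn0.le,
      Real.rpow_def_of_pos hn0 (-(1 / 2) * ((3 : ℕ) : ℝ))]
    refine Real.exp_le_exp.2 ?_
    push_cast; linarith

lemma good_of_large {n : ℕ} {η C₁ C₂ C₃ : ℝ} {d : Fin n → ℕ} {X : SimpleGraph (Fin n)}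
    (hn : 2 ≤ n) (h1 : ∀ j, |(d j : ℝ) - dBar d| ≤ C₁ * (n : ℝ) ^ ((1 : ℝ) / 2 + η / 4))
    (h2 : ∀ j, (xDeg X j : ℝ) ≤ C₂ * (n : ℝ) ^ ((1 : ℝ) / 2 + η / 4))
    (h3 : (xEdges X : ℝ) ≤ C₃ * (n : ℝ) ^ ((1 : ℝ) + 2 * (η / 4)))
    (e1 : C₁ ≤ (n : ℝ) ^ (3 * η / 4)) (e2 : C₂ ≤ (n : ℝ) ^ (3 * η / 4))
    (e3 : 2 * C₃ ≤ (n : ℝ) ^ (η / 2)) :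
    Good (lamb d) ((n : ℝ) ^ η) ((n : ℝ) ^ (-(1 / 2) : ℝ)) 0 X (fun j => (d j : ℤ)) := by
  have hn0 : (0 : ℝ) < n := by positivity
  have hn1 : (n : ℝ) - 1 ≠ 0 := by
    have : (2 : ℝ) ≤ n := by exact_mod_cast hn
    linarith
  have e0 : lamb d * ((n : ℝ) - 1) = dBar d := div_mul_cancel₀ _ hn1
  have e4 : (n : ℝ) ^ η * ((n : ℝ) ^ (-(1 / 2) : ℝ))⁻¹ + 0
      = (n : ℝ) ^ (3 * η / 4) * (n : ℝ) ^ ((1 : ℝ) / 2 + η / 4) := by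
    rw [add_zero, ← Real.rpow_neg hn0.le, ← Real.rpow_add hn0, ← Real.rpow_add hn0]
    congr 1; ring
  refine ⟨fun j => ?_, fun j => ?_, ?_, ?_⟩
  · rw [e4, e0]
    refine le_trans ?_ (mul_le_mul_of_nonneg_right e1 (by positivity))
    exact_mod_cast h1 j
  · rw [e4, dg_eq_card]
    refine le_trans ?_ (mul_le_mul_of_nonneg_right e2 (by positivity))
    exact_mod_cast h2 j
  · have e5 : ∑ j, (dg X j : ℝ) = 2 * xEdges X := by exact_mod_cast sum_dg_eq X
    rw [e5, add_zero]
    calc (2 : ℝ) * xEdges X ≤ 2 * C₃ * (n : ℝ) ^ ((1 : ℝ) + 2 * (η / 4)) := by linarith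
      _ ≤ (n : ℝ) ^ (η / 2) * (n : ℝ) ^ ((1 : ℝ) + 2 * (η / 4)) := by gcongr
      _ = (n : ℝ) ^ (η + 1) := by
        rw [← Real.rpow_add hn0]; congr 1; ring
      _ = _ := Real.rpow_add_one hn0.ne' _
  · rw [e0]
    have : ∑ j, (((d j : ℤ) : ℝ) - dBar d) = 0 := by
      rw [Finset.sum_sub_distrib]
      unfold dBar
      simp only [Finset.sum_const, Finset.card_univ, Fintype.card_fin, nsmul_eq_mul,
        Int.cast_natCast]
      field_simp
      ring
    rw [this, abs_zero]

end Asymptotics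

/-- Theorem 2.1, first part: asymptotics of `miss(d,X)` under the conditions of the
main theorem. -/
theorem stmt3 (a b : ℝ) (ha : 0 < a) (hb : 0 < b) (hab : a + b < 1/2) :
    ∃ ε : ℝ, 0 < ε ∧
      ∀ (d : (n : ℕ) → Fin n → ℕ) (X : (n : ℕ) → SimpleGraph (Fin n)),
        (∀ n, Even (∑ j, d n j)) →
        (∃ C : ℝ, ∀ (n : ℕ) (j : Fin n),
            |(d n j : ℝ) - dBar (d n)| ≤ C * (n : ℝ) ^ ((1:ℝ)/2 + ε)) →
        (∃ C : ℝ, ∀ (n : ℕ) (j : Fin n),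
            (xDeg (X n) j : ℝ) ≤ C * (n : ℝ) ^ ((1:ℝ)/2 + ε)) →
        (∃ C : ℝ, ∀ n : ℕ, (xEdges (X n) : ℝ) ≤ C * (n : ℝ) ^ ((1:ℝ) + 2*ε)) →
        (∀ᶠ n : ℕ in atTop,
            (n : ℝ) / (3 * a * Real.log n) ≤ min (dBar (d n)) ((n : ℝ) - dBar (d n) - 1)) →
        ∃ C : ℝ, ∀ᶠ n : ℕ in atTop, ∃ err : ℝ, |err| ≤ C * (n : ℝ) ^ (-b) ∧
          missPar (d n) (X n) = Real.exp (
              lamb (d n) * (xEdges (X n) : ℝ) / ((1 - lamb (d n)) * (n : ℝ))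
            + lamb (d n) * xPow (X n) 2 / (2 * (1 - lamb (d n)) * (n : ℝ))
            + lamb (d n) * (1 - 2 * lamb (d n)) * xPow (X n) 3
                / (6 * (1 - lamb (d n))^2 * (n : ℝ)^2)
            + lamb (d n) * (xEdges (X n) : ℝ)^2 / ((1 - lamb (d n)) * (n : ℝ)^2)
            - pairSum (X n) (deltaPar (d n) (X n))
                / (lamb (d n) * (1 - lamb (d n)) * (n : ℝ)^2)
            - cPar (d n) (X n) 1 1 / ((1 - lamb (d n)) * (n : ℝ))
            - (1 - 2 * lamb (d n)) * cPar (d n) (X n) 1 2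
                / (2 * (1 - lamb (d n))^2 * (n : ℝ)^2)
            - cPar (d n) (X n) 2 1 / (2 * (1 - lamb (d n))^2 * (n : ℝ)^2)
            + err) := by
  set η : ℝ := (1 / 2 - b) / 400 with hη
  have hη0 : 0 < η := by
    have : 0 < 1 / 2 - b := by linarith
    positivity
  refine ⟨η / 4, by positivity, ?_⟩
  rintro d X heven ⟨C₁, h1⟩ ⟨C₂, h2⟩ ⟨C₃, h3⟩ h4
  refine ⟨|C₃|, ?_⟩
  filter_upwards [h4, eventually_ge_atTop 2, eventually_const_le hη0 16,
    eventually_log_le hη0 (3 * a), eventually_log_le hη0 (3 / 2),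
    eventually_const_le (by positivity : 0 < 3 * η / 4) C₁,
    eventually_const_le (by positivity : 0 < 3 * η / 4) C₂,
    eventually_const_le (by positivity : 0 < η / 2) (2 * C₃)] with n h4 hn h16 hlog hlog' e1 e2 e3
  have hn0 : (0 : ℝ) < n := by positivity
  have hn2 : (2 : ℝ) ≤ n := by exact_mod_cast hn
  have e0 : lamb (d n) * ((n : ℝ) - 1) = dBar (d n) := div_mul_cancel₀ _ (by linarith)
  have hp : Par n (lamb (d n)) ((n : ℝ) ^ η) ((n : ℝ) ^ (-(1 / 2) : ℝ)) :=
    par_of_large hn ha (by rw [hη]; linarith) h16 hlog hlog' (by rwa [e0])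
  have hg := good_of_large hn (h1 n) (h2 n) (h3 n) e1 e2 e3
  obtain ⟨err, herr, hmiss⟩ := missPar_eq hp hg (heven n)
  refine ⟨err, herr.trans ?_, ?_⟩
  · have e4 : ((n : ℝ) ^ η) ^ 360 * ((n : ℝ) ^ (-(1 / 2) : ℝ)) ^ 3
        = (n : ℝ) ^ (360 * η - 3 / 2) := by
      rw [← Real.rpow_natCast, ← Real.rpow_natCast, ← Real.rpow_mul hn0.le,
        ← Real.rpow_mul hn0.le, ← Real.rpow_add hn0]
      congr 1; push_cast; ring
    rw [e4]
    calc (xEdges (X n) : ℝ) * (n : ℝ) ^ (360 * η - 3 / 2)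
        ≤ (|C₃| * (n : ℝ) ^ ((1 : ℝ) + 2 * (η / 4))) * (n : ℝ) ^ (360 * η - 3 / 2) := by
          refine mul_le_mul_of_nonneg_right ((h3 n).trans ?_) (by positivity)
          exact mul_le_mul_of_nonneg_right (le_abs_self _) (by positivity)
      _ = |C₃| * (n : ℝ) ^ (((1 : ℝ) + 2 * (η / 4)) + (360 * η - 3 / 2)) := by
          rw [mul_assoc, ← Real.rpow_add hn0]
      _ ≤ |C₃| * (n : ℝ) ^ (-b) := by
          refine mul_le_mul_of_nonneg_left
            (Real.rpow_le_rpow_of_exponent_le (by linarith) ?_) (abs_nonneg _)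
          have : 400 * η = 1 / 2 - b := by rw [hη]; ring
          linarith
  · rw [hmiss, missExp_eq (d n) (X n) (by linarith) hp.n_eq]
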